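/- Let d, k ≥ 1 and let S₁, S₂ ⊂ I^d be closed cubes. Suppose that for every ν₁ ∈ S₁, ν₂ ∈ S₂, every t ∈ ℝ^k with |t| = 1 and ν ∈ {ν₁, ν₂}, we have det M(t,ν₁,ν₂,ν) ≠ 0, where M(t,ν₁,ν₂,ν) is the (d+k)×(d+k) block matrix with upper-left k×k block 0, upper-right block D(ν₁,ν₂), lower-left block D(ν₁,ν₂)^t, and lower-right block Σ_{i=1}^k t_i Hφ_i(ν). Then for every q ≥ 2 and p with 1/p + ((d+3k)/(d+k))·(1/(2q)) ≤ 1, there is a constant C such that ‖E₁f · E₂g‖_{L^q(ℝ^{d+k})} ≤ C ‖f‖_{L^p(ℝ^d)} ‖g‖_{L^p(ℝ^d)}. -/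

import Mathlib

open MeasureTheory ENNReal Matrix

noncomputable section

/-- The extension (adjoint restriction) operator associated to the surface
`ξ ↦ (ξ, Φ ξ)`, acting on functions supported in `S ⊆ I^d`, evaluated at
`w = (x, t) ∈ ℝ^d × ℝ^k`. -/
def extOp (d k : ℕ) (S : Set (Fin d → ℝ)) (Φ : (Fin d → ℝ) → Fin k → ℝ)
    (f : (Fin d → ℝ) → ℂ) (w : (Fin d → ℝ) × (Fin k → ℝ)) : ℂ :=
  ∫ ξ in S, Complex.exp (2 * Real.pi * Complex.I *
    (((∑ i, w.1 i * ξ i) + ∑ j, w.2 j * Φ ξ j : ℝ) : ℂ)) * f ξ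

/-- `S` is a closed cube in `ℝ^d` (an axis-parallel cube `∏ [aᵢ - r, aᵢ + r]`). -/
def IsClosedCube (d : ℕ) (S : Set (Fin d → ℝ)) : Prop :=
  ∃ (a : Fin d → ℝ) (r : ℝ), 0 ≤ r ∧ S = {x | ∀ i, |x i - a i| ≤ r}

/-- The gradient `∇φ(ν)` of a scalar function on `ℝ^d`, as a vector. -/
def gradPhi (d : ℕ) (φ : (Fin d → ℝ) → ℝ) (ν : Fin d → ℝ) : Fin d → ℝ :=
  fun i => fderiv ℝ φ ν (Pi.single i 1)

/-- The Hessian matrix `Hφ(ν)` of a scalar function on `ℝ^d`. -/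
def hessPhi (d : ℕ) (φ : (Fin d → ℝ) → ℝ) (ν : Fin d → ℝ) : Matrix (Fin d) (Fin d) ℝ :=
  Matrix.of fun i j => fderiv ℝ (fun x => fderiv ℝ φ x (Pi.single j 1)) ν (Pi.single i 1)

/-- The `k × d` matrix `D(ν₁, ν₂)` whose `j`-th row is `∇φⱼ(ν₂) - ∇φⱼ(ν₁)`. -/
def Dmat (d k : ℕ) (Φ : (Fin d → ℝ) → Fin k → ℝ) (ν₁ ν₂ : Fin d → ℝ) :
    Matrix (Fin k) (Fin d) ℝ :=
  Matrix.of fun j i => gradPhi d (fun x => Φ x j) ν₂ i - gradPhi d (fun x => Φ x j) ν₁ i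

/-- The matrix `∑ᵢ tᵢ Hφᵢ(ν)`. -/
def tHess (d k : ℕ) (Φ : (Fin d → ℝ) → Fin k → ℝ) (t : Fin k → ℝ) (ν : Fin d → ℝ) :
    Matrix (Fin d) (Fin d) ℝ :=
  ∑ i, t i • hessPhi d (fun x => Φ x i) ν

/-- The `(k+d) × (k+d)` block matrix `M(t, ν₁, ν₂, ν)` with blocks
`0, D(ν₁,ν₂); D(ν₁,ν₂)ᵗ, ∑ᵢ tᵢ Hφᵢ(ν)`. -/
def Mmat (d k : ℕ) (Φ : (Fin d → ℝ) → Fin k → ℝ) (t : Fin k → ℝ) (ν₁ ν₂ ν : Fin d → ℝ) :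
    Matrix (Fin k ⊕ Fin d) (Fin k ⊕ Fin d) ℝ :=
  Matrix.fromBlocks 0 (Dmat d k Φ ν₁ ν₂) (Dmat d k Φ ν₁ ν₂)ᵀ (tHess d k Φ t ν)

/-- A globally smooth function agreeing with `u⁻¹` on `[c, ∞)`. -/
theorem exists_contDiff_eq_inv (c : ℝ) (hc : 0 < c) :
    ∃ r : ℝ → ℝ, ContDiff ℝ (⊤ : ℕ∞) r ∧ ∀ u, c ≤ u → r u * u = 1 := by
  refine ⟨fun u => u / (u ^ 2 + Real.smoothTransition (1 - u / c)), ?_, ?_⟩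
  · refine contDiff_id.div ?_ ?_
    · exact (contDiff_id.pow 2).add (Real.smoothTransition.contDiff.comp
        (contDiff_const.sub (contDiff_id.div_const c)))
    · intro u
      rcases lt_or_ge u c with h | h
      · have : 0 < Real.smoothTransition (1 - u / c) :=
          Real.smoothTransition.pos_of_pos (by rw [sub_pos, div_lt_one hc]; exact h)
        positivity
      · have h1 : 0 < u := hc.trans_le h
        have := Real.smoothTransition.nonneg (1 - u / c)
        positivity
  · intro u hu
    have h1 : 0 < u := hc.trans_le hu
    have : Real.smoothTransition (1 - u / c) = 0 :=
      Real.smoothTransition.zero_of_nonpos (by rw [sub_nonpos, one_le_div hc]; exact hu)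
    simp only [this]
    field_simp
    simp

section Nonstationary

variable {Q W : Type*} [NormedAddCommGroup Q] [NormedSpace ℝ Q]
  [NormedAddCommGroup W] [NormedSpace ℝ W]

theorem hasFDerivAt_partial_right {f : Q × W → ℝ} (hf : ContDiff ℝ (⊤ : ℕ∞) f) (θ : Q) (Y : W) :
    HasFDerivAt (fun Y => f (θ, Y))
      ((fderiv ℝ f (θ, Y)).comp (ContinuousLinearMap.inr ℝ Q W)) Y := by
  have h := (hf.differentiable (by simp) (θ, Y)).hasFDerivAt
  exact h.comp Y (hasFDerivAt_prodMk_right θ Y)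

variable [FiniteDimensional ℝ W]
  [MeasurableSpace W] [BorelSpace W] (μ : Measure W) [μ.IsAddHaarMeasure]

theorem integral_exp_phase_by_parts {P u : W → ℝ} {P' u' : W → (W →L[ℝ] ℝ)} (e : W) (m : ℝ)
    (hP : ∀ Y, HasFDerivAt P (P' Y) Y) (hu : ∀ Y, HasFDerivAt u (u' Y) Y)
    (hP'c : Continuous fun Y => P' Y e) (hu'c : Continuous fun Y => u' Y e)
    (hsu : HasCompactSupport u) (hsu' : HasCompactSupport fun Y => u' Y e) :
    (m : ℂ) * ∫ Y, Complex.exp (Complex.I * (m * P Y : ℝ)) * ((P' Y e * u Y : ℝ) : ℂ) ∂μ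
      = Complex.I * ∫ Y, Complex.exp (Complex.I * (m * P Y : ℝ)) * ((u' Y e : ℝ) : ℂ) ∂μ := by
  have hPc : Continuous P := continuous_iff_continuousAt.2 fun Y => (hP Y).continuousAt
  have huc : Continuous u := continuous_iff_continuousAt.2 fun Y => (hu Y).continuousAt
  have hE : ∀ Y, HasFDerivAt (fun Y => Complex.exp (Complex.I * (m * P Y : ℝ)))
      (Complex.exp (Complex.I * (m * P Y : ℝ)) • (Complex.I • (Complex.ofRealCLM.comp
        (m • P' Y)))) Y := by
    intro Y
    have h1 : HasFDerivAt (fun Y => ((m * P Y : ℝ) : ℂ)) (Complex.ofRealCLM.comp (m • P' Y)) Y :=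
      Complex.ofRealCLM.hasFDerivAt.comp Y ((hP Y).const_mul m)
    exact (h1.const_mul Complex.I).cexp
  have hU : ∀ Y, HasFDerivAt (fun Y => ((u Y : ℝ) : ℂ)) (Complex.ofRealCLM.comp (u' Y)) Y :=
    fun Y => Complex.ofRealCLM.hasFDerivAt.comp Y (hu Y)
  have hEc : Continuous fun Y => Complex.exp (Complex.I * (m * P Y : ℝ)) := by fun_prop
  have key := integral_bilinear_hasFDerivAt_right_eq_neg_left_of_integrable (μ := μ)
    (f := fun Y => ((u Y : ℝ) : ℂ)) (g := fun Y => Complex.exp (Complex.I * (m * P Y : ℝ)))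
    (v := e) (B := ContinuousLinearMap.mul ℝ ℂ)
    (f' := fun Y => Complex.ofRealCLM.comp (u' Y))
    (g' := fun Y => (Complex.exp (Complex.I * (m * P Y : ℝ)) • (Complex.I •
      (Complex.ofRealCLM.comp (m • P' Y))))) ?_ ?_ ?_ (fun Y _ => hU Y) (fun Y _ => hE Y)
  · simp only [ContinuousLinearMap.mul_apply', ContinuousLinearMap.comp_apply,
      _root_.smul_apply, Complex.ofRealCLM_apply, smul_eq_mul] at key
    rw [← integral_const_mul]
    have h2 : ∀ Y, (m : ℂ) * (Complex.exp (Complex.I * (m * P Y : ℝ)) * ((P' Y e * u Y : ℝ) : ℂ))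
      = (-Complex.I) * ((u Y : ℂ) * (Complex.exp (Complex.I * (m * P Y : ℝ)) *
        (Complex.I * ((m * P' Y e : ℝ) : ℂ)))) := by
      intro Y
      push_cast
      linear_combination ((m : ℂ) * Complex.exp (Complex.I * (m * P Y)) * P' Y e * u Y) *
        Complex.I_mul_I
    simp_rw [h2]
    rw [integral_const_mul, key]
    simp only [neg_mul, mul_neg, neg_neg]
    congr 2
    ext Y
    ring
  · refine Continuous.integrable_of_hasCompactSupport ?_ ?_
    · simp only [ContinuousLinearMap.mul_apply', ContinuousLinearMap.comp_apply,
        Complex.ofRealCLM_apply]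
      exact (Complex.continuous_ofReal.comp hu'c).mul hEc
    · refine hsu'.mono ?_
      intro Y hY
      simp only [Function.mem_support, ContinuousLinearMap.mul_apply',
        ContinuousLinearMap.comp_apply, Complex.ofRealCLM_apply] at hY ⊢
      intro h; simp [h] at hY
  · refine Continuous.integrable_of_hasCompactSupport ?_ ?_
    · simp only [ContinuousLinearMap.mul_apply', ContinuousLinearMap.comp_apply,
        _root_.smul_apply, Complex.ofRealCLM_apply, smul_eq_mul]
      exact (Complex.continuous_ofReal.comp huc).mul (hEc.mul (continuous_const.mul
        (Complex.continuous_ofReal.comp (continuous_const.mul hP'c))))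
    · refine hsu.mono ?_
      intro Y hY
      simp only [Function.mem_support, ContinuousLinearMap.mul_apply'] at hY ⊢
      intro h; simp [h] at hY
  · refine Continuous.integrable_of_hasCompactSupport ?_ ?_
    · simp only [ContinuousLinearMap.mul_apply']
      exact (Complex.continuous_ofReal.comp huc).mul hEc
    · refine hsu.mono ?_
      intro Y hY
      simp only [Function.mem_support, ContinuousLinearMap.mul_apply'] at hY ⊢
      intro h; simp [h] at hY

/-- Non-stationary phase with parameters: rapid decay, uniform over a compact parameter set. -/
theorem nonstationary_phase {P : Q × W → ℝ} (hP : ContDiff ℝ (⊤ : ℕ∞) P)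
    {e : Q → W} (he : ContDiff ℝ (⊤ : ℕ∞) e) {K K' : Set Q} (hK : IsCompact K) (hK' : K' ⊆ K)
    {L : Set W} (hL : IsCompact L) {c : ℝ} (hc : 0 < c)
    (hpos : ∀ θ ∈ K', ∀ Y ∈ L, c ≤ fderiv ℝ P (θ, Y) (0, e θ)) (N : ℕ) :
    ∀ a : Q × W → ℝ, ContDiff ℝ (⊤ : ℕ∞) a → (∀ θ ∈ K', ∀ Y ∉ L, a (θ, Y) = 0) →
    ∃ C : ℝ, ∀ θ ∈ K', ∀ m : ℝ, 0 ≤ m →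
      m ^ N * ‖∫ Y, Complex.exp (Complex.I * (m * P (θ, Y) : ℝ)) * ((a (θ, Y) : ℝ) : ℂ) ∂μ‖ ≤ C := by
  induction N with
  | zero =>
    intro a ha has
    obtain ⟨B, hB⟩ := (hK.prod hL).exists_bound_of_continuousOn ha.continuous.continuousOn
    refine ⟨B * μ.real L, fun θ hθ m _ => ?_⟩
    rw [pow_zero, one_mul, ← setIntegral_eq_integral_of_forall_compl_eq_zero (s := L)]
    · refine norm_setIntegral_le_of_norm_le_const hL.measure_lt_top fun Y hY => ?_
      rw [norm_mul, mul_comm Complex.I, Complex.norm_exp_ofReal_mul_I, one_mul, Complex.norm_real]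
      exact hB _ ⟨hK' hθ, hY⟩
    · intro Y hY
      simp [has θ hθ Y hY]
  | succ N ih =>
    intro a ha has
    obtain ⟨r, hr, hr1⟩ := exists_contDiff_eq_inv c hc
    have hv : ContDiff ℝ (⊤ : ℕ∞) (fun z : Q × W => ((0 : Q), e z.1)) :=
      contDiff_const.prodMk (he.comp contDiff_fst)
    have hD : ∀ f : Q × W → ℝ, ContDiff ℝ (⊤ : ℕ∞) f →
        ContDiff ℝ (⊤ : ℕ∞) (fun z => fderiv ℝ f z (0, e z.1)) := fun f hf =>
      (hf.fderiv_right (m := (⊤ : ℕ∞)) (by simp)).clm_apply hv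
    set u : Q × W → ℝ := fun z => r (fderiv ℝ P z (0, e z.1)) * a z with hu
    have hus : ContDiff ℝ (⊤ : ℕ∞) u := (hr.comp (hD P hP)).mul ha
    have hu0 : ∀ θ ∈ K', ∀ Y ∉ L, u (θ, Y) = 0 := fun θ hθ Y hY => by
      simp [hu, has θ hθ Y hY]
    have hb0 : ∀ θ ∈ K', ∀ Y ∉ L, fderiv ℝ u (θ, Y) (0, e θ) = 0 := by
      intro θ hθ Y hY
      have h1 := hasFDerivAt_partial_right hus θ Y
      have h2 : (fun Y => u (θ, Y)) =ᶠ[nhds Y] fun _ => 0 := by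
        filter_upwards [hL.isClosed.isOpen_compl.mem_nhds hY] with Z hZ using hu0 θ hθ Z hZ
      have h3 := (h1.congr_of_eventuallyEq h2.symm).unique (hasFDerivAt_const 0 Y)
      have := DFunLike.congr_fun h3 (e θ)
      simpa using this
    obtain ⟨C, hC⟩ := ih _ (hD u hus) hb0
    refine ⟨C, fun θ hθ m hm => ?_⟩
    have hcs : ∀ f : W → ℝ, (∀ Y ∉ L, f Y = 0) → HasCompactSupport f := fun f hf =>
      HasCompactSupport.intro hL hf
    have key := integral_exp_phase_by_parts μ (P := fun Y => P (θ, Y)) (u := fun Y => u (θ, Y))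
      (e θ) m (hasFDerivAt_partial_right hP θ) (hasFDerivAt_partial_right hus θ)
      (by simpa [Function.comp_def] using (hD P hP).continuous.comp (Continuous.prodMk_right θ))
      (by simpa [Function.comp_def] using (hD u hus).continuous.comp (Continuous.prodMk_right θ))
      (hcs _ (hu0 θ hθ)) (hcs _ (by simpa using hb0 θ hθ))
    have h4 : ∀ Y, ((fderiv ℝ P (θ, Y)).comp (ContinuousLinearMap.inr ℝ Q W)) (e θ) * u (θ, Y)
        = a (θ, Y) := by
      intro Y
      simp only [ContinuousLinearMap.comp_apply, ContinuousLinearMap.inr_apply, hu]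
      by_cases hY : Y ∈ L
      · rw [← mul_assoc, mul_comm _ (r _), hr1 _ (hpos θ hθ Y hY), one_mul]
      · simp [has θ hθ Y hY]
    simp_rw [h4] at key
    have h5 := congrArg norm key
    rw [norm_mul, norm_mul, Complex.norm_I, one_mul, Complex.norm_real, Real.norm_of_nonneg hm] at h5
    rw [pow_succ, mul_assoc, h5]
    exact hC θ hθ m hm

end Nonstationary

open scoped Convolution in
/-- A parametric integral over `[0,1]` of a jointly smooth function is smooth. -/
theorem contDiff_integral_zero_one {V : Type*} [NormedAddCommGroup V] [NormedSpace ℝ V]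
    {F : V × ℝ → ℝ} (hF : ContDiff ℝ (⊤ : ℕ∞) F) :
    ContDiff ℝ (⊤ : ℕ∞) fun q => ∫ s in (0 : ℝ)..1, F (q, s) := by
  let χ : ContDiffBump (0 : ℝ) := ⟨1, 2, by norm_num, by norm_num⟩
  let g : V → ℝ → ℝ := fun q x => F (q, -x) * χ x
  have hχ : ContDiff ℝ (⊤ : ℕ∞) (χ : ℝ → ℝ) := χ.contDiff
  have hg : ContDiff ℝ (⊤ : ℕ∞) (fun z : V × ℝ => g z.1 z.2) :=
    (hF.comp (contDiff_fst.prodMk contDiff_snd.neg)).mul (hχ.comp contDiff_snd)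
  have hloc : LocallyIntegrable (Set.indicator (Set.Ioc (0 : ℝ) 1) (fun _ => (1 : ℝ))) volume :=
    (integrable_indicator_iff measurableSet_Ioc).2 (by simp) |>.locallyIntegrable
  have key := contDiffOn_convolution_right_with_param (𝕜 := ℝ) (n := (⊤ : ℕ∞)) (μ := volume)
    (ContinuousLinearMap.mul ℝ ℝ) (g := g) (s := Set.univ) (k := Metric.closedBall (0 : ℝ) 2)
    isOpen_univ (isCompact_closedBall _ _) (fun p x _ hx => by
      have : χ x = 0 := χ.zero_of_le_dist (by
        rw [Metric.mem_closedBall, not_le] at hx; exact hx.le)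
      simp [g, this]) hloc (hg.contDiffOn)
  rw [Set.univ_prod_univ, contDiffOn_univ] at key
  have h0 : ContDiff ℝ (⊤ : ℕ∞) fun q : V => (q, (0 : ℝ)) := contDiff_id.prodMk contDiff_const
  convert key.comp h0 using 1
  ext q
  simp only [Function.comp, convolution, ContinuousLinearMap.mul_apply']
  rw [intervalIntegral.integral_of_le zero_le_one, ← integral_indicator measurableSet_Ioc]
  refine integral_congr_ae (Filter.Eventually.of_forall fun s => ?_)
  by_cases hs : s ∈ Set.Ioc (0 : ℝ) 1
  · have : χ (-s) = 1 := χ.one_of_mem_closedBall (by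
      simp only [χ, Metric.mem_closedBall, dist_zero_right, norm_neg, Real.norm_eq_abs, abs_le]
      exact ⟨by linarith [hs.1], hs.2⟩)
    simp [hs, g, this]
  · simp [hs]

/-- Hadamard's lemma for difference quotients of a smooth function. -/
theorem exists_contDiff_difference_quotient {V : Type*} [NormedAddCommGroup V] [NormedSpace ℝ V]
    {f : V → ℝ} (hf : ContDiff ℝ (⊤ : ℕ∞) f) :
    ∃ h : V × V × ℝ → ℝ, ContDiff ℝ (⊤ : ℕ∞) h ∧
      ∀ a ω ρ, f a - f (a - ρ • ω) = ρ * h (a, ω, ρ) := by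
  refine ⟨fun q => ∫ s in (0 : ℝ)..1, fderiv ℝ f (q.1 - (s * q.2.2) • q.2.1) q.2.1,
    contDiff_integral_zero_one (F := fun z : (V × V × ℝ) × ℝ =>
      fderiv ℝ f (z.1.1 - (z.2 * z.1.2.2) • z.1.2.1) z.1.2.1) ?_, fun a ω ρ => ?_⟩
  · refine ContDiff.clm_apply ((hf.fderiv_right (m := (⊤ : ℕ∞)) (by simp)).comp ?_) ?_
    · fun_prop
    · fun_prop
  · have hd : ∀ s : ℝ, HasDerivAt (fun s : ℝ => -f (a - (s * ρ) • ω))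
        (ρ * fderiv ℝ f (a - (s * ρ) • ω) ω) s := by
      intro s
      have h1 : HasDerivAt (fun s : ℝ => a - (s * ρ) • ω) (-(ρ • ω)) s := by
        simpa using (((hasDerivAt_id s).mul_const ρ).smul_const ω).const_sub a
      have h2 := ((hf.differentiable (by simp) (a - (s * ρ) • ω)).hasFDerivAt.comp_hasDerivAt s
        h1).neg
      simpa [Function.comp_def] using! h2
    have hc : Continuous fun s : ℝ => ρ * fderiv ℝ f (a - (s * ρ) • ω) ω := by
      have := (hf.continuous_fderiv (by simp))
      fun_prop
    have := intervalIntegral.integral_eq_sub_of_hasDerivAt (fun s _ => hd s)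
      (hc.intervalIntegrable 0 1)
    rw [← intervalIntegral.integral_const_mul, this]
    simp
    ring

section Kernel

variable {Q V W : Type*} [NormedAddCommGroup Q] [NormedSpace ℝ Q]
  [NormedAddCommGroup V] [NormedSpace ℝ V] [FiniteDimensional ℝ V]
  [NormedAddCommGroup W] [NormedSpace ℝ W] [FiniteDimensional ℝ W]
  [MeasurableSpace W] [BorelSpace W] (μ : Measure W) [μ.IsAddHaarMeasure]

/-- Decay of the `T T*` kernel of a nondegenerate oscillatory integral operator. -/
theorem oscillatory_kernel_decay {S a : Q × V × W → ℝ} (hS : ContDiff ℝ (⊤ : ℕ∞) S)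
    (ha : ContDiff ℝ (⊤ : ℕ∞) a) (A : V →L[ℝ] W) {KP : Set Q} {KV : Set V} {L : Set W}
    (hKP : IsCompact KP) (hKV : IsCompact KV) (hL : IsCompact L) {c : ℝ} (hc : 0 < c)
    (ha0 : ∀ p ∈ KP, ∀ X ∈ KV, ∀ Y ∉ L, a (p, X, Y) = 0)
    (hNS : ∀ p ∈ KP, ∀ X ∈ KV, ∀ Z ∈ KV, ∀ Y ∈ L, c * ‖X - Z‖ ^ 2 ≤
      fderiv ℝ (fun Y => S (p, X, Y) - S (p, Z, Y)) Y (A (X - Z))) (N : ℕ) :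
    ∃ C : ℝ, 0 ≤ C ∧ ∀ p ∈ KP, ∀ X ∈ KV, ∀ Z ∈ KV, ∀ s : ℝ, 0 < s →
      ‖∫ Y, Complex.exp (Complex.I * (s * (S (p, X, Y) - S (p, Z, Y)) : ℝ)) *
        ((a (p, X, Y) * a (p, Z, Y) : ℝ) : ℂ) ∂μ‖ ≤ C * (1 + s * ‖X - Z‖) ^ (-(N : ℝ)) := by
  obtain ⟨h, hh, hhS⟩ := exists_contDiff_difference_quotient hS
  let P : (Q × V × V × ℝ) × W → ℝ := fun z =>
    h ((z.1.1, z.1.2.1, z.2), ((0 : Q), z.1.2.2.1, (0 : W)), z.1.2.2.2)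
  let b : (Q × V × V × ℝ) × W → ℝ := fun z =>
    a (z.1.1, z.1.2.1, z.2) * a (z.1.1, z.1.2.1 - z.1.2.2.2 • z.1.2.2.1, z.2)
  have hP : ContDiff ℝ (⊤ : ℕ∞) P := by
    refine hh.comp ?_
    fun_prop
  have hb : ContDiff ℝ (⊤ : ℕ∞) b := by
    refine (ha.comp ?_).mul (ha.comp ?_) <;> fun_prop
  obtain ⟨R, hR⟩ := hKV.isBounded.exists_norm_le
  let K : Set (Q × V × V × ℝ) :=
    KP ×ˢ (KV ×ˢ (Metric.sphere (0 : V) 1 ×ˢ Set.Icc (0 : ℝ) (R + R)))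
  let K' : Set (Q × V × V × ℝ) := {θ | θ ∈ K ∧ 0 < θ.2.2.2 ∧ θ.2.1 - θ.2.2.2 • θ.2.2.1 ∈ KV}
  have : ProperSpace V := FiniteDimensional.proper_real V
  have hK : IsCompact K := hKP.prod (hKV.prod ((isCompact_sphere _ _).prod isCompact_Icc))
  have hPS : ∀ p X ω ρ Y, S (p, X, Y) - S (p, X - ρ • ω, Y) = ρ * P ((p, X, ω, ρ), Y) := by
    intro p X ω ρ Y
    have := hhS (p, X, Y) ((0 : Q), ω, (0 : W)) ρ
    simpa [P] using this
  obtain ⟨C1, hC1⟩ := nonstationary_phase μ hP (e := fun θ => A θ.2.2.1)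
    (A.contDiff.comp (by fun_prop)) hK (K' := K') (fun θ hθ => hθ.1) hL hc (by
      rintro ⟨p, X, ω, ρ⟩ ⟨⟨hp, hX, hω, hρ⟩, hρ0, hZ⟩ Y hY
      simp only at hp hX hω hρ hρ0 hZ ⊢
      have h1 := hNS p hp X hX _ hZ Y hY
      have hω1 : ‖ω‖ = 1 := by simpa using hω
      have h2 : (fun Y => S (p, X, Y) - S (p, X - ρ • ω, Y)) =
          fun Y => ρ * P ((p, X, ω, ρ), Y) := by
        ext Y; exact hPS p X ω ρ Y
      rw [h2, ((hasFDerivAt_partial_right hP (p, X, ω, ρ) Y).const_mul ρ).fderiv] at h1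
      simp only [_root_.sub_sub_cancel, norm_smul, hω1, map_smul, _root_.smul_apply,
        ContinuousLinearMap.comp_apply, ContinuousLinearMap.inr_apply, smul_eq_mul,
        Real.norm_of_nonneg hρ0.le, mul_one] at h1
      have h3 : ρ ^ 2 * c ≤ ρ ^ 2 * fderiv ℝ P ((p, X, ω, ρ), Y) (0, A ω) := by
        nlinarith
      exact le_of_mul_le_mul_left h3 (by positivity)) N b hb (by
      rintro ⟨p, X, ω, ρ⟩ ⟨⟨hp, hX, hω, hρ⟩, hρ0, hZ⟩ Y hY
      simp only [b]
      rw [ha0 p hp X hX Y hY, zero_mul])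
  obtain ⟨B, hB⟩ := (hKP.prod (hKV.prod hL)).exists_bound_of_continuousOn ha.continuous.continuousOn
  have hC1' : 0 ≤ max C1 0 := le_max_right _ _
  have hC0 : 0 ≤ B ^ 2 * μ.real L := by positivity
  refine ⟨2 ^ N * (2 * (B ^ 2 * μ.real L + max C1 0)), by positivity, fun p hp X hX Z hZ s hs => ?_⟩
  set k := ‖∫ Y, Complex.exp (Complex.I * (s * (S (p, X, Y) - S (p, Z, Y)) : ℝ)) *
        ((a (p, X, Y) * a (p, Z, Y) : ℝ) : ℂ) ∂μ‖ with hk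
  have hk0 : k ≤ B ^ 2 * μ.real L := by
    rw [hk, ← setIntegral_eq_integral_of_forall_compl_eq_zero (s := L)]
    · refine norm_setIntegral_le_of_norm_le_const hL.measure_lt_top fun Y hY => ?_
      rw [norm_mul, mul_comm Complex.I, Complex.norm_exp_ofReal_mul_I, one_mul, Complex.norm_real,
        norm_mul, sq]
      have h1 := hB (p, X, Y) ⟨hp, hX, hY⟩
      have h2 := hB (p, Z, Y) ⟨hp, hZ, hY⟩
      exact mul_le_mul h1 h2 (norm_nonneg _) ((norm_nonneg _).trans h1)
    · intro Y hY
      simp [ha0 p hp X hX Y hY]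
  have hk1 : (s * ‖X - Z‖) ^ N * k ≤ B ^ 2 * μ.real L + max C1 0 := by
    by_cases hXZ : X = Z
    · rcases Nat.eq_zero_or_pos N with rfl | hN
      · simpa using hk0.trans (le_add_of_nonneg_right hC1')
      · rw [hXZ, sub_self, norm_zero, mul_zero, zero_pow hN.ne', zero_mul]
        positivity
    · set ρ := ‖X - Z‖ with hρ
      have hρ0 : 0 < ρ := norm_pos_iff.2 (sub_ne_zero.2 hXZ)
      set ω := ρ⁻¹ • (X - Z) with hω
      have hZ' : X - ρ • ω = Z := by
        rw [hω, smul_smul, mul_inv_cancel₀ hρ0.ne', one_smul, _root_.sub_sub_cancel]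
      have hω1 : ‖ω‖ = 1 := by
        rw [hω, norm_smul, norm_inv, norm_norm, inv_mul_cancel₀ hρ0.ne']
      have := hC1 (p, X, ω, ρ) ⟨⟨hp, hX, by simpa using hω1, hρ0.le,
        (norm_sub_le _ _).trans (add_le_add (hR X hX) (hR Z hZ))⟩, hρ0, by simpa [hZ'] using hZ⟩
        (s * ρ) (by positivity)
      simp only [b, hZ'] at this
      have h3 : ∀ Y, s * ρ * P ((p, X, ω, ρ), Y) = s * (S (p, X, Y) - S (p, Z, Y)) := by
        intro Y
        rw [← hZ', hPS, mul_assoc]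
      simp_rw [h3] at this
      exact this.trans ((le_max_left _ _).trans (le_add_of_nonneg_left hC0))
  have hpos : 0 < 1 + s * ‖X - Z‖ := by positivity
  rw [Real.rpow_neg hpos.le, Real.rpow_natCast, ← div_eq_mul_inv, le_div_iff₀ (by positivity)]
  have hk2 : 0 ≤ k := norm_nonneg _
  have h4 := add_pow_le (zero_le_one (α := ℝ)) (by positivity : 0 ≤ s * ‖X - Z‖) N
  rw [one_pow] at h4
  have h5 : (2 : ℝ) ^ (N - 1) ≤ 2 ^ N := pow_le_pow_right₀ (by norm_num) (Nat.sub_le _ _)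
  calc k * (1 + s * ‖X - Z‖) ^ N
      ≤ k * (2 ^ N * (1 + (s * ‖X - Z‖) ^ N)) := by
        refine mul_le_mul_of_nonneg_left (h4.trans ?_) hk2
        gcongr
    _ = 2 ^ N * (k + (s * ‖X - Z‖) ^ N * k) := by ring
    _ ≤ _ := by
        gcongr
        linarith
end Kernel

/-- Cauchy–Schwarz against a bounded function on a set of finite measure. -/
theorem norm_setIntegral_mul_sq_le {W : Type*} [MeasurableSpace W] {μ : Measure W} {F : Set W}
    (hF : μ F ≠ ∞) {v T : W → ℂ} (hv : AEStronglyMeasurable v (μ.restrict F))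
    (hv1 : ∀ y, ‖v y‖ ≤ 1) (hT : MemLp T 2 μ) :
    ‖∫ y in F, v y * T y ∂μ‖ ^ 2 ≤ μ.real F * ∫ y, ‖T y‖ ^ 2 ∂μ := by
  have : IsFiniteMeasure (μ.restrict F) := ⟨by simpa using hF.lt_top⟩
  have hT' : MemLp T 2 (μ.restrict F) := hT.restrict F
  have hv' : MemLp v 2 (μ.restrict F) := MemLp.of_bound hv 1 (Filter.Eventually.of_forall hv1)
  have h1 : ‖∫ y in F, v y * T y ∂μ‖ ≤ ∫ y in F, ‖v y‖ * ‖T y‖ ∂μ := by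
    refine (norm_integral_le_integral_norm _).trans_eq ?_
    simp_rw [norm_mul]
  have h2 := integral_mul_norm_le_Lp_mul_Lq (μ := μ.restrict F) (p := 2) (q := 2)
    (f := v) (g := T) Real.HolderConjugate.two_two (by simpa using hv') (by simpa using hT')
  have h3 : ∫ y in F, ‖v y‖ ^ (2 : ℝ) ∂μ ≤ μ.real F := by
    have : ∫ y in F, ‖v y‖ ^ (2 : ℝ) ∂μ ≤ ∫ y in F, (1 : ℝ) ∂μ := by
      refine integral_mono_of_nonneg (Filter.Eventually.of_forall fun y => by positivity)
        (integrable_const _) (Filter.Eventually.of_forall fun y => ?_)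
      exact Real.rpow_le_one (norm_nonneg _) (hv1 y) (by norm_num)
    simpa using this
  have h4 : ∫ y in F, ‖T y‖ ^ (2 : ℝ) ∂μ ≤ ∫ y, ‖T y‖ ^ 2 ∂μ := by
    simp_rw [Real.rpow_two]
    refine setIntegral_le_integral ?_ (Filter.Eventually.of_forall fun y => by positivity)
    exact hT.integrable_norm_pow (by norm_num)
  have h5 : 0 ≤ ∫ y in F, ‖v y‖ ^ (2 : ℝ) ∂μ := integral_nonneg fun y => by positivity
  have h6 : 0 ≤ ∫ y in F, ‖T y‖ ^ (2 : ℝ) ∂μ := integral_nonneg fun y => by positivity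
  have h8 : ∀ x : ℝ, 0 ≤ x → (x ^ ((1 : ℝ) / 2)) ^ 2 = x := fun x hx => by
    rw [← Real.sqrt_eq_rpow, Real.sq_sqrt hx]
  have h7 := pow_le_pow_left₀ (norm_nonneg _) (h1.trans h2) 2
  rw [mul_pow, h8 _ h5, h8 _ h6] at h7
  exact h7.trans (mul_le_mul h3 h4 h6 measureReal_nonneg)

section Hormander

variable {Q V W : Type*} [NormedAddCommGroup Q] [NormedSpace ℝ Q]
  [NormedAddCommGroup V] [NormedSpace ℝ V] [FiniteDimensional ℝ V]
  [MeasurableSpace V] [BorelSpace V] (μV : Measure V) [μV.IsAddHaarMeasure]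
  [NormedAddCommGroup W] [NormedSpace ℝ W] [FiniteDimensional ℝ W]
  [MeasurableSpace W] [BorelSpace W] (μ : Measure W) [μ.IsAddHaarMeasure]

/-- The scaled kernel `(1 + s‖X - Z‖)^{-N}` has mass `O(s^{-dim V})`. -/
theorem integral_one_add_smul_norm {N : ℕ} (s : ℝ) (hs : 0 < s) (X : V) :
    ∫ Z, (1 + s * ‖X - Z‖) ^ (-(N : ℝ)) ∂μV =
      (s ^ Module.finrank ℝ V)⁻¹ * ∫ Z, (1 + ‖Z‖) ^ (-(N : ℝ)) ∂μV := by
  have h := Measure.integral_comp_smul μV (fun Z : V => (1 + ‖Z‖) ^ (-(N : ℝ))) s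
  rw [integral_sub_left_eq_self (fun Z : V => (1 + s * ‖Z‖) ^ (-(N : ℝ)))]
  simp only [norm_smul, Real.norm_of_nonneg hs.le, smul_eq_mul] at h
  rw [h, abs_of_pos (by positivity)]

theorem integrable_one_add_smul_norm {N : ℕ} (hN : Module.finrank ℝ V < N) (s : ℝ) (hs : 0 < s)
    (X : V) : Integrable (fun Z => (1 + s * ‖X - Z‖) ^ (-(N : ℝ))) μV := by
  have h0 : Integrable (fun Z : V => (1 + ‖Z‖) ^ (-(N : ℝ))) μV :=
    integrable_one_add_norm (by exact_mod_cast hN)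
  have h1 := h0.comp_smul hs.ne'
  simp only [norm_smul, Real.norm_of_nonneg hs.le] at h1
  exact h1.comp_sub_left X

/-- Hörmander's `L²` estimate for nondegenerate oscillatory integral operators, in bilinear form. -/
theorem oscillatory_bilinear_bound {S a : Q × V × W → ℝ} (hS : ContDiff ℝ (⊤ : ℕ∞) S)
    (ha : ContDiff ℝ (⊤ : ℕ∞) a) (A : V →L[ℝ] W) {KP : Set Q} {KV : Set V} {L : Set W}
    (hKP : IsCompact KP) (hKV : IsCompact KV) (hL : IsCompact L) {c : ℝ} (hc : 0 < c)
    (ha0 : ∀ p ∈ KP, ∀ X ∈ KV, ∀ Y ∉ L, a (p, X, Y) = 0)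
    (hNS : ∀ p ∈ KP, ∀ X ∈ KV, ∀ Z ∈ KV, ∀ Y ∈ L, c * ‖X - Z‖ ^ 2 ≤
      fderiv ℝ (fun Y => S (p, X, Y) - S (p, Z, Y)) Y (A (X - Z))) :
    ∃ C : ℝ, 0 ≤ C ∧ ∀ p ∈ KP, ∀ E ⊆ KV, MeasurableSet E → ∀ F : Set W, μ F ≠ ∞ →
      ∀ (u : V → ℂ) (v : W → ℂ), Measurable u → (∀ X, ‖u X‖ ≤ 1) → Measurable v →
      (∀ Y, ‖v Y‖ ≤ 1) → ∀ s : ℝ, 0 < s →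
      ‖∫ Y in F, v Y * ∫ X in E, u X * (Complex.exp (Complex.I * (s * S (p, X, Y) : ℝ)) *
        (a (p, X, Y) : ℂ)) ∂μV ∂μ‖ ^ 2 ≤
        C * (s ^ Module.finrank ℝ V)⁻¹ * μV.real E * μ.real F := by
  obtain ⟨C, hC0, hC⟩ := oscillatory_kernel_decay μ hS ha A hKP hKV hL hc ha0 hNS
    (Module.finrank ℝ V + 1)
  have hI0 : 0 ≤ ∫ Z, (1 + ‖Z‖) ^ (-((Module.finrank ℝ V + 1 : ℕ) : ℝ)) ∂μV :=
    integral_nonneg fun Z => by positivity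
  refine ⟨C * ∫ Z, (1 + ‖Z‖) ^ (-((Module.finrank ℝ V + 1 : ℕ) : ℝ)) ∂μV, by positivity, ?_⟩
  intro p hp E hE hEm F hF u v hu hu1 hv hv1 s hs
  have : ProperSpace V := FiniteDimensional.proper_real V
  have : ProperSpace W := FiniteDimensional.proper_real W
  have hEfin : μV E ≠ ∞ := ((measure_mono hE).trans_lt hKV.measure_lt_top).ne
  let ν := μV.restrict E
  have : IsFiniteMeasure ν := ⟨by simpa [ν] using hEfin.lt_top⟩
  let ρ := μ.restrict L
  have : IsFiniteMeasure ρ := ⟨by simpa [ρ] using hL.measure_lt_top⟩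
  obtain ⟨B, hB⟩ := (hKP.prod (hKV.prod hL)).exists_bound_of_continuousOn ha.continuous.continuousOn
  let G : V → W → ℂ := fun X Y => u X * (Complex.exp (Complex.I * (s * S (p, X, Y) : ℝ)) *
        (a (p, X, Y) : ℂ))
  have hGm : Measurable fun z : V × W => G z.1 z.2 := by
    have h1 : Continuous fun z : V × W => S (p, z.1, z.2) := hS.continuous.comp (by fun_prop)
    have h2 : Continuous fun z : V × W => a (p, z.1, z.2) := ha.continuous.comp (by fun_prop)
    exact (hu.comp measurable_fst).mul (by fun_prop : Continuous _).measurable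
  have hGB : ∀ X ∈ E, ∀ Y, ‖G X Y‖ ≤ max B 0 := by
    intro X hX Y
    simp only [G]
    rw [norm_mul, norm_mul, mul_comm Complex.I, Complex.norm_exp_ofReal_mul_I, one_mul,
      Complex.norm_real]
    by_cases hY : Y ∈ L
    · have := hB (p, X, Y) ⟨hp, hE hX, hY⟩
      calc _ ≤ 1 * ‖a (p, X, Y)‖ := by gcongr; exact hu1 X
        _ ≤ _ := by rw [one_mul]; exact this.trans (le_max_left _ _)
    · simp [ha0 p hp X (hE hX) Y hY]
  let T : W → ℂ := fun Y => ∫ X, G X Y ∂ν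
  have hTm : StronglyMeasurable T := by
    have : StronglyMeasurable (Function.uncurry fun Y X => G X Y) :=
      (hGm.comp measurable_swap).stronglyMeasurable
    exact this.integral_prod_right
  have hT0 : ∀ Y ∉ L, T Y = 0 := by
    intro Y hY
    refine setIntegral_eq_zero_of_forall_eq_zero fun X hX => ?_
    simp [G, ha0 p hp X (hE hX) Y hY]
  have hTB : ∀ Y, ‖T Y‖ ≤ max B 0 * μV.real E := fun Y =>
    norm_setIntegral_le_of_norm_le_const hEfin.lt_top fun X hX => hGB X hX Y
  have hT2 : MemLp T 2 μ := by
    have h1 : MemLp T 2 ρ := MemLp.of_bound hTm.aestronglyMeasurable _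
      (Filter.Eventually.of_forall hTB)
    have h2 : T = L.indicator T := by
      ext Y
      by_cases hY : Y ∈ L
      · simp [hY]
      · simp [hY, hT0 Y hY]
    rw [h2]
    exact (memLp_indicator_iff_restrict hL.measurableSet).2 h1
  refine (norm_setIntegral_mul_sq_le hF hv.aestronglyMeasurable hv1 hT2).trans ?_
  suffices h : ∫ Y, ‖T Y‖ ^ 2 ∂μ ≤ C * (s ^ Module.finrank ℝ V)⁻¹ * μV.real E *
      ∫ Z, (1 + ‖Z‖) ^ (-((Module.finrank ℝ V + 1 : ℕ) : ℝ)) ∂μV by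
    have := mul_le_mul_of_nonneg_left h (measureReal_nonneg (μ := μ) (s := F))
    refine this.trans_eq ?_
    ring
  have e1 : ((∫ Y, ‖T Y‖ ^ 2 ∂μ : ℝ) : ℂ) =
      ∫ Y, ∫ z, G z.1 Y * (starRingEnd ℂ) (G z.2 Y) ∂(ν.prod ν) ∂ρ := by
    rw [← setIntegral_eq_integral_of_forall_compl_eq_zero (s := L)
      (fun Y hY => by simp [hT0 Y hY]), ← integral_complex_ofReal]
    refine integral_congr_ae (Filter.Eventually.of_forall fun Y => ?_)
    simp only
    rw [integral_prod_mul (f := fun X => G X Y) (g := fun X => (starRingEnd ℂ) (G X Y)),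
      integral_conj, Complex.mul_conj, Complex.normSq_eq_norm_sq]
  have hprod : ν.prod ν = (μV.prod μV).restrict (E ×ˢ E) := Measure.prod_restrict _ _
  have e2 : Integrable (Function.uncurry fun (Y : W) (z : V × V) =>
      G z.1 Y * (starRingEnd ℂ) (G z.2 Y)) (ρ.prod (ν.prod ν)) := by
    refine Integrable.of_bound (C := max B 0 * max B 0) ?_ ?_
    · refine Measurable.aestronglyMeasurable ?_
      refine Measurable.mul (hGm.comp (by fun_prop :
        Measurable fun q : W × V × V => (q.2.1, q.1))) ?_
      exact Complex.continuous_conj.measurable.comp (hGm.comp (by fun_prop :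
        Measurable fun q : W × V × V => (q.2.2, q.1)))
    · have : ∀ᵐ z ∂(ν.prod ν), z ∈ E ×ˢ E := by
        rw [hprod]
        exact ae_restrict_mem (hEm.prod hEm)
      have h3 : ∀ᵐ q ∂(ρ.prod (ν.prod ν)), q.2 ∈ E ×ˢ E :=
        Measure.quasiMeasurePreserving_snd.ae this
      filter_upwards [h3] with q hq
      simp only [Function.uncurry, norm_mul, RCLike.norm_conj]
      exact mul_le_mul (hGB _ hq.1 _) (hGB _ hq.2 _) (norm_nonneg _) (le_max_right _ _)
  rw [integral_integral_swap e2] at e1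
  have e3 : ∀ z ∈ E ×ˢ E, ‖∫ Y, G z.1 Y * (starRingEnd ℂ) (G z.2 Y) ∂ρ‖ ≤
      C * (1 + s * ‖z.1 - z.2‖) ^ (-((Module.finrank ℝ V + 1 : ℕ) : ℝ)) := by
    rintro ⟨X, Z⟩ ⟨hX, hZ⟩
    have h1 : ∫ Y, G X Y * (starRingEnd ℂ) (G Z Y) ∂ρ = (u X * (starRingEnd ℂ) (u Z)) *
        ∫ Y, Complex.exp (Complex.I * (s * (S (p, X, Y) - S (p, Z, Y)) : ℝ)) *
        ((a (p, X, Y) * a (p, Z, Y) : ℝ) : ℂ) ∂μ := by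
      rw [← setIntegral_eq_integral_of_forall_compl_eq_zero (μ := μ) (s := L)
        (fun Y hY => by simp [ha0 p hp X (hE hX) Y hY]), ← integral_const_mul]
      refine integral_congr_ae (Filter.Eventually.of_forall fun Y => ?_)
      simp only [G, map_mul, ← Complex.exp_conj, Complex.conj_I, Complex.conj_ofReal]
      rw [mul_sub, Complex.ofReal_sub, mul_sub, sub_eq_add_neg, Complex.exp_add]
      push_cast
      rw [neg_mul]
      ring
    simp only [h1, norm_mul, RCLike.norm_conj]
    refine le_trans ?_ (hC p hp X (hE hX) Z (hE hZ) s hs)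
    refine mul_le_of_le_one_left (norm_nonneg _) ?_
    exact mul_le_one₀ (hu1 X) (norm_nonneg _) (hu1 Z)
  have hkm : Measurable fun z : V × V =>
      (1 + s * ‖z.1 - z.2‖) ^ (-((Module.finrank ℝ V + 1 : ℕ) : ℝ)) := by fun_prop
  have hkint : Integrable (fun z : V × V =>
      (1 + s * ‖z.1 - z.2‖) ^ (-((Module.finrank ℝ V + 1 : ℕ) : ℝ))) (ν.prod ν) := by
    refine Integrable.of_bound (C := 1) hkm.aestronglyMeasurable
      (Filter.Eventually.of_forall fun z => ?_)
    rw [Real.norm_of_nonneg (by positivity)]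
    refine Real.rpow_le_one_of_one_le_of_nonpos ?_ (neg_nonpos.2 (Nat.cast_nonneg _))
    have : 0 ≤ s * ‖z.1 - z.2‖ := by positivity
    linarith
  have e4 : ∫ Y, ‖T Y‖ ^ 2 ∂μ ≤ ∫ z, C * (1 + s * ‖z.1 - z.2‖) ^
      (-((Module.finrank ℝ V + 1 : ℕ) : ℝ)) ∂(ν.prod ν) := by
    have h0 : 0 ≤ ∫ Y, ‖T Y‖ ^ 2 ∂μ := integral_nonneg fun Y => by positivity
    rw [← Real.norm_of_nonneg h0, ← Complex.norm_real, e1]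
    refine (norm_integral_le_integral_norm _).trans ?_
    rw [hprod]
    refine setIntegral_mono_on ?_ ?_ (hEm.prod hEm) e3
    · rw [IntegrableOn, ← hprod]
      exact e2.swap.integral_prod_left.norm
    · rw [IntegrableOn, ← hprod]
      exact hkint.const_mul C
  refine e4.trans ?_
  rw [integral_const_mul, integral_prod _ hkint]
  have e5 : ∀ X, ∫ Z, (1 + s * ‖X - Z‖) ^ (-((Module.finrank ℝ V + 1 : ℕ) : ℝ)) ∂ν ≤
      (s ^ Module.finrank ℝ V)⁻¹ *
        ∫ Z, (1 + ‖Z‖) ^ (-((Module.finrank ℝ V + 1 : ℕ) : ℝ)) ∂μV := by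
    intro X
    rw [← integral_one_add_smul_norm μV s hs X]
    exact setIntegral_le_integral (integrable_one_add_smul_norm μV (by simp) s hs X)
      (Filter.Eventually.of_forall fun Z => by positivity)
  have e6 : ∫ X, ∫ Z, (1 + s * ‖X - Z‖) ^ (-((Module.finrank ℝ V + 1 : ℕ) : ℝ)) ∂ν ∂ν ≤
      ∫ X, (s ^ Module.finrank ℝ V)⁻¹ *
        ∫ Z, (1 + ‖Z‖) ^ (-((Module.finrank ℝ V + 1 : ℕ) : ℝ)) ∂μV ∂ν :=
    integral_mono hkint.integral_prod_left (integrable_const _) e5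
  rw [integral_const, measureReal_restrict_apply_univ, smul_eq_mul] at e6
  refine (mul_le_mul_of_nonneg_left e6 hC0).trans_eq ?_
  ring

end Hormander

/-- A mixed Hessian that is positive along `A` makes the phase differences nonstationary near the
base point. -/
theorem exists_nonstationary_of_mixed_deriv {Q V W : Type*}
    [NormedAddCommGroup Q] [NormedSpace ℝ Q] [NormedAddCommGroup V] [NormedSpace ℝ V]
    [NormedAddCommGroup W] [NormedSpace ℝ W] {S : Q × V × W → ℝ} (hS : ContDiff ℝ (⊤ : ℕ∞) S)
    (A : V →L[ℝ] W) (p₀ : Q) (X₀ : V) (Y₀ : W) (B : V → W → ℝ)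
    (hB : ∀ ω e, HasDerivAt (fun r : ℝ => fderiv ℝ S (p₀, X₀ + r • ω, Y₀) (0, 0, e)) (B ω e) 0)
    {c : ℝ} (hc : 0 < c) (hA : ∀ ω, c * ‖ω‖ ^ 2 ≤ B ω (A ω)) :
    ∃ δ : ℝ, 0 < δ ∧ ∀ p ∈ Metric.closedBall p₀ δ, ∀ X ∈ Metric.closedBall X₀ δ,
      ∀ Z ∈ Metric.closedBall X₀ δ, ∀ Y ∈ Metric.closedBall Y₀ δ, c / 2 * ‖X - Z‖ ^ 2 ≤
      fderiv ℝ (fun Y => S (p, X, Y) - S (p, Z, Y)) Y (A (X - Z)) := by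
  have hS' : ContDiff ℝ (⊤ : ℕ∞) (fderiv ℝ S) := hS.fderiv_right (by simp)
  have hst := hS'.contDiffAt (x := (p₀, X₀, Y₀)) |>.hasStrictFDerivAt (by simp)
  have hη : 0 < c / 2 / (‖A‖ + 1) := by positivity
  have h1 := hst.isLittleO.def hη
  rw [nhds_prod_eq] at h1
  obtain ⟨t, ht, ht'⟩ := Filter.mem_prod_self_iff.1 h1
  obtain ⟨δ, hδ, hδt⟩ := Metric.nhds_basis_closedBall.mem_iff.1 ht
  refine ⟨δ, hδ, fun p hp X hX Z hZ Y hY => ?_⟩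
  have hmem : ∀ X ∈ Metric.closedBall X₀ δ, (p, X, Y) ∈ t := fun X hX => hδt (by
    rw [Metric.mem_closedBall] at *
    rw [Prod.dist_eq, Prod.dist_eq]
    exact max_le hp (max_le hX hY))
  have h2 := ht' (Set.mk_mem_prod (hmem X hX) (hmem Z hZ))
  have hsub : ((p, X, Y) : Q × V × W) - (p, Z, Y) = (0, X - Z, 0) := by simp
  simp only [Set.mem_ofPred_eq] at h2
  rw [hsub] at h2
  have hn : ‖((0 : Q), X - Z, (0 : W))‖ = ‖X - Z‖ := by simp
  rw [hn] at h2
  set L := fderiv ℝ (fderiv ℝ S) (p₀, X₀, Y₀) with hL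
  set ω := X - Z with hω
  have hBL : ∀ e, B ω e = L (0, ω, 0) (0, 0, e) := by
    intro e
    have hl : HasDerivAt (fun r : ℝ => (p₀, X₀ + r • ω, Y₀)) ((0 : Q), ω, (0 : W)) 0 := by
      refine (hasDerivAt_const _ _).prodMk (HasDerivAt.prodMk ?_ (hasDerivAt_const _ _))
      simpa using ((hasDerivAt_id (0 : ℝ)).smul_const ω).const_add X₀
    have hd : HasFDerivAt (fderiv ℝ S) L (p₀, X₀ + (0 : ℝ) • ω, Y₀) := by
      simpa using hst.hasFDerivAt
    have h3 : HasDerivAt (fun r : ℝ => fderiv ℝ S (p₀, X₀ + r • ω, Y₀)) (L (0, ω, 0)) 0 :=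
      hd.comp_hasDerivAt (0 : ℝ) hl
    have h4 := h3.clm_apply (hasDerivAt_const (0 : ℝ) ((0 : Q), (0 : V), e))
    exact (hB ω e).unique (h4.congr_deriv (by rw [map_zero, add_zero]))
  have hd : ∀ X, HasFDerivAt (fun Y => S (p, X, Y)) ((fderiv ℝ S (p, X, Y)).comp
      ((ContinuousLinearMap.inr ℝ Q (V × W)).comp (ContinuousLinearMap.inr ℝ V W))) Y := by
    intro X
    exact (hS.differentiable (by simp) (p, X, Y)).hasFDerivAt.comp Y
      ((hasFDerivAt_prodMk_right (𝕜 := ℝ) p (X, Y)).comp Y (hasFDerivAt_prodMk_right X Y))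
  rw [((hd X).fun_sub (hd Z)).fderiv]
  have h3 := ((fderiv ℝ S (p, X, Y) - fderiv ℝ S (p, Z, Y) - L (0, ω, 0))).le_of_opNorm_le h2
    (0, 0, A ω)
  have h4 : ‖((0 : Q), (0 : V), A ω)‖ ≤ ‖A‖ * ‖ω‖ := by
    simpa using A.le_opNorm ω
  have h5 := hA ω
  rw [hBL] at h5
  have h6 : c / 2 / (‖A‖ + 1) * ‖ω‖ * ‖((0 : Q), (0 : V), A ω)‖ ≤ c / 2 * ‖ω‖ ^ 2 := by
    calc _ ≤ c / 2 / (‖A‖ + 1) * ‖ω‖ * ((‖A‖ + 1) * ‖ω‖) := by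
          gcongr
          refine h4.trans ?_
          gcongr
          linarith
      _ = _ := by
        have : ‖A‖ + 1 ≠ 0 := by positivity
        field_simp
  have h7 := (Real.norm_eq_abs _ ▸ h3).trans h6
  have h8 := (abs_le.1 h7).1
  simp only [_root_.sub_apply, ContinuousLinearMap.comp_apply,
    ContinuousLinearMap.inr_apply] at h8 ⊢
  linarith

theorem fderiv_eq_gradPhi {d : ℕ} (φ : (Fin d → ℝ) → ℝ) (ν e : Fin d → ℝ) :
    fderiv ℝ φ ν e = gradPhi d φ ν ⬝ᵥ e := by
  conv_lhs => rw [← Finset.univ_sum_single e]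
  rw [map_sum]
  refine Finset.sum_congr rfl fun i _ => ?_
  have : Pi.single i (e i) = e i • Pi.single (M := fun _ : Fin d => ℝ) i 1 := by
    rw [← Pi.single_smul, smul_eq_mul, mul_one]
  rw [this, map_smul, smul_eq_mul, mul_comm, gradPhi]

theorem hasDerivAt_fderiv_line {d : ℕ} {φ : (Fin d → ℝ) → ℝ} (hφ : ContDiff ℝ (⊤ : ℕ∞) φ)
    (b w e : Fin d → ℝ) :
    HasDerivAt (fun r : ℝ => fderiv ℝ φ (b + r • w) e) (w ⬝ᵥ (hessPhi d φ b *ᵥ e)) 0 := by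
  have h1 : (fun r : ℝ => fderiv ℝ φ (b + r • w) e) =
      fun r => ∑ j, fderiv ℝ φ (b + r • w) (Pi.single j 1) * e j := by
    ext r
    rw [fderiv_eq_gradPhi]
    rfl
  have h2 : w ⬝ᵥ (hessPhi d φ b *ᵥ e) = ∑ j, (gradPhi d
      (fun x => fderiv ℝ φ x (Pi.single j 1)) b ⬝ᵥ w) * e j := by
    simp only [dotProduct, mulVec, hessPhi, Matrix.of_apply, gradPhi, Finset.mul_sum,
      Finset.sum_mul]
    rw [Finset.sum_comm]
    refine Finset.sum_congr rfl fun i _ => Finset.sum_congr rfl fun j _ => ?_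
    ring
  rw [h1, h2]
  refine HasDerivAt.fun_sum fun j _ => HasDerivAt.mul_const ?_ _
  rw [← fderiv_eq_gradPhi]
  have hd : Differentiable ℝ fun x => fderiv ℝ φ x (Pi.single j 1) := by
    have : ContDiff ℝ (⊤ : ℕ∞) (fderiv ℝ φ) := hφ.fderiv_right (by simp)
    exact (this.differentiable (by simp)).clm_apply (differentiable_const _)
  have hl : HasDerivAt (fun r : ℝ => b + r • w) w 0 := by
    simpa using ((hasDerivAt_id (0 : ℝ)).smul_const w).const_add b
  have h0 : HasFDerivAt (fun x => fderiv ℝ φ x (Pi.single j 1))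
    (fderiv ℝ (fun x => fderiv ℝ φ x (Pi.single j 1)) b) (b + (0 : ℝ) • w) := by
      simpa using (hd b).hasFDerivAt
  exact h0.comp_hasDerivAt (0 : ℝ) hl

/-- The phase function of the averaging operator attached to the surface. -/
def radonPhase {d k : ℕ} (Φ : (Fin d → ℝ) → Fin k → ℝ)
    (q : (Fin d → ℝ) × ((Fin d → ℝ) × (Fin k → ℝ)) × ((Fin d → ℝ) × (Fin k → ℝ))) : ℝ :=
  2 * Real.pi * ∑ j, (q.2.1.2 j + q.2.2.2 j) *
    (Φ q.2.1.1 j - Φ q.2.2.1 j + Φ (q.2.2.1 - q.2.1.1 + q.1) j)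

theorem contDiff_radonPhase {d k : ℕ} {Φ : (Fin d → ℝ) → Fin k → ℝ}
    (hΦ : ContDiff ℝ (⊤ : ℕ∞) Φ) : ContDiff ℝ (⊤ : ℕ∞) (radonPhase Φ) := by
  unfold radonPhase
  have hj : ∀ j, ContDiff ℝ (⊤ : ℕ∞) fun x => Φ x j := fun j => contDiff_pi.1 hΦ j
  refine contDiff_const.mul (ContDiff.sum fun j _ => ?_)
  refine ContDiff.mul (by fun_prop) (ContDiff.add (ContDiff.sub ?_ ?_) ?_)
  · exact (hj j).comp (by fun_prop)
  · exact (hj j).comp (by fun_prop)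
  · exact (hj j).comp (by fun_prop)

theorem fderiv_radonPhase {d k : ℕ} {Φ : (Fin d → ℝ) → Fin k → ℝ} (hΦ : ContDiff ℝ (⊤ : ℕ∞) Φ)
    (ζ x y : Fin d → ℝ) (τ σ : Fin k → ℝ) (e : (Fin d → ℝ) × (Fin k → ℝ)) :
    fderiv ℝ (radonPhase Φ) (ζ, (x, τ), (y, σ)) (0, 0, e) = 2 * Real.pi * ∑ j,
      (e.2 j * (Φ x j - Φ y j + Φ (y - x + ζ) j) + (τ j + σ j) *
        (-fderiv ℝ (fun x => Φ x j) y e.1 + fderiv ℝ (fun x => Φ x j) (y - x + ζ) e.1)) := by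
  have hj : ∀ j, Differentiable ℝ fun x => Φ x j := fun j =>
    (contDiff_pi.1 hΦ j).differentiable (by simp)
  have hl : HasDerivAt (fun s : ℝ => (ζ, (x, τ), (y + s • e.1, σ + s • e.2)))
      ((0 : Fin d → ℝ), (0 : (Fin d → ℝ) × (Fin k → ℝ)), e) 0 := by
    refine (hasDerivAt_const _ _).prodMk ((hasDerivAt_const _ _).prodMk (HasDerivAt.prodMk ?_ ?_))
    · simpa using ((hasDerivAt_id (0 : ℝ)).smul_const e.1).const_add y
    · simpa using ((hasDerivAt_id (0 : ℝ)).smul_const e.2).const_add σ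
  have h0 : HasFDerivAt (radonPhase Φ) (fderiv ℝ (radonPhase Φ) (ζ, (x, τ), (y, σ)))
      (ζ, (x, τ), (y + (0 : ℝ) • e.1, σ + (0 : ℝ) • e.2)) := by
    simpa using ((contDiff_radonPhase hΦ).differentiable (by simp) _).hasFDerivAt
  refine (h0.comp_hasDerivAt (0 : ℝ) hl).unique ?_
  simp only [Function.comp_def, radonPhase]
  refine HasDerivAt.const_mul _ (HasDerivAt.fun_sum fun j _ => ?_)
  have hy : HasDerivAt (fun s : ℝ => y + s • e.1) e.1 0 := by
    simpa using ((hasDerivAt_id (0 : ℝ)).smul_const e.1).const_add y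
  have h1 : HasDerivAt (fun s : ℝ => Φ (y + s • e.1) j) (fderiv ℝ (fun x => Φ x j) y e.1) 0 := by
    have : HasFDerivAt (fun x => Φ x j) (fderiv ℝ (fun x => Φ x j) y) (y + (0 : ℝ) • e.1) := by
      simpa using (hj j y).hasFDerivAt
    exact this.comp_hasDerivAt (0 : ℝ) hy
  have h2 : HasDerivAt (fun s : ℝ => Φ (y + s • e.1 - x + ζ) j)
      (fderiv ℝ (fun x => Φ x j) (y - x + ζ) e.1) 0 := by
    have : HasFDerivAt (fun x => Φ x j) (fderiv ℝ (fun x => Φ x j) (y - x + ζ))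
        (y + (0 : ℝ) • e.1 - x + ζ) := by
      simpa using (hj j _).hasFDerivAt
    exact this.comp_hasDerivAt (0 : ℝ) ((hy.sub_const x).add_const ζ)
  have h3 : HasDerivAt (fun s : ℝ => τ j + (σ + s • e.2) j) (e.2 j) 0 := by
    simp only [Pi.add_apply, Pi.smul_apply, smul_eq_mul]
    simpa using (((hasDerivAt_id (0 : ℝ)).mul_const (e.2 j)).const_add (σ j)).const_add (τ j)
  have := h3.mul ((h1.const_sub (Φ x j)).add h2)
  simpa using! this

/-- The mixed Hessian of `radonPhase` is nondegenerate where `det M ≠ 0`. -/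
theorem exists_nonstationary_radonPhase {d k : ℕ} {Φ : (Fin d → ℝ) → Fin k → ℝ}
    (hΦ : ContDiff ℝ (⊤ : ℕ∞) Φ) (ν₁ ν₂ : Fin d → ℝ) (t : Fin k → ℝ)
    (hM : (Mmat d k Φ t ν₁ ν₂ ν₂).det ≠ 0) :
    ∃ (A : (Fin d → ℝ) × (Fin k → ℝ) →L[ℝ] (Fin d → ℝ) × (Fin k → ℝ)) (c δ : ℝ), 0 < c ∧ 0 < δ ∧
      ∀ p ∈ Metric.closedBall ν₂ δ, ∀ X ∈ Metric.closedBall (ν₁, t) δ,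
      ∀ Z ∈ Metric.closedBall (ν₁, t) δ, ∀ Y ∈ Metric.closedBall (ν₁, (0 : Fin k → ℝ)) δ,
      c * ‖X - Z‖ ^ 2 ≤
      fderiv ℝ (fun Y => radonPhase Φ (p, X, Y) - radonPhase Φ (p, Z, Y)) Y (A (X - Z)) := by
  let M := Mmat d k Φ t ν₁ ν₂ ν₂
  let vec : (Fin d → ℝ) × (Fin k → ℝ) →ₗ[ℝ] (Fin k ⊕ Fin d → ℝ) :=
    { toFun := fun ω => Sum.elim ω.2 (-ω.1)
      map_add' := fun a b => by ext i; rcases i with i | i <;> simp; ring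
      map_smul' := fun a b => by ext i; rcases i with i | i <;> simp }
  let spl : (Fin k ⊕ Fin d → ℝ) →ₗ[ℝ] (Fin d → ℝ) × (Fin k → ℝ) :=
    (LinearMap.funLeft ℝ ℝ Sum.inr).prod (LinearMap.funLeft ℝ ℝ Sum.inl)
  let A₀ : (Fin d → ℝ) × (Fin k → ℝ) →ₗ[ℝ] (Fin d → ℝ) × (Fin k → ℝ) :=
    spl ∘ₗ M⁻¹.mulVecLin ∘ₗ vec
  have hA₀ : ∀ ω, Dmat d k Φ ν₁ ν₂ *ᵥ (A₀ ω).1 = ω.2 ∧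
      (Dmat d k Φ ν₁ ν₂)ᵀ *ᵥ (A₀ ω).2 + tHess d k Φ t ν₂ *ᵥ (A₀ ω).1 = -ω.1 := by
    intro ω
    have h1 : M *ᵥ (M⁻¹ *ᵥ vec ω) = vec ω := by
      rw [mulVec_mulVec, mul_nonsing_inv _ (Ne.isUnit hM), one_mulVec]
    have h2 : M⁻¹ *ᵥ vec ω = Sum.elim (A₀ ω).2 (A₀ ω).1 := by
      ext i
      rcases i with i | i <;> rfl
    rw [h2] at h1
    simp only [M, Mmat, fromBlocks_mulVec, Sum.elim_comp_inl, Sum.elim_comp_inr, zero_mulVec,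
      zero_add] at h1
    exact ⟨congrArg (· ∘ Sum.inl) h1, congrArg (· ∘ Sum.inr) h1⟩
  let D := Dmat d k Φ ν₁ ν₂
  let B : (Fin d → ℝ) × (Fin k → ℝ) → (Fin d → ℝ) × (Fin k → ℝ) → ℝ := fun ω e =>
    2 * Real.pi * (-(e.2 ⬝ᵥ (D *ᵥ ω.1)) + ω.2 ⬝ᵥ (D *ᵥ e.1) -
      ω.1 ⬝ᵥ (tHess d k Φ t ν₂ *ᵥ e.1))
  have hD : ∀ w j, (D *ᵥ w) j = fderiv ℝ (fun x => Φ x j) ν₂ w - fderiv ℝ (fun x => Φ x j) ν₁ w := by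
    intro w j
    rw [fderiv_eq_gradPhi, fderiv_eq_gradPhi, ← sub_dotProduct]
    rfl
  obtain ⟨δ, hδ, h⟩ := exists_nonstationary_of_mixed_deriv (contDiff_radonPhase hΦ)
    (LinearMap.toContinuousLinearMap A₀) ν₂ (ν₁, t) (ν₁, (0 : Fin k → ℝ)) B (by
      rintro ⟨w, v⟩ ⟨ey, es⟩
      have hj : ∀ j, ContDiff ℝ (⊤ : ℕ∞) fun x => Φ x j := fun j => contDiff_pi.1 hΦ j
      simp only [Prod.smul_mk, Prod.mk_add_mk, fderiv_radonPhase hΦ]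
      have hB : B (w, v) (ey, es) = 2 * Real.pi * ∑ j, (es j * (fderiv ℝ (fun x => Φ x j) ν₁ w
          - fderiv ℝ (fun x => Φ x j) ν₂ w) + (v j * (-fderiv ℝ (fun x => Φ x j) ν₁ ey +
            fderiv ℝ (fun x => Φ x j) ν₂ ey) +
          t j * ((-w) ⬝ᵥ (hessPhi d (fun x => Φ x j) ν₂ *ᵥ ey)))) := by
        simp only [B]
        congr 1
        have h1 : w ⬝ᵥ (tHess d k Φ t ν₂ *ᵥ ey) =
            ∑ j, t j * (w ⬝ᵥ (hessPhi d (fun x => Φ x j) ν₂ *ᵥ ey)) := by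
          rw [tHess, sum_mulVec, dotProduct_sum]
          simp [smul_mulVec]
        rw [h1, dotProduct, dotProduct, ← Finset.sum_neg_distrib, ← Finset.sum_add_distrib,
          ← Finset.sum_sub_distrib]
        refine Finset.sum_congr rfl fun j _ => ?_
        rw [hD, hD, neg_dotProduct]
        ring
      rw [hB]
      refine HasDerivAt.const_mul _ (HasDerivAt.fun_sum fun j _ => ?_)
      have hx : HasDerivAt (fun r : ℝ => ν₁ + r • w) w 0 := by
        simpa using ((hasDerivAt_id (0 : ℝ)).smul_const w).const_add ν₁
      have h1 : HasDerivAt (fun r : ℝ => Φ (ν₁ + r • w) j) (fderiv ℝ (fun x => Φ x j) ν₁ w) 0 := by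
        have : HasFDerivAt (fun x => Φ x j) (fderiv ℝ (fun x => Φ x j) ν₁) (ν₁ + (0 : ℝ) • w) := by
          simpa using ((hj j).differentiable (by simp) ν₁).hasFDerivAt
        exact this.comp_hasDerivAt (0 : ℝ) hx
      have hx2 : HasDerivAt (fun r : ℝ => ν₂ + r • (-w)) (-w) 0 := by
        simpa using! ((hasDerivAt_id (0 : ℝ)).smul_const (-w)).const_add ν₂
      have e2 : ∀ r : ℝ, ν₁ - (ν₁ + r • w) + ν₂ = ν₂ + r • (-w) := by
        intro r
        rw [smul_neg]
        abel
      have h2 : HasDerivAt (fun r : ℝ => Φ (ν₂ + r • (-w)) j)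
          (fderiv ℝ (fun x => Φ x j) ν₂ (-w)) 0 := by
        have : HasFDerivAt (fun x => Φ x j) (fderiv ℝ (fun x => Φ x j) ν₂)
            (ν₂ + (0 : ℝ) • (-w)) := by
          simpa using ((hj j).differentiable (by simp) ν₂).hasFDerivAt
        exact this.comp_hasDerivAt (0 : ℝ) hx2
      have h3 := hasDerivAt_fderiv_line (hj j) ν₂ (-w) ey
      have h4 : HasDerivAt (fun r : ℝ => (t + r • v) j + (0 : Fin k → ℝ) j) (v j) 0 := by
        simp only [Pi.add_apply, Pi.smul_apply, smul_eq_mul]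
        simpa using ((hasDerivAt_id (0 : ℝ)).mul_const (v j)).const_add (t j)
      simp only [e2]
      have h5 := ((h1.sub_const (Φ ν₁ j)).add h2).const_mul (es j)
      have h6 := h4.mul (h3.const_add (-fderiv ℝ (fun x => Φ x j) ν₁ ey))
      have h7 := h5.add h6
      refine HasDerivAt.congr_deriv h7 ?_
      simp only [map_neg, zero_smul, add_zero, Pi.zero_apply]
      ring) (c := 1) one_pos (by
      rintro ⟨w, v⟩
      obtain ⟨h1, h2⟩ := hA₀ (w, v)
      set e := A₀ (w, v) with he
      have hAe : LinearMap.toContinuousLinearMap A₀ (w, v) = e := rfl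
      rw [hAe]
      simp only [B] at h1 h2 ⊢
      have h3 : e.2 ⬝ᵥ (D *ᵥ w) = w ⬝ᵥ (Dᵀ *ᵥ e.2) := by
        rw [dotProduct_mulVec, ← mulVec_transpose, dotProduct_comm]
      have h4 : w ⬝ᵥ (tHess d k Φ t ν₂ *ᵥ e.1) = -(w ⬝ᵥ w) - w ⬝ᵥ (Dᵀ *ᵥ e.2) := by
        rw [eq_sub_iff_add_eq, ← dotProduct_add, add_comm, h2, dotProduct_neg]
      have h6 : ∀ {n : ℕ} (x : Fin n → ℝ), ‖x‖ ^ 2 ≤ x ⬝ᵥ x := by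
        intro n x
        have h0 : 0 ≤ x ⬝ᵥ x := Finset.sum_nonneg fun i _ => mul_self_nonneg _
        rw [← Real.sqrt_le_sqrt_iff h0, Real.sqrt_sq (norm_nonneg _)]
        refine (pi_norm_le_iff_of_nonneg (Real.sqrt_nonneg _)).2 fun i => ?_
        rw [Real.norm_eq_abs]
        refine Real.abs_le_sqrt ?_
        rw [sq]
        exact Finset.single_le_sum (f := fun i => x i * x i) (fun i _ => mul_self_nonneg _)
          (Finset.mem_univ i)
      rw [h3, h4, h1]
      have h7 : ‖(w, v)‖ ^ 2 ≤ v ⬝ᵥ v + w ⬝ᵥ w := by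
        have hw := h6 w
        have hv := h6 v
        rw [Prod.norm_mk]
        rcases max_choice ‖w‖ ‖v‖ with h | h <;> rw [h] <;> nlinarith [sq_nonneg ‖w‖, sq_nonneg ‖v‖]
      have h8 : 0 ≤ v ⬝ᵥ v + w ⬝ᵥ w := (sq_nonneg _).trans h7
      nlinarith [Real.pi_gt_three])
  exact ⟨_, 1 / 2, δ, by norm_num, hδ, h⟩

/-- The amplitude attached to the cutoffs of the averaging operator. -/
def radonAmplitude {d k : ℕ} (χ χ₁ : (Fin d → ℝ) → ℝ) (h ψ : (Fin k → ℝ) → ℝ)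
    (q : (Fin d → ℝ) × ((Fin d → ℝ) × (Fin k → ℝ)) × ((Fin d → ℝ) × (Fin k → ℝ))) : ℝ :=
  χ (q.2.2.1 - q.2.1.1 + q.1) * χ₁ q.2.2.1 * ψ (q.2.1.2 + q.2.2.2) * h q.2.2.2

/-- The integrand of the localised and frequency-doubled averaging form. -/
def radonIntegrand {d k : ℕ} (Φ : (Fin d → ℝ) → Fin k → ℝ) (χ χ₁ : (Fin d → ℝ) → ℝ)
    (h ψ : (Fin k → ℝ) → ℝ) (ζ : Fin d → ℝ) (c : Fin k → ℝ) (s : ℝ)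
    (z : ((Fin d → ℝ) × (Fin k → ℝ)) × ((Fin d → ℝ) × (Fin k → ℝ))) : ℂ :=
  Complex.exp (Complex.I * (-(s * (2 * Real.pi * (z.1.2 ⬝ᵥ c))) : ℝ)) *
    (Complex.exp (Complex.I * (-(s * (2 * Real.pi * (z.2.2 ⬝ᵥ c))) : ℝ)) *
      (Complex.exp (Complex.I * (s * radonPhase Φ (ζ, z.2, z.1) : ℝ)) *
        (radonAmplitude χ χ₁ h ψ (ζ, z.2, z.1) : ℂ)))

theorem contDiff_radonAmplitude {d k : ℕ} {χ χ₁ : (Fin d → ℝ) → ℝ} {h ψ : (Fin k → ℝ) → ℝ}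
    (hχ : ContDiff ℝ (⊤ : ℕ∞) χ) (hχ₁ : ContDiff ℝ (⊤ : ℕ∞) χ₁) (hh : ContDiff ℝ (⊤ : ℕ∞) h)
    (hψ : ContDiff ℝ (⊤ : ℕ∞) ψ) : ContDiff ℝ (⊤ : ℕ∞) (radonAmplitude χ χ₁ h ψ) := by
  unfold radonAmplitude
  refine (((hχ.comp ?_).mul (hχ₁.comp ?_)).mul (hψ.comp ?_)).mul (hh.comp ?_) <;> fun_prop

theorem continuous_dotProduct_const {k : ℕ} (c : Fin k → ℝ) :
    Continuous fun t : Fin k → ℝ => t ⬝ᵥ c := by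
  unfold dotProduct
  fun_prop

theorem continuous_radonIntegrand {d k : ℕ} {Φ : (Fin d → ℝ) → Fin k → ℝ}
    (hΦ : ContDiff ℝ (⊤ : ℕ∞) Φ) {χ χ₁ : (Fin d → ℝ) → ℝ} {h ψ : (Fin k → ℝ) → ℝ}
    (hχ : ContDiff ℝ (⊤ : ℕ∞) χ) (hχ₁ : ContDiff ℝ (⊤ : ℕ∞) χ₁) (hh : ContDiff ℝ (⊤ : ℕ∞) h)
    (hψ : ContDiff ℝ (⊤ : ℕ∞) ψ) (ζ : Fin d → ℝ) (c : Fin k → ℝ) (s : ℝ) :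
    Continuous (radonIntegrand Φ χ χ₁ h ψ ζ c s) := by
  have h1 := (contDiff_radonAmplitude hχ hχ₁ hh hψ).continuous
  have h2 := (contDiff_radonPhase hΦ).continuous
  have h3 := continuous_dotProduct_const c
  unfold radonIntegrand
  have h4 : Continuous fun z : ((Fin d → ℝ) × (Fin k → ℝ)) × ((Fin d → ℝ) × (Fin k → ℝ)) =>
    radonPhase Φ (ζ, z.2, z.1) := h2.comp (by fun_prop)
  have h5 : Continuous fun z : ((Fin d → ℝ) × (Fin k → ℝ)) × ((Fin d → ℝ) × (Fin k → ℝ)) =>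
    radonAmplitude χ χ₁ h ψ (ζ, z.2, z.1) := h1.comp (by fun_prop)
  have h6 : Continuous fun z : ((Fin d → ℝ) × (Fin k → ℝ)) × ((Fin d → ℝ) × (Fin k → ℝ)) =>
    z.1.2 ⬝ᵥ c := h3.comp (by fun_prop)
  have h7 : Continuous fun z : ((Fin d → ℝ) × (Fin k → ℝ)) × ((Fin d → ℝ) × (Fin k → ℝ)) =>
    z.2.2 ⬝ᵥ c := h3.comp (by fun_prop)
  fun_prop

theorem integrableOn_radonIntegrand {d k : ℕ} {Φ : (Fin d → ℝ) → Fin k → ℝ}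
    (hΦ : ContDiff ℝ (⊤ : ℕ∞) Φ) {χ χ₁ : (Fin d → ℝ) → ℝ} {h ψ : (Fin k → ℝ) → ℝ}
    (hχ : ContDiff ℝ (⊤ : ℕ∞) χ) (hχ₁ : ContDiff ℝ (⊤ : ℕ∞) χ₁) (hh : ContDiff ℝ (⊤ : ℕ∞) h)
    (hψ : ContDiff ℝ (⊤ : ℕ∞) ψ) (ζ : Fin d → ℝ) (c : Fin k → ℝ) (s : ℝ)
    {E F : Set (Fin d → ℝ)} {B T : Set (Fin k → ℝ)} {K₁ K₂ : Set (Fin d → ℝ)}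
    {K₃ K₄ : Set (Fin k → ℝ)} (hE : E ⊆ K₁) (hF : F ⊆ K₂) (hB : B ⊆ K₃) (hT : T ⊆ K₄)
    (h₁ : IsCompact K₁) (h₂ : IsCompact K₂) (h₃ : IsCompact K₃) (h₄ : IsCompact K₄) :
    IntegrableOn (radonIntegrand Φ χ χ₁ h ψ ζ c s) ((F ×ˢ B) ×ˢ (E ×ˢ T)) :=
  ((continuous_radonIntegrand hΦ hχ hχ₁ hh hψ ζ c s).continuousOn.integrableOn_compact
    ((h₂.prod h₃).prod (h₁.prod h₄))).mono_set
    (Set.prod_mono (Set.prod_mono hF hB) (Set.prod_mono hE hT))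

/-- The `L²` bound for the averaging form with one dual variable localised to `K`. -/
def RadonBoundOn {d k : ℕ} (Φ : (Fin d → ℝ) → Fin k → ℝ) (ν₁ ν₂ : Fin d → ℝ)
    (ψ : (Fin k → ℝ) → ℝ) (K : Set (Fin k → ℝ)) : Prop :=
  ∃ δ₀ : ℝ, 0 < δ₀ ∧ ∀ δ, 0 < δ → δ ≤ δ₀ →
    ∀ (χ χ₁ : (Fin d → ℝ) → ℝ) (h : (Fin k → ℝ) → ℝ), ContDiff ℝ (⊤ : ℕ∞) χ →
    ContDiff ℝ (⊤ : ℕ∞) χ₁ → ContDiff ℝ (⊤ : ℕ∞) h →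
    (∀ x ∉ Metric.closedBall ν₂ (2 * δ), χ x = 0) →
    (∀ x ∉ Metric.closedBall ν₁ (2 * δ), χ₁ x = 0) →
    (∀ x ∉ Metric.closedBall 0 δ, h x = 0) →
    ∃ C : ℝ, 0 ≤ C ∧ ∀ ζ, ∀ T ⊆ K, MeasurableSet T → ∀ E ⊆ Metric.closedBall ν₁ δ,
    MeasurableSet E → ∀ F ⊆ Metric.closedBall ν₁ δ, MeasurableSet F → ∀ c s, 0 < s →
    ‖∫ z in (F ×ˢ Metric.closedBall 0 δ) ×ˢ (E ×ˢ T), radonIntegrand Φ χ χ₁ h ψ ζ c s z‖ ≤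
      C * √((s ^ (d + k))⁻¹ * volume.real E * volume.real F)

theorem norm_cexp_I_mul_ofReal (x : ℝ) : ‖Complex.exp (Complex.I * (x : ℂ))‖ = 1 := by
  rw [mul_comm, Complex.norm_exp_ofReal_mul_I]

theorem exists_radonBoundOn_closedBall {d k : ℕ} {Φ : (Fin d → ℝ) → Fin k → ℝ}
    (hΦ : ContDiff ℝ (⊤ : ℕ∞) Φ) (ν₁ ν₂ : Fin d → ℝ) {ψ : (Fin k → ℝ) → ℝ}
    (hψ : ContDiff ℝ (⊤ : ℕ∞) ψ) (t : Fin k → ℝ) (hM : (Mmat d k Φ t ν₁ ν₂ ν₂).det ≠ 0) :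
    ∃ r : ℝ, 0 < r ∧ RadonBoundOn Φ ν₁ ν₂ ψ (Metric.closedBall t r) := by
  obtain ⟨A, c, r, hc, hr, hA⟩ := exists_nonstationary_radonPhase hΦ ν₁ ν₂ t hM
  refine ⟨r, hr, r / 4, by positivity, fun δ hδ hδr χ χ₁ h hχ hχ₁ hh hχ0 hχ₁0 hh0 => ?_⟩
  have hle : 4 * δ ≤ r := by linarith
  have : (volume : Measure ((Fin d → ℝ) × (Fin k → ℝ))).IsAddHaarMeasure :=
    Measure.prod.instIsAddHaarMeasure volume volume
  obtain ⟨C, hC0, hC⟩ := oscillatory_bilinear_bound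
    (volume : Measure ((Fin d → ℝ) × (Fin k → ℝ))) (volume : Measure ((Fin d → ℝ) × (Fin k → ℝ)))
    (contDiff_radonPhase hΦ) (contDiff_radonAmplitude hχ hχ₁ hh hψ) A
    (KP := Metric.closedBall ν₂ (4 * δ)) (KV := Metric.closedBall (ν₁, t) r)
    (L := Metric.closedBall (ν₁, (0 : Fin k → ℝ)) (2 * δ)) (isCompact_closedBall _ _)
    (isCompact_closedBall _ _) (isCompact_closedBall _ _) hc
    (by
      rintro p - ⟨x, τ⟩ - ⟨y, σ⟩ hY
      rw [← closedBall_prod_same, Set.mem_prod, not_and_or] at hY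
      rcases hY with hY | hY
      · simp [radonAmplitude, hχ₁0 y hY]
      · have : h σ = 0 := hh0 σ fun h' => hY (Metric.closedBall_subset_closedBall (by linarith) h')
        simp [radonAmplitude, this])
    (fun p hp X hX Z hZ Y hY => hA p (Metric.closedBall_subset_closedBall hle hp) X hX Z hZ Y
      (Metric.closedBall_subset_closedBall (by linarith) hY))
  set b := volume.real (Metric.closedBall (0 : Fin k → ℝ) δ) with hb
  set b' := volume.real (Metric.closedBall t r) with hb'
  have hb0 : 0 ≤ b := measureReal_nonneg
  have hb0' : 0 ≤ b' := measureReal_nonneg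
  refine ⟨√(C * b' * b), Real.sqrt_nonneg _, ?_⟩
  intro ζ T hT hTm E hE hEm F hF hFm c₀ s hs
  by_cases hζ : ζ ∈ Metric.closedBall ν₂ (4 * δ)
  swap
  · rw [setIntegral_eq_zero_of_forall_eq_zero, norm_zero]
    · positivity
    · rintro ⟨⟨y, σ⟩, x, τ⟩ ⟨⟨hy, -⟩, hx, -⟩
      have : χ (y - x + ζ) = 0 := by
        refine hχ0 _ fun h' => hζ ?_
        have h1 := hE hx
        have h2 := hF hy
        rw [mem_closedBall_iff_norm] at h' h1 h2 ⊢
        calc ‖ζ - ν₂‖ = ‖(y - x + ζ - ν₂) - (y - ν₁) + (x - ν₁)‖ := by congr 1; abel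
          _ ≤ ‖y - x + ζ - ν₂‖ + ‖y - ν₁‖ + ‖x - ν₁‖ :=
            (norm_add_le _ _).trans (add_le_add_left (norm_sub_le _ _) _)
          _ ≤ 4 * δ := by linarith
      simp [radonIntegrand, radonAmplitude, this]
  have key := hC ζ hζ (E ×ˢ T) (by
      rw [← closedBall_prod_same]
      exact Set.prod_mono (hE.trans (Metric.closedBall_subset_closedBall (by linarith))) hT)
    (hEm.prod hTm) (F ×ˢ Metric.closedBall 0 δ)
    (((measure_mono (Set.prod_mono hF subset_rfl)).trans_lt
      ((isCompact_closedBall ν₁ δ).prod (isCompact_closedBall 0 δ)).measure_lt_top).ne)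
    (fun X => Complex.exp (Complex.I * (-(s * (2 * Real.pi * (X.2 ⬝ᵥ c₀))) : ℝ)))
    (fun Y => Complex.exp (Complex.I * (-(s * (2 * Real.pi * (Y.2 ⬝ᵥ c₀))) : ℝ)))
    (by
      have := continuous_dotProduct_const c₀
      fun_prop)
    (fun X => (norm_cexp_I_mul_ofReal _).le)
    (by
      have := continuous_dotProduct_const c₀
      fun_prop)
    (fun X => (norm_cexp_I_mul_ofReal _).le) s hs
  have hfin := integrableOn_radonIntegrand hΦ hχ hχ₁ hh hψ ζ c₀ s hE hF subset_rfl hT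
    (isCompact_closedBall _ _) (isCompact_closedBall _ _) (isCompact_closedBall (0 : Fin k → ℝ) δ)
    (isCompact_closedBall _ _)
  have e1 : ∫ z in (F ×ˢ Metric.closedBall 0 δ) ×ˢ (E ×ˢ T), radonIntegrand Φ χ χ₁ h ψ ζ c₀ s z =
      ∫ Y in F ×ˢ Metric.closedBall 0 δ, Complex.exp (Complex.I *
        (-(s * (2 * Real.pi * (Y.2 ⬝ᵥ c₀))) : ℝ)) * ∫ X in E ×ˢ T,
        Complex.exp (Complex.I * (-(s * (2 * Real.pi * (X.2 ⬝ᵥ c₀))) : ℝ)) *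
        (Complex.exp (Complex.I * (s * radonPhase Φ (ζ, X, Y) : ℝ)) *
        (radonAmplitude χ χ₁ h ψ (ζ, X, Y) : ℂ)) := by
    rw [Measure.volume_eq_prod, setIntegral_prod _ hfin]
    refine integral_congr_ae (Filter.Eventually.of_forall fun Y => ?_)
    simp only [radonIntegrand, integral_const_mul]
  rw [← e1] at key
  have hfr : Module.finrank ℝ ((Fin d → ℝ) × (Fin k → ℝ)) = d + k := by simp
  rw [hfr] at key
  rw [← Real.sqrt_mul (by positivity)]
  refine Real.le_sqrt_of_sq_le (key.trans ?_)
  rw [Measure.volume_eq_prod, measureReal_prod_prod, measureReal_prod_prod]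
  have hTb : volume.real T ≤ b' := measureReal_mono hT (isCompact_closedBall _ _).measure_lt_top.ne
  calc C * (s ^ (d + k))⁻¹ * (volume.real E * volume.real T) * (volume.real F * b)
      ≤ C * (s ^ (d + k))⁻¹ * (volume.real E * b') * (volume.real F * b) := by gcongr
    _ = _ := by ring

theorem RadonBoundOn.union {d k : ℕ} {Φ : (Fin d → ℝ) → Fin k → ℝ}
    (hΦ : ContDiff ℝ (⊤ : ℕ∞) Φ) {ν₁ ν₂ : Fin d → ℝ} {ψ : (Fin k → ℝ) → ℝ}
    (hψ : ContDiff ℝ (⊤ : ℕ∞) ψ) {K₁ K₂ : Set (Fin k → ℝ)} (h₁ : IsCompact K₁) (h₂ : IsCompact K₂)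
    (H₁ : RadonBoundOn Φ ν₁ ν₂ ψ K₁) (H₂ : RadonBoundOn Φ ν₁ ν₂ ψ K₂) :
    RadonBoundOn Φ ν₁ ν₂ ψ (K₁ ∪ K₂) := by
  obtain ⟨δ₁, hδ₁, H₁⟩ := H₁
  obtain ⟨δ₂, hδ₂, H₂⟩ := H₂
  refine ⟨min δ₁ δ₂, lt_min hδ₁ hδ₂, fun δ hδ hle χ χ₁ h hχ hχ₁ hh hχ0 hχ₁0 hh0 => ?_⟩
  obtain ⟨C₁, hC₁, B₁⟩ := H₁ δ hδ (hle.trans (min_le_left _ _)) χ χ₁ h hχ hχ₁ hh hχ0 hχ₁0 hh0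
  obtain ⟨C₂, hC₂, B₂⟩ := H₂ δ hδ (hle.trans (min_le_right _ _)) χ χ₁ h hχ hχ₁ hh hχ0 hχ₁0 hh0
  refine ⟨C₁ + C₂, add_nonneg hC₁ hC₂, fun ζ T hT hTm E hE hEm F hF hFm c s hs => ?_⟩
  have b₁ := B₁ ζ (T ∩ K₁) Set.inter_subset_right (hTm.inter h₁.measurableSet) E hE hEm F hF hFm
    c s hs
  have b₂ := B₂ ζ (T \ K₁) (fun x hx => (hT hx.1).resolve_left hx.2) (hTm.diff h₁.measurableSet)
    E hE hEm F hF hFm c s hs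
  have hTu : (F ×ˢ Metric.closedBall (0 : Fin k → ℝ) δ) ×ˢ (E ×ˢ T) =
      ((F ×ˢ Metric.closedBall 0 δ) ×ˢ (E ×ˢ (T ∩ K₁))) ∪
      ((F ×ˢ Metric.closedBall 0 δ) ×ˢ (E ×ˢ (T \ K₁))) := by
    rw [← Set.prod_union, ← Set.prod_union, Set.inter_union_sdiff]
  have hInt : ∀ T' ⊆ K₁ ∪ K₂, IntegrableOn (radonIntegrand Φ χ χ₁ h ψ ζ c s)
      ((F ×ˢ Metric.closedBall 0 δ) ×ˢ (E ×ˢ T')) := fun T' hT' =>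
    integrableOn_radonIntegrand hΦ hχ hχ₁ hh hψ ζ c s hE hF subset_rfl hT'
      (isCompact_closedBall _ _) (isCompact_closedBall _ _)
      (isCompact_closedBall (0 : Fin k → ℝ) δ) (h₁.union h₂)
  rw [hTu, setIntegral_union, add_mul]
  · exact (norm_add_le _ _).trans (add_le_add b₁ b₂)
  · rw [Set.disjoint_left]
    rintro ⟨_, _, τ⟩ ⟨_, _, h1⟩ ⟨_, _, h2⟩
    exact h2.2 h1.2
  · exact (hFm.prod measurableSet_closedBall).prod (hEm.prod (hTm.diff h₁.measurableSet))
  · exact hInt _ (Set.inter_subset_left.trans hT)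
  · exact hInt _ (Set.sdiff_subset.trans hT)

theorem RadonBoundOn.mono {d k : ℕ} {Φ : (Fin d → ℝ) → Fin k → ℝ} {ν₁ ν₂ : Fin d → ℝ}
    {ψ : (Fin k → ℝ) → ℝ} {K₁ K₂ : Set (Fin k → ℝ)} (hK : K₁ ⊆ K₂)
    (H : RadonBoundOn Φ ν₁ ν₂ ψ K₂) : RadonBoundOn Φ ν₁ ν₂ ψ K₁ := by
  obtain ⟨δ₁, hδ₁, H⟩ := H
  refine ⟨δ₁, hδ₁, fun δ hδ hle χ χ₁ h hχ hχ₁ hh hχ0 hχ₁0 hh0 => ?_⟩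
  obtain ⟨C, hC, B⟩ := H δ hδ hle χ χ₁ h hχ hχ₁ hh hχ0 hχ₁0 hh0
  exact ⟨C, hC, fun ζ T hT => B ζ T (hT.trans hK)⟩

/-- `L²` bound for the averaging form with the dual variable localised to a compact set. -/
theorem radonBoundOn_of_isCompact {d k : ℕ} {Φ : (Fin d → ℝ) → Fin k → ℝ}
    (hΦ : ContDiff ℝ (⊤ : ℕ∞) Φ) (ν₁ ν₂ : Fin d → ℝ)
    (hM : ∀ t ≠ 0, (Mmat d k Φ t ν₁ ν₂ ν₂).det ≠ 0) {ψ : (Fin k → ℝ) → ℝ}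
    (hψ : ContDiff ℝ (⊤ : ℕ∞) ψ) {K : Set (Fin k → ℝ)} (hK : IsCompact K) (hK0 : ∀ t ∈ K, t ≠ 0) :
    RadonBoundOn Φ ν₁ ν₂ ψ K := by
  suffices h : ∃ K', K ⊆ K' ∧ IsCompact K' ∧ RadonBoundOn Φ ν₁ ν₂ ψ K' by
    obtain ⟨K', hKK', -, h⟩ := h
    exact h.mono hKK'
  refine hK.induction_on (p := fun K => ∃ K', K ⊆ K' ∧ IsCompact K' ∧ RadonBoundOn Φ ν₁ ν₂ ψ K')
    ?_ ?_ ?_ ?_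
  · refine ⟨∅, subset_rfl, isCompact_empty, 1, one_pos, ?_⟩
    intro δ hδ hle χ χ₁ h hχ hχ₁ hh hχ0 hχ₁0 hh0
    refine ⟨0, le_rfl, fun ζ T hT hTm E hE hEm F hF hFm c s hs => ?_⟩
    rw [Set.subset_empty_iff.1 hT]
    simp
  · rintro A B hAB ⟨K', hK', h⟩
    exact ⟨K', hAB.trans hK', h⟩
  · rintro A B ⟨K₁, h₁, h₁c, H₁⟩ ⟨K₂, h₂, h₂c, H₂⟩
    exact ⟨K₁ ∪ K₂, Set.union_subset_union h₁ h₂, h₁c.union h₂c, H₁.union hΦ hψ h₁c h₂c H₂⟩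
  · intro t ht
    obtain ⟨r, hr, H⟩ := exists_radonBoundOn_closedBall hΦ ν₁ ν₂ hψ t (hM t (hK0 t ht))
    exact ⟨_, mem_nhdsWithin_of_mem_nhds (Metric.closedBall_mem_nhds t hr), _, subset_rfl,
      isCompact_closedBall _ _, H⟩

/-- The rescaled Fourier transform of `ψ`. -/
def oscKernel {k : ℕ} (ψ : (Fin k → ℝ) → ℝ) (s : ℝ) (u : Fin k → ℝ) : ℂ :=
  ∫ τ, Complex.exp (Complex.I * (s * (2 * Real.pi * (τ ⬝ᵥ u)) : ℝ)) * (ψ τ : ℂ)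

/-- The defining function of the averaging operator. -/
def radonTheta {d k : ℕ} (Φ : (Fin d → ℝ) → Fin k → ℝ) (ζ x y : Fin d → ℝ) : Fin k → ℝ :=
  Φ x - Φ y + Φ (y - x + ζ)

theorem radonIntegrand_eq {d k : ℕ} (Φ : (Fin d → ℝ) → Fin k → ℝ) (χ χ₁ : (Fin d → ℝ) → ℝ)
    (h ψ : (Fin k → ℝ) → ℝ) (ζ x y : Fin d → ℝ) (c τ σ : Fin k → ℝ) (s : ℝ) :
    radonIntegrand Φ χ χ₁ h ψ ζ c s ((y, σ), (x, τ)) =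
      (h σ : ℂ) * ((χ (y - x + ζ) * χ₁ y : ℝ) * (Complex.exp (Complex.I *
        (s * (2 * Real.pi * ((τ + σ) ⬝ᵥ (radonTheta Φ ζ x y - c))) : ℝ)) * (ψ (τ + σ) : ℂ))) := by
  have h1 : s * (2 * Real.pi * ((τ + σ) ⬝ᵥ (radonTheta Φ ζ x y - c))) =
      -(s * (2 * Real.pi * (σ ⬝ᵥ c))) + (-(s * (2 * Real.pi * (τ ⬝ᵥ c))) +
        s * radonPhase Φ (ζ, (x, τ), (y, σ))) := by
    have : radonPhase Φ (ζ, (x, τ), (y, σ)) =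
        2 * Real.pi * ((τ + σ) ⬝ᵥ radonTheta Φ ζ x y) := rfl
    rw [this, dotProduct_sub, add_dotProduct τ σ c]
    ring
  rw [h1, Complex.ofReal_add, mul_add, Complex.exp_add, Complex.ofReal_add, mul_add,
    Complex.exp_add]
  simp only [radonIntegrand, radonAmplitude]
  push_cast
  ring

/-- The dyadic piece of the averaging form. -/
theorem exists_radon_dyadic_bound {d k : ℕ} {Φ : (Fin d → ℝ) → Fin k → ℝ}
    (hΦ : ContDiff ℝ (⊤ : ℕ∞) Φ) (ν₁ ν₂ : Fin d → ℝ)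
    (hM : ∀ t ≠ 0, (Mmat d k Φ t ν₁ ν₂ ν₂).det ≠ 0) {ψ : (Fin k → ℝ) → ℝ}
    (hψ : ContDiff ℝ (⊤ : ℕ∞) ψ) (hψ0 : ∀ t, ψ t ≠ 0 → 1 ≤ ‖t‖ ∧ ‖t‖ ≤ 4) :
    ∃ δ : ℝ, 0 < δ ∧ ∃ χ : (Fin d → ℝ) → ℝ, Continuous χ ∧ (∀ x, 0 ≤ χ x) ∧ (∀ x, χ x ≤ 1) ∧
      (∀ x ∈ Metric.closedBall ν₂ δ, χ x = 1) ∧ ∃ C : ℝ, 0 ≤ C ∧ ∀ ζ,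
      ∀ E ⊆ Metric.closedBall ν₁ δ, MeasurableSet E → ∀ F ⊆ Metric.closedBall ν₁ δ,
      MeasurableSet F → ∀ c s, 0 < s →
      ‖∫ y in F, ∫ x in E, (χ (y - x + ζ) : ℂ) * oscKernel ψ s (radonTheta Φ ζ x y - c)‖ ≤
        C * √((s ^ (d + k))⁻¹ * volume.real E * volume.real F) := by
  let K : Set (Fin k → ℝ) := Metric.closedBall 0 5 \ Metric.ball 0 (1 / 2)
  have hK : IsCompact K := (isCompact_closedBall _ _).diff Metric.isOpen_ball
  obtain ⟨δ₀, hδ₀, H⟩ := radonBoundOn_of_isCompact hΦ ν₁ ν₂ hM hψ hK (by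
    rintro t ⟨-, h⟩ rfl
    exact h (by simp))
  let δ := min δ₀ (1 / 2)
  have hδ : 0 < δ := lt_min hδ₀ (by norm_num)
  have hδ2 : δ ≤ 1 / 2 := min_le_right _ _
  let χ : ContDiffBump ν₂ := ⟨δ, 2 * δ, hδ, by linarith⟩
  let χ₁ : ContDiffBump ν₁ := ⟨δ, 2 * δ, hδ, by linarith⟩
  let h₀ : ContDiffBump (0 : Fin k → ℝ) := ⟨δ / 2, δ, by linarith, by linarith⟩
  let h : (Fin k → ℝ) → ℝ := h₀.normed volume
  have hh : ContDiff ℝ (⊤ : ℕ∞) h := h₀.contDiff_normed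
  have hout : ∀ {n : ℕ} {c : Fin n → ℝ} (f : ContDiffBump c), ∀ x ∉ Metric.closedBall c f.rOut,
      f x = 0 := by
    intro n c f x hx
    refine f.zero_of_le_dist ?_
    rw [Metric.mem_closedBall, not_le] at hx
    exact hx.le
  have hh0 : ∀ x ∉ Metric.closedBall 0 δ, h x = 0 := by
    intro x hx
    simp only [h, ContDiffBump.normed]
    rw [hout h₀ x hx, zero_div]
  obtain ⟨C, hC0, hC⟩ := H δ hδ (min_le_left _ _) χ χ₁ h χ.contDiff χ₁.contDiff hh
    (hout χ) (hout χ₁) hh0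
  refine ⟨δ, hδ, χ, χ.continuous, fun x => χ.nonneg, fun x => χ.le_one,
    fun x hx => χ.one_of_mem_closedBall hx, C, hC0, ?_⟩
  intro ζ E hE hEm F hF hFm c s hs
  have key := hC ζ K subset_rfl hK.measurableSet E hE hEm F hF hFm c s hs
  refine le_trans (le_of_eq ?_) key
  congr 1
  have hInt := integrableOn_radonIntegrand hΦ χ.contDiff χ₁.contDiff hh hψ ζ c s hE hF
    subset_rfl subset_rfl (isCompact_closedBall _ _) (isCompact_closedBall _ _)
    (isCompact_closedBall (0 : Fin k → ℝ) δ) hK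
  have e1 : ∫ z in (F ×ˢ Metric.closedBall 0 δ) ×ˢ (E ×ˢ K), radonIntegrand Φ χ χ₁ h ψ ζ c s z =
      ∫ Y in F ×ˢ Metric.closedBall 0 δ, ∫ X in E ×ˢ K,
        radonIntegrand Φ χ χ₁ h ψ ζ c s (Y, X) := by
    rw [Measure.volume_eq_prod, setIntegral_prod _ hInt]
  rw [e1]
  have hint2 : IntegrableOn (fun Y => ∫ X in E ×ˢ K, radonIntegrand Φ χ χ₁ h ψ ζ c s (Y, X))
      (F ×ˢ Metric.closedBall 0 δ) := by
    rw [IntegrableOn, Measure.volume_eq_prod, ← Measure.prod_restrict] at hInt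
    exact hInt.integral_prod_left
  have e2 : ∫ Y in F ×ˢ Metric.closedBall 0 δ, ∫ X in E ×ˢ K,
        radonIntegrand Φ χ χ₁ h ψ ζ c s (Y, X) =
      ∫ y in F, ∫ σ in Metric.closedBall 0 δ, ∫ X in E ×ˢ K,
        radonIntegrand Φ χ χ₁ h ψ ζ c s ((y, σ), X) := setIntegral_prod _ hint2
  rw [e2]
  symm
  refine setIntegral_congr_fun hFm fun y hy => ?_
  have hχ₁ : χ₁ y = 1 := χ₁.one_of_mem_closedBall (hF hy)
  have hinner : ∀ σ ∈ Metric.closedBall (0 : Fin k → ℝ) δ,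
      ∫ X in E ×ˢ K, radonIntegrand Φ χ χ₁ h ψ ζ c s ((y, σ), X) =
      (h σ : ℂ) * ∫ x in E, (χ (y - x + ζ) : ℂ) * oscKernel ψ s (radonTheta Φ ζ x y - c) := by
    intro σ hσ
    have hint3 : IntegrableOn (fun X => radonIntegrand Φ χ χ₁ h ψ ζ c s ((y, σ), X)) (E ×ˢ K) :=
      (((continuous_radonIntegrand hΦ χ.contDiff χ₁.contDiff hh hψ ζ c s).comp
        (Continuous.prodMk_right (y, σ))).continuousOn.integrableOn_compact
        ((isCompact_closedBall ν₁ δ).prod hK)).mono_set (Set.prod_mono hE subset_rfl)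
    have e3 : ∫ X in E ×ˢ K, radonIntegrand Φ χ χ₁ h ψ ζ c s ((y, σ), X) =
        ∫ x in E, ∫ τ in K, radonIntegrand Φ χ χ₁ h ψ ζ c s ((y, σ), (x, τ)) :=
      setIntegral_prod _ hint3
    rw [e3, ← integral_const_mul]
    refine integral_congr_ae (Filter.Eventually.of_forall fun x => ?_)
    simp only [radonIntegrand_eq, integral_const_mul]
    rw [hχ₁, mul_one]
    congr 2
    rw [setIntegral_eq_integral_of_forall_compl_eq_zero]
    · exact integral_add_right_eq_self (fun τ => Complex.exp (Complex.I *
        (s * (2 * Real.pi * (τ ⬝ᵥ (radonTheta Φ ζ x y - c))) : ℝ)) * (ψ τ : ℂ)) σ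
    · intro τ hτ
      have : ψ (τ + σ) = 0 := by
        by_contra h'
        obtain ⟨h1, h2⟩ := hψ0 _ h'
        rw [mem_closedBall_zero_iff] at hσ
        refine hτ ⟨?_, ?_⟩
        · rw [mem_closedBall_zero_iff]
          have : ‖τ‖ ≤ ‖τ + σ‖ + ‖σ‖ := by
            simpa using norm_sub_le (τ + σ) σ
          linarith
        · rw [mem_ball_zero_iff, not_lt]
          have := norm_add_le τ σ
          linarith
      simp [this]
  rw [setIntegral_congr_fun measurableSet_closedBall hinner, integral_mul_const,
    integral_complex_ofReal, setIntegral_eq_integral_of_forall_compl_eq_zero hh0]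
  simp only [h]
  rw [h₀.integral_normed]
  simp

theorem norm_cexp_mul_ofReal_le (x y : ℝ) :
    ‖Complex.exp (Complex.I * (x : ℂ)) * (y : ℂ)‖ = |y| := by
  rw [norm_mul, norm_cexp_I_mul_ofReal, one_mul, Complex.norm_real, Real.norm_eq_abs]

theorem integrable_cexp_mul {X : Type*} [MeasurableSpace X] {μ : Measure X} {f : X → ℝ}
    {g : X → ℝ} (hf : AEStronglyMeasurable f μ) (hg : Integrable g μ) :
    Integrable (fun x => Complex.exp (Complex.I * (f x : ℂ)) * (g x : ℂ)) μ := by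
  refine hg.ofReal.bdd_mul (c := 1) ?_ (Filter.Eventually.of_forall fun x =>
    (norm_cexp_I_mul_ofReal _).le)
  exact Complex.continuous_exp.comp_aestronglyMeasurable
    ((Complex.continuous_ofReal.comp_aestronglyMeasurable hf).const_mul _)

theorem continuous_phase_left {k : ℕ} (s : ℝ) (u : Fin k → ℝ) :
    Continuous fun τ : Fin k → ℝ => s * (2 * Real.pi * (τ ⬝ᵥ u)) := by
  have := continuous_dotProduct_const u
  fun_prop

theorem norm_oscKernel_le {k : ℕ} (ψ : (Fin k → ℝ) → ℝ) (s : ℝ) (u : Fin k → ℝ) :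
    ‖oscKernel ψ s u‖ ≤ ∫ τ, |ψ τ| := by
  refine (norm_integral_le_integral_norm _).trans (le_of_eq ?_)
  simp only [norm_cexp_mul_ofReal_le]

theorem continuous_oscKernel {k : ℕ} {ψ : (Fin k → ℝ) → ℝ} (hψ : Integrable ψ) (s : ℝ) :
    Continuous (oscKernel ψ s) := by
  refine continuous_of_dominated (bound := fun τ => |ψ τ|) (fun u => ?_) (fun u => ?_) hψ.abs ?_
  · exact (integrable_cexp_mul (continuous_phase_left s u).aestronglyMeasurable
      hψ).aestronglyMeasurable
  · exact Filter.Eventually.of_forall fun τ => (norm_cexp_mul_ofReal_le _ _).le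
  · refine Filter.Eventually.of_forall fun τ => ?_
    have : Continuous fun u : Fin k → ℝ => τ ⬝ᵥ u := by
      simp only [dotProduct_comm τ]
      exact continuous_dotProduct_const τ
    fun_prop

theorem oscKernel_dilate {k : ℕ} {b : (Fin k → ℝ) → ℝ} (hb : Integrable b) (s : ℝ)
    (u : Fin k → ℝ) :
    (2 * s : ℂ) ^ k * oscKernel b (2 * s) u = (s : ℂ) ^ k * oscKernel b s u +
      (s : ℂ) ^ k * oscKernel (fun t => b ((1 / 2 : ℝ) • t) - b t) s u := by
  have h1 : oscKernel (fun t => b ((1 / 2 : ℝ) • t) - b t) s u =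
      oscKernel (fun t => b ((1 / 2 : ℝ) • t)) s u - oscKernel b s u := by
    simp only [oscKernel, Complex.ofReal_sub, mul_sub]
    refine integral_sub ?_ ?_
    · exact integrable_cexp_mul (continuous_phase_left s u).aestronglyMeasurable
        (hb.comp_smul (by norm_num))
    · exact integrable_cexp_mul (continuous_phase_left s u).aestronglyMeasurable hb
  have h2 : oscKernel (fun t => b ((1 / 2 : ℝ) • t)) s u = (2 : ℂ) ^ k * oscKernel b (2 * s) u := by
    have := Measure.integral_comp_smul (volume : Measure (Fin k → ℝ))
      (fun τ => Complex.exp (Complex.I * ((2 * s) * (2 * Real.pi * (τ ⬝ᵥ u)) : ℝ)) * (b τ : ℂ))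
      (1 / 2 : ℝ)
    simp only [Module.finrank_fintype_fun_eq_card, Fintype.card_fin] at this
    have e : |((1 / 2 : ℝ) ^ k)⁻¹| = 2 ^ k := by
      rw [abs_of_pos (by positivity)]
      simp
    rw [e, Complex.real_smul] at this
    push_cast at this
    simp only [oscKernel]
    push_cast
    rw [← this]
    refine integral_congr_ae (Filter.Eventually.of_forall fun τ => ?_)
    simp only [smul_dotProduct, smul_eq_mul]
    push_cast
    ring_nf
  rw [h1, h2]
  ring

/-- Multi-scale decomposition: bounds for the dyadic pieces imply a bound at all scales. -/
theorem norm_integral_oscKernel_le {X : Type*} [MeasurableSpace X] (μ : Measure X)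
    [IsFiniteMeasure μ] {d k : ℕ} (hdk : k < d) {b : (Fin k → ℝ) → ℝ} (hb : Integrable b)
    {a : X → ℂ} (ha : AEStronglyMeasurable a μ) (ha1 : ∀ x, ‖a x‖ ≤ 1) {θ : X → Fin k → ℝ}
    (hθ : Measurable θ) {C : ℝ} (hC : 0 ≤ C)
    (H : ∀ c s, 0 < s → ‖∫ x, a x * oscKernel (fun t => b ((1 / 2 : ℝ) • t) - b t) s
      (θ x - c) ∂μ‖ ≤ C * √((s ^ (d + k))⁻¹ * μ.real Set.univ))
    {l : ℝ} (hl : 0 < l) (hl' : μ.real Set.univ = (l ^ (d + k))⁻¹) (c : Fin k → ℝ) (J : ℕ) :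
    ‖∫ x, a x * (((2 ^ J * l : ℝ) : ℂ) ^ k * oscKernel b (2 ^ J * l) (θ x - c)) ∂μ‖ ≤
      ((∫ τ, |b τ|) + C * (1 - 2 ^ k * √((2 ^ (d + k) : ℝ)⁻¹))⁻¹) * (l ^ d)⁻¹ := by
  set B := ∫ τ, |b τ| with hB
  set ρ := 2 ^ k * √((2 ^ (d + k) : ℝ)⁻¹) with hρ
  have hρ0 : 0 ≤ ρ := by positivity
  have hρ1 : ρ < 1 := by
    refine lt_of_pow_lt_pow_left₀ 2 zero_le_one ?_
    rw [hρ, mul_pow, Real.sq_sqrt (by positivity), one_pow, ← pow_mul,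
      mul_inv_lt_iff₀ (by positivity), one_mul]
    exact pow_lt_pow_right₀ (by norm_num) (by omega)
  have hbψ : Integrable (fun t => b ((1 / 2 : ℝ) • t) - b t) :=
    (hb.comp_smul (by norm_num)).sub hb
  have hInt : ∀ {ψ : (Fin k → ℝ) → ℝ} (_ : Integrable ψ) (s : ℝ),
      Integrable (fun x => a x * oscKernel ψ s (θ x - c)) μ := by
    intro ψ hψ s
    refine Integrable.bdd_mul (c := 1) ?_ ha (Filter.Eventually.of_forall ha1)
    refine Integrable.of_bound ((continuous_oscKernel hψ s).measurable.comp
      (hθ.sub_const c)).aestronglyMeasurable _ (Filter.Eventually.of_forall fun x =>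
      norm_oscKernel_le ψ s _)
  have hcoe : ∀ j : ℕ, ‖((2 ^ j * l : ℝ) : ℂ)‖ = 2 ^ j * l := fun j => by
    rw [Complex.norm_real, Real.norm_of_nonneg (by positivity)]
  have hmain : ∀ J : ℕ,
      ‖∫ x, a x * (((2 ^ J * l : ℝ) : ℂ) ^ k * oscKernel b (2 ^ J * l) (θ x - c)) ∂μ‖ ≤
      (B + C * ∑ j ∈ Finset.range J, ρ ^ j) * (l ^ d)⁻¹ := by
    intro J
    induction J with
    | zero =>
      simp only [pow_zero, one_mul, Finset.range_zero, Finset.sum_empty, mul_zero, add_zero]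
      calc _ ≤ (l ^ k * B) * μ.real Set.univ := by
            refine norm_integral_le_of_norm_le_const (Filter.Eventually.of_forall fun x => ?_)
            rw [norm_mul, norm_mul, norm_pow, Complex.norm_real, Real.norm_of_nonneg hl.le]
            calc ‖a x‖ * (l ^ k * ‖oscKernel b l (θ x - c)‖) ≤ 1 * (l ^ k * B) := by
                  gcongr
                  · exact ha1 x
                  · exact norm_oscKernel_le _ _ _
              _ = _ := one_mul _
        _ = _ := by
          rw [hl', pow_add]
          field_simp
    | succ J ih =>
      have hs : 0 < 2 ^ J * l := by positivity
      have e : ∀ x, a x * (((2 ^ (J + 1) * l : ℝ) : ℂ) ^ k *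
          oscKernel b (2 ^ (J + 1) * l) (θ x - c)) =
          a x * (((2 ^ J * l : ℝ) : ℂ) ^ k * oscKernel b (2 ^ J * l) (θ x - c)) +
          ((2 ^ J * l : ℝ) : ℂ) ^ k * (a x *
          oscKernel (fun t => b ((1 / 2 : ℝ) • t) - b t) (2 ^ J * l) (θ x - c)) := by
        intro x
        have := oscKernel_dilate hb (2 ^ J * l) (θ x - c)
        have e1 : (2 : ℝ) ^ (J + 1) * l = 2 * (2 ^ J * l) := by ring
        have e2 : ((2 * (2 ^ J * l) : ℝ) : ℂ) = 2 * ((2 ^ J * l : ℝ) : ℂ) := by push_cast; ring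
        rw [e1, e2, this]
        ring
      simp only [e]
      rw [integral_add _ ((hInt hbψ _).const_mul _), integral_const_mul, Finset.sum_range_succ]
      · refine (norm_add_le _ _).trans ?_
        have h1 := H c _ hs
        have h2 : (2 ^ J * l) ^ k * (C * √(((2 ^ J * l) ^ (d + k))⁻¹ * μ.real Set.univ)) =
            C * ρ ^ J * (l ^ d)⁻¹ := by
          have : √(((2 ^ J * l) ^ (d + k))⁻¹ * μ.real Set.univ) =
              √((2 ^ (d + k) : ℝ)⁻¹) ^ J * (l ^ (d + k))⁻¹ := by
            rw [hl', Real.sqrt_eq_iff_mul_self_eq (by positivity) (by positivity)]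
            rw [mul_mul_mul_comm, ← pow_add, ← two_mul, pow_mul, Real.sq_sqrt (by positivity)]
            rw [mul_pow, ← pow_mul, mul_comm J, pow_mul]
            rw [mul_inv, inv_pow]
            ring
          rw [this, hρ, mul_pow, mul_pow, ← pow_mul, ← pow_mul, mul_comm J k, pow_add]
          field_simp
          ring
        rw [norm_mul, norm_pow, hcoe]
        calc _ ≤ (B + C * ∑ j ∈ Finset.range J, ρ ^ j) * (l ^ d)⁻¹ +
              (2 ^ J * l) ^ k * (C * √(((2 ^ J * l) ^ (d + k))⁻¹ * μ.real Set.univ)) := by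
              gcongr
          _ = _ := by rw [h2]; ring
      · have := (hInt hb (2 ^ J * l)).const_mul (((2 ^ J * l : ℝ) : ℂ) ^ k)
        refine this.congr (Filter.Eventually.of_forall fun x => ?_)
        simp only
        ring
  refine (hmain J).trans ?_
  gcongr
  have := (summable_geometric_of_lt_one hρ0 hρ1).sum_le_tsum (Finset.range J)
    (fun j _ => pow_nonneg hρ0 j)
  rwa [tsum_geometric_of_lt_one hρ0 hρ1] at this

/-- A continuous nonnegative kernel `g` which is the inverse Fourier transform of `w`, and `w`
the Fourier transform of `g`. -/
structure IsFourierPair {k : ℕ} (w g : (Fin k → ℝ) → ℝ) : Prop where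
  continuous_w : Continuous w
  continuous_g : Continuous g
  integrable_w : Integrable w
  integrable_g : Integrable g
  w_nonneg : ∀ t, 0 ≤ w t
  g_nonneg : ∀ t, 0 ≤ g t
  g_eq : ∀ u, (g u : ℂ) = ∫ t, Complex.exp (Complex.I * (2 * Real.pi * (t ⬝ᵥ u) : ℝ)) * (w t : ℂ)
  w_eq : ∀ t, (w t : ℂ) = ∫ u, Complex.exp (Complex.I * (2 * Real.pi * (t ⬝ᵥ u) : ℝ)) * (g u : ℂ)

theorem IsFourierPair.w_zero {k : ℕ} {w g : (Fin k → ℝ) → ℝ} (h : IsFourierPair w g) :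
    w 0 = ∫ u, g u := by
  have := h.w_eq 0
  simp only [zero_dotProduct, mul_zero, Complex.ofReal_zero, Complex.exp_zero, one_mul,
    integral_complex_ofReal] at this
  exact_mod_cast this

theorem IsFourierPair.integral_mul_oscKernel {k : ℕ} {w g b : (Fin k → ℝ) → ℝ}
    (h : IsFourierPair w g) (hb : Integrable b) {s : ℝ} (hs : 0 < s) (u : Fin k → ℝ) :
    ∫ v, (g v : ℂ) * ((s : ℂ) ^ k * oscKernel b s (u + v)) =
      ∫ t, Complex.exp (Complex.I * (2 * Real.pi * (t ⬝ᵥ u) : ℝ)) * ((b (s⁻¹ • t) * w t : ℝ) : ℂ) := by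
  have h1 : ∫ v, (g v : ℂ) * oscKernel b s (u + v) =
      ∫ τ, Complex.exp (Complex.I * (s * (2 * Real.pi * (τ ⬝ᵥ u)) : ℝ)) *
        ((b τ * w (s • τ) : ℝ) : ℂ) := by
    simp only [oscKernel, ← integral_const_mul]
    rw [integral_integral_swap]
    · refine integral_congr_ae (Filter.Eventually.of_forall fun τ => ?_)
      simp only
      rw [Complex.ofReal_mul (b τ), h.w_eq, ← integral_const_mul, ← integral_const_mul]
      refine integral_congr_ae (Filter.Eventually.of_forall fun v => ?_)
      simp only
      have e : s * (2 * Real.pi * (τ ⬝ᵥ (u + v))) = s * (2 * Real.pi * (τ ⬝ᵥ u)) +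
          2 * Real.pi * ((s • τ) ⬝ᵥ v) := by
        rw [dotProduct_add, smul_dotProduct, smul_eq_mul]
        ring
      rw [e, Complex.ofReal_add, mul_add, Complex.exp_add]
      ring
    · have := h.integrable_g.mul_prod hb
      refine (integrable_cexp_mul (f := fun z : (Fin k → ℝ) × (Fin k → ℝ) =>
        s * (2 * Real.pi * (z.2 ⬝ᵥ (u + z.1)))) ?_ this).congr
        (Filter.Eventually.of_forall fun z => ?_)
      · refine Continuous.aestronglyMeasurable ?_
        simp only [dotProduct, Pi.add_apply]
        fun_prop
      · simp only [Function.uncurry]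
        push_cast
        ring
  have h2 := Measure.integral_comp_smul (volume : Measure (Fin k → ℝ))
    (fun t => Complex.exp (Complex.I * (2 * Real.pi * (t ⬝ᵥ u) : ℝ)) *
      ((b (s⁻¹ • t) * w t : ℝ) : ℂ)) s
  simp only [Module.finrank_fintype_fun_eq_card, Fintype.card_fin] at h2
  rw [abs_of_pos (by positivity), Complex.real_smul] at h2
  have h3 : ∫ τ, Complex.exp (Complex.I * (s * (2 * Real.pi * (τ ⬝ᵥ u)) : ℝ)) *
        ((b τ * w (s • τ) : ℝ) : ℂ) = ∫ τ, Complex.exp (Complex.I * (2 * Real.pi * ((s • τ) ⬝ᵥ u) : ℝ)) *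
      ((b (s⁻¹ • s • τ) * w (s • τ) : ℝ) : ℂ) := by
    refine integral_congr_ae (Filter.Eventually.of_forall fun τ => ?_)
    simp only [smul_dotProduct, smul_eq_mul, inv_smul_smul₀ hs.ne']
    ring_nf
  rw [← h3] at h2
  have h4 : ∀ v, (g v : ℂ) * ((s : ℂ) ^ k * oscKernel b s (u + v)) =
    (s : ℂ) ^ k * ((g v : ℂ) * oscKernel b s (u + v)) := fun v => by ring
  simp only [h4, integral_const_mul]
  rw [h1, h2]
  push_cast
  rw [mul_inv_cancel_left₀ (pow_ne_zero _ (by exact_mod_cast hs.ne'))]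

/-- Uniform bounds for smoothly truncated kernels pass to the averaged kernel. -/
theorem norm_integral_fourierPair_le {X : Type*} [MeasurableSpace X] (μ : Measure X)
    [IsFiniteMeasure μ] {k : ℕ} {b w g : (Fin k → ℝ) → ℝ} (hb : Integrable b)
    (hbc : Continuous b) (hb0 : b 0 = 1) (hb1 : ∀ t, |b t| ≤ 1) (hwg : IsFourierPair w g)
    {a : X → ℂ} (ha : AEStronglyMeasurable a μ) (ha1 : ∀ x, ‖a x‖ ≤ 1) {θ : X → Fin k → ℝ}
    (hθ : Measurable θ) {C : ℝ} {l : ℝ} (hl : 0 < l)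
    (H : ∀ c, ∀ J : ℕ, ‖∫ x, a x * (((2 ^ J * l : ℝ) : ℂ) ^ k *
      oscKernel b (2 ^ J * l) (θ x - c)) ∂μ‖ ≤ C) (c : Fin k → ℝ) :
    ‖∫ x, a x * (g (θ x - c) : ℂ) ∂μ‖ ≤ C * w 0 := by
  let s : ℕ → ℝ := fun J => 2 ^ J * l
  have hs : ∀ J, 0 < s J := fun J => by positivity
  have hst : Filter.Tendsto (fun J => (s J)⁻¹) Filter.atTop (nhds 0) := by
    refine tendsto_inv_atTop_zero.comp ?_
    exact (tendsto_pow_atTop_atTop_of_one_lt (one_lt_two : (1 : ℝ) < 2)).atTop_mul_const hl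
  let G : ℕ → (Fin k → ℝ) → ℂ := fun J u =>
    ∫ t, Complex.exp (Complex.I * (2 * Real.pi * (t ⬝ᵥ u) : ℝ)) * ((b ((s J)⁻¹ • t) * w t : ℝ) : ℂ)
  have hphase : ∀ u : Fin k → ℝ, Continuous fun t : Fin k → ℝ => 2 * Real.pi * (t ⬝ᵥ u) := by
    intro u
    have := continuous_dotProduct_const u
    fun_prop
  have hbw : ∀ J t, |b ((s J)⁻¹ • t) * w t| ≤ w t := by
    intro J t
    rw [abs_mul, abs_of_nonneg (hwg.w_nonneg t)]
    exact mul_le_of_le_one_left (hwg.w_nonneg t) (hb1 _)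
  have hcb : ∀ J, Continuous fun t => b ((s J)⁻¹ • t) * w t := fun J =>
    (hbc.comp (continuous_const_smul _)).mul hwg.continuous_w
  have hGt : ∀ u, Filter.Tendsto (fun J => G J u) Filter.atTop (nhds (g u : ℂ)) := by
    intro u
    rw [hwg.g_eq]
    refine tendsto_integral_of_dominated_convergence w (fun J => ?_) hwg.integrable_w
      (fun J => Filter.Eventually.of_forall fun t => ?_) (Filter.Eventually.of_forall fun t => ?_)
    · have := hcb J
      have := hphase u
      exact Continuous.aestronglyMeasurable (by fun_prop)
    · rw [norm_cexp_mul_ofReal_le]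
      exact hbw J t
    · refine Filter.Tendsto.const_mul _ ?_
      have h1 : Filter.Tendsto (fun J => b ((s J)⁻¹ • t)) Filter.atTop (nhds 1) := by
        have h2 : Filter.Tendsto (fun J => (s J)⁻¹ • t) Filter.atTop (nhds 0) := by
          simpa using hst.smul_const t
        have h3 := (hbc.tendsto 0).comp h2
        rwa [hb0] at h3
      have h4 := (Complex.continuous_ofReal.tendsto _).comp (h1.mul_const (w t))
      rw [one_mul] at h4
      exact h4
  have hGb : ∀ J u, ‖G J u‖ ≤ ∫ t, w t := by
    intro J u
    refine norm_integral_le_of_norm_le hwg.integrable_w (Filter.Eventually.of_forall fun t => ?_)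
    rw [norm_cexp_mul_ofReal_le]
    exact hbw J t
  have hGeq : ∀ J u, ∫ v, (g v : ℂ) * ((s J : ℂ) ^ k * oscKernel b (s J) (u + v)) = G J u :=
    fun J u => hwg.integral_mul_oscKernel hb (hs J) u
  have hosc : ∀ J, Continuous (oscKernel b (s J)) := fun J => continuous_oscKernel hb _
  have key : ∀ J, ‖∫ x, a x * G J (θ x - c) ∂μ‖ ≤ C * w 0 := by
    intro J
    simp only [← hGeq, ← integral_const_mul]
    rw [integral_integral_swap]
    · have e : ∀ v, ∫ x, a x * ((g v : ℂ) * ((s J : ℂ) ^ k * oscKernel b (s J) (θ x - c + v))) ∂μ =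
          (g v : ℂ) * ∫ x, a x * ((s J : ℂ) ^ k * oscKernel b (s J) (θ x - (c - v))) ∂μ := by
        intro v
        rw [← integral_const_mul]
        refine integral_congr_ae (Filter.Eventually.of_forall fun x => ?_)
        simp only
        rw [show θ x - c + v = θ x - (c - v) by abel]
        ring
      simp only [e]
      rw [hwg.w_zero, ← integral_const_mul]
      refine norm_integral_le_of_norm_le (hwg.integrable_g.const_mul C)
        (Filter.Eventually.of_forall fun v => ?_)
      rw [norm_mul, Complex.norm_real, Real.norm_of_nonneg (hwg.g_nonneg v), mul_comm]
      exact mul_le_mul_of_nonneg_right (H _ J) (hwg.g_nonneg v)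
    · have h1 : Integrable (fun z : X × (Fin k → ℝ) => ((g z.2 : ℝ) : ℂ)) (μ.prod volume) :=
        (hwg.integrable_g.comp_snd μ).ofReal
      have h2 : AEStronglyMeasurable (fun z : X × (Fin k → ℝ) => a z.1 * ((s J : ℂ) ^ k *
          oscKernel b (s J) (θ z.1 - c + z.2))) (μ.prod volume) := by
        refine (ha.comp_fst).mul ?_
        refine Measurable.aestronglyMeasurable ?_
        refine Measurable.const_mul ?_ _
        exact (hosc J).measurable.comp
          (((hθ.comp measurable_fst).sub_const c).add measurable_snd)
      refine (h1.bdd_mul (c := (s J) ^ k * ∫ τ, |b τ|) h2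
        (Filter.Eventually.of_forall fun z => ?_)).congr (Filter.Eventually.of_forall fun z => ?_)
      · rw [norm_mul, norm_mul, norm_pow, Complex.norm_real, Real.norm_of_nonneg (hs J).le]
        calc _ ≤ 1 * ((s J) ^ k * ∫ τ, |b τ|) := by
              have := (hs J).le
              gcongr
              · exact ha1 _
              · exact norm_oscKernel_le _ _ _
          _ = _ := one_mul _
      · simp only [Function.uncurry]
        ring
  have hlim : Filter.Tendsto (fun J => ∫ x, a x * G J (θ x - c) ∂μ) Filter.atTop
      (nhds (∫ x, a x * (g (θ x - c) : ℂ) ∂μ)) := ?_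
  · exact le_of_tendsto' hlim.norm key
  refine tendsto_integral_of_dominated_convergence (fun _ => ∫ t, w t) (fun J => ?_)
    (integrable_const _) (fun J => Filter.Eventually.of_forall fun x => ?_)
    (Filter.Eventually.of_forall fun x => (hGt _).const_mul _)
  · refine ha.mul (Measurable.aestronglyMeasurable ?_)
    have : Continuous (G J) := by
      refine continuous_of_dominated (bound := w) (fun u => ?_) (fun u => ?_) hwg.integrable_w ?_
      · have := hcb J
        have := hphase u
        exact Continuous.aestronglyMeasurable (by fun_prop)
      · refine Filter.Eventually.of_forall fun t => ?_
        rw [norm_cexp_mul_ofReal_le]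
        exact hbw J t
      · refine Filter.Eventually.of_forall fun τ => ?_
        have : Continuous fun u : Fin k → ℝ => τ ⬝ᵥ u := by
          simp only [dotProduct_comm τ]
          exact continuous_dotProduct_const τ
        fun_prop
    exact this.measurable.comp (hθ.sub_const c)
  · rw [norm_mul]
    calc _ ≤ 1 * ∫ t, w t := by
          gcongr
          · exact ha1 _
          · exact hGb _ _
      _ = _ := one_mul _

theorem continuous_radonTheta {d k : ℕ} {Φ : (Fin d → ℝ) → Fin k → ℝ} (hΦ : Continuous Φ)
    (ζ : Fin d → ℝ) :
    Continuous fun z : (Fin d → ℝ) × (Fin d → ℝ) => radonTheta Φ ζ z.2 z.1 := by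
  unfold radonTheta
  fun_prop

/-- Restricted estimate for the averaging operator. -/
theorem exists_average_bound {d k : ℕ} (hdk : k < d) {Φ : (Fin d → ℝ) → Fin k → ℝ}
    (hΦ : ContDiff ℝ (⊤ : ℕ∞) Φ) (ν₁ ν₂ : Fin d → ℝ)
    (hM : ∀ t ≠ 0, (Mmat d k Φ t ν₁ ν₂ ν₂).det ≠ 0) :
    ∃ δ : ℝ, 0 < δ ∧ ∃ C : ℝ, 0 ≤ C ∧ ∀ w g : (Fin k → ℝ) → ℝ, IsFourierPair w g → w 0 = 1 →
      ∀ ζ c, ∀ E ⊆ Metric.closedBall ν₁ δ, MeasurableSet E → ∀ F ⊆ Metric.closedBall ν₁ δ,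
      MeasurableSet F →
      ∫⁻ y in F, ∫⁻ x in E, (Metric.closedBall ν₂ δ).indicator 1 (y - x + ζ) *
        ENNReal.ofReal (g (radonTheta Φ ζ x y - c)) ≤
        ENNReal.ofReal C * (volume E * volume F) ^ ((d : ℝ) / (d + k)) := by
  let b : ContDiffBump (0 : Fin k → ℝ) := ⟨1, 2, one_pos, one_lt_two⟩
  have hbint : Integrable (b : (Fin k → ℝ) → ℝ) :=
    b.continuous.integrable_of_hasCompactSupport b.hasCompactSupport
  have hψ0 : ∀ t : Fin k → ℝ, b ((1 / 2 : ℝ) • t) - b t ≠ 0 → 1 ≤ ‖t‖ ∧ ‖t‖ ≤ 4 := by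
    intro t ht
    have hn : ‖(1 / 2 : ℝ) • t‖ = ‖t‖ / 2 := by
      rw [norm_smul]
      norm_num
      ring
    constructor
    · by_contra! h
      apply ht
      rw [b.one_of_mem_closedBall (x := t) (by rw [mem_closedBall_zero_iff]; exact h.le),
        b.one_of_mem_closedBall (x := (1 / 2 : ℝ) • t) (by
          rw [mem_closedBall_zero_iff, hn]; simp only [b]; linarith [norm_nonneg t]), sub_self]
    · by_contra! h
      apply ht
      rw [b.zero_of_le_dist (x := t) (by rw [dist_zero_right]; simp only [b]; linarith),
        b.zero_of_le_dist (x := (1 / 2 : ℝ) • t) (by rw [dist_zero_right, hn]; simp only [b]; linarith), sub_self]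
  obtain ⟨δ, hδ, χ, hχ, hχ0, hχ1, hχe, C, hC, H⟩ := exists_radon_dyadic_bound hΦ ν₁ ν₂ hM
    (ψ := fun t => b ((1 / 2 : ℝ) • t) - b t)
    ((b.contDiff.comp (contDiff_const_smul _)).sub b.contDiff) hψ0
  set B := (∫ τ, |b τ|) + C * (1 - 2 ^ k * √((2 ^ (d + k) : ℝ)⁻¹))⁻¹ with hB
  refine ⟨δ, hδ, max B 0, le_max_right _ _, ?_⟩
  intro w g hwg hw0 ζ c E hE hEm F hF hFm
  have hEf : volume E ≠ ∞ := ((measure_mono hE).trans_lt (isCompact_closedBall _ _).measure_lt_top).ne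
  have hFf : volume F ≠ ∞ := ((measure_mono hF).trans_lt (isCompact_closedBall _ _).measure_lt_top).ne
  by_cases hE0 : volume E = 0
  · simp [Measure.restrict_eq_zero.2 hE0]
  by_cases hF0 : volume F = 0
  · simp [Measure.restrict_eq_zero.2 hF0]
  have hEf' : Fact (volume E < ∞) := ⟨hEf.lt_top⟩
  have hFf' : Fact (volume F < ∞) := ⟨hFf.lt_top⟩
  let μ := (volume.restrict F).prod (volume.restrict E)
  have hPE : 0 < volume.real E := ENNReal.toReal_pos hE0 hEf
  have hPF : 0 < volume.real F := ENNReal.toReal_pos hF0 hFf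
  have hμ : μ.real Set.univ = volume.real E * volume.real F := by
    rw [← Set.univ_prod_univ, measureReal_prod_prod]
    simp [mul_comm]
  let a : (Fin d → ℝ) × (Fin d → ℝ) → ℂ := fun z => (χ (z.1 - z.2 + ζ) : ℂ)
  have hac : Continuous fun z : (Fin d → ℝ) × (Fin d → ℝ) => χ (z.1 - z.2 + ζ) := by fun_prop
  have ha : Continuous a := by fun_prop
  have ha1 : ∀ z, ‖a z‖ ≤ 1 := by
    intro z
    rw [Complex.norm_real, Real.norm_of_nonneg (hχ0 _)]
    exact hχ1 _
  have hθ := continuous_radonTheta hΦ.continuous ζ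
  have hψi : Integrable (fun t : Fin k → ℝ => b ((1 / 2 : ℝ) • t) - b t) :=
    (hbint.comp_smul (by norm_num)).sub hbint
  set P := volume.real E * volume.real F with hP
  have hP0 : 0 < P := by positivity
  have hdk0 : (0 : ℝ) < d + k := by
    have : (0 : ℝ) ≤ k := by positivity
    have : (k : ℝ) < d := by exact_mod_cast hdk
    linarith
  let l : ℝ := P ^ (-(1 / ((d : ℝ) + k)))
  have hl : 0 < l := Real.rpow_pos_of_pos hP0 _
  have hlP : P = (l ^ (d + k))⁻¹ := by
    rw [← Real.rpow_natCast, ← Real.rpow_mul hP0.le, ← Real.rpow_neg hP0.le]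
    push_cast
    rw [neg_mul, neg_neg, one_div, inv_mul_cancel₀ hdk0.ne', Real.rpow_one]
  have hlP' : (l ^ d)⁻¹ = P ^ ((d : ℝ) / (d + k)) := by
    rw [← Real.rpow_natCast, ← Real.rpow_mul hP0.le, ← Real.rpow_neg hP0.le]
    congr 1
    field_simp
  have hdy : ∀ c s, 0 < s → ‖∫ z, a z * oscKernel (fun t => b ((1 / 2 : ℝ) • t) - b t) s
      (radonTheta Φ ζ z.2 z.1 - c) ∂μ‖ ≤ C * √((s ^ (d + k))⁻¹ * μ.real Set.univ) := by
    intro c s hs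
    have h1 := H ζ E hE hEm F hF hFm c s hs
    rw [mul_assoc (s ^ (d + k))⁻¹, ← hP, ← hμ] at h1
    refine le_trans (le_of_eq ?_) h1
    congr 1
    refine integral_prod _ ?_
    refine Integrable.bdd_mul (c := 1) ?_ ha.aestronglyMeasurable
      (Filter.Eventually.of_forall ha1)
    exact Integrable.of_bound (((continuous_oscKernel hψi s).comp
      (hθ.sub continuous_const)).aestronglyMeasurable) _ (Filter.Eventually.of_forall fun x =>
      norm_oscKernel_le _ s _)
  have key := norm_integral_fourierPair_le μ hbint b.continuous
    (b.one_of_mem_closedBall (by simp [b])) (fun t => by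
      rw [abs_of_nonneg b.nonneg]; exact b.le_one) hwg ha.aestronglyMeasurable ha1 hθ.measurable hl
    (fun c J => norm_integral_oscKernel_le μ hdk hbint ha.aestronglyMeasurable ha1 hθ.measurable
      hC hdy hl (hμ.trans hlP) c J) c
  rw [hw0, mul_one, ← hB, hlP'] at key
  have hgc : Continuous fun z : (Fin d → ℝ) × (Fin d → ℝ) => g (radonTheta Φ ζ z.2 z.1 - c) :=
    hwg.continuous_g.comp (hθ.sub continuous_const)
  have hInt : Integrable (fun z : (Fin d → ℝ) × (Fin d → ℝ) =>
      χ (z.1 - z.2 + ζ) * g (radonTheta Φ ζ z.2 z.1 - c)) μ := by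
    have h1 : IntegrableOn (fun z : (Fin d → ℝ) × (Fin d → ℝ) =>
      χ (z.1 - z.2 + ζ) * g (radonTheta Φ ζ z.2 z.1 - c)) (F ×ˢ E) (volume.prod volume) :=
      ((hac.mul hgc).continuousOn.integrableOn_compact
      ((isCompact_closedBall ν₁ δ).prod (isCompact_closedBall ν₁ δ))).mono_set
      (Set.prod_mono hF hE)
    rwa [IntegrableOn, ← Measure.prod_restrict] at h1
  have hnn : 0 ≤ ∫ z, χ (z.1 - z.2 + ζ) * g (radonTheta Φ ζ z.2 z.1 - c) ∂μ :=
    integral_nonneg fun z => mul_nonneg (hχ0 _) (hwg.g_nonneg _)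
  calc ∫⁻ y in F, ∫⁻ x in E, (Metric.closedBall ν₂ δ).indicator 1 (y - x + ζ) *
        ENNReal.ofReal (g (radonTheta Φ ζ x y - c))
      ≤ ∫⁻ y in F, ∫⁻ x in E, ENNReal.ofReal
        (χ (y - x + ζ) * g (radonTheta Φ ζ x y - c)) := by
        refine lintegral_mono fun y => lintegral_mono fun x => ?_
        simp only
        rw [ENNReal.ofReal_mul (hχ0 _)]
        gcongr
        by_cases hx : y - x + ζ ∈ Metric.closedBall ν₂ δ
        · rw [hχe _ hx]
          simp [hx]
        · simp [hx]
    _ = ∫⁻ z, ENNReal.ofReal (χ (z.1 - z.2 + ζ) * g (radonTheta Φ ζ z.2 z.1 - c)) ∂μ := by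
        exact (lintegral_prod _ (hac.mul hgc).measurable.ennreal_ofReal.aemeasurable).symm
    _ = ENNReal.ofReal (∫ z, χ (z.1 - z.2 + ζ) * g (radonTheta Φ ζ z.2 z.1 - c) ∂μ) := by
        rw [ofReal_integral_eq_lintegral_ofReal hInt (Filter.Eventually.of_forall fun z =>
          mul_nonneg (hχ0 _) (hwg.g_nonneg _))]
    _ ≤ ENNReal.ofReal (max B 0 * P ^ ((d : ℝ) / (d + k))) := by
        refine ENNReal.ofReal_le_ofReal ?_
        have e : ∫ z, a z * (g (radonTheta Φ ζ z.2 z.1 - c) : ℂ) ∂μ =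
            ((∫ z, χ (z.1 - z.2 + ζ) * g (radonTheta Φ ζ z.2 z.1 - c) ∂μ : ℝ) : ℂ) := by
          rw [← integral_complex_ofReal]
          simp [a]
        rw [e, Complex.norm_real, Real.norm_of_nonneg hnn] at key
        refine key.trans ?_
        gcongr
        exact le_max_left _ _
    _ = ENNReal.ofReal (max B 0) * (volume E * volume F) ^ ((d : ℝ) / (d + k)) := by
        rw [ENNReal.ofReal_mul (le_max_right _ _), ← ENNReal.ofReal_rpow_of_pos hP0, hP,
          ENNReal.ofReal_mul hPE.le, ofReal_measureReal hEf, ofReal_measureReal hFf]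

/-- A quadrilinear form with kernel `Q`. -/
def fourForm {X : Type*} [MeasurableSpace X] (μ : Measure X) (Q : (X × X) × (X × X) → ℝ≥0∞)
    (f₁ f₂ g₁ g₂ : X → ℝ≥0∞) : ℝ≥0∞ :=
  ∫⁻ z, f₁ z.1.1 * f₂ z.1.2 * (g₁ z.2.1 * g₂ z.2.2) * Q z ∂(μ.prod μ).prod (μ.prod μ)

/-- The dyadic level sets of a function. -/
def dyadicLevel {X : Type*} (f : X → NNReal) (m : ℤ) : Set X :=
  {x | f x ≠ 0 ∧ Int.log 2 (f x) = m}


theorem measurableSet_dyadicLevel {X : Type*} [MeasurableSpace X] {f : X → NNReal}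
    (hf : Measurable f) (m : ℤ) : MeasurableSet (dyadicLevel f m) := by
  have : dyadicLevel f m = f ⁻¹' Set.Ico ((2 : NNReal) ^ m) (2 ^ (m + 1)) := by
    ext x
    simp only [dyadicLevel, Set.mem_ofPred_eq, Set.mem_preimage, Set.mem_Ico]
    constructor
    · rintro ⟨h0, rfl⟩
      have h0' := pos_iff_ne_zero.2 h0
      exact ⟨by exact_mod_cast Int.zpow_log_le_self one_lt_two h0',
        by exact_mod_cast Int.lt_zpow_succ_log_self one_lt_two (f x)⟩
    · rintro ⟨h1, h2⟩
      have h0' : 0 < f x := lt_of_lt_of_le (by positivity) h1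
      refine ⟨h0'.ne', le_antisymm ?_ ?_⟩
      · exact Int.lt_add_one_iff.1 ((Int.lt_zpow_iff_log_lt one_lt_two h0').1 (by exact_mod_cast h2))
      · exact (Int.zpow_le_iff_le_log one_lt_two h0').1 (by exact_mod_cast h1)
  rw [this]
  exact hf measurableSet_Ico

theorem coe_zpow_two (m : ℤ) : (((2 : NNReal) ^ m : NNReal) : ℝ≥0∞) = (2 : ℝ≥0∞) ^ (m : ℝ) := by
  rw [ENNReal.rpow_intCast, ENNReal.coe_zpow two_ne_zero]
  rfl

theorem tsum_dyadicLevel_le {X : Type*} [MeasurableSpace X] {μ : Measure X} {f : X → NNReal}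
    (hf : Measurable f) {p : ℝ} (hp : 0 ≤ p) :
    ∑' m : ℤ, (2 : ℝ≥0∞) ^ (m * p) * μ (dyadicLevel f m) ≤ ∫⁻ x, (f x : ℝ≥0∞) ^ p ∂μ := by
  have h1 : ∀ m : ℤ, (2 : ℝ≥0∞) ^ (m * p) * μ (dyadicLevel f m) =
      ∫⁻ x, (dyadicLevel f m).indicator (fun _ => (2 : ℝ≥0∞) ^ (m * p)) x ∂μ := fun m => by
    rw [lintegral_indicator_const (measurableSet_dyadicLevel hf m)]
  simp only [h1]
  rw [← lintegral_tsum fun m =>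
    (measurable_const.indicator (measurableSet_dyadicLevel hf m)).aemeasurable]
  refine lintegral_mono fun x => ?_
  by_cases hx : f x = 0
  · have : ∀ m : ℤ, (dyadicLevel f m).indicator (fun _ => (2 : ℝ≥0∞) ^ (m * p)) x = 0 := fun m =>
      Set.indicator_of_notMem (fun h => h.1 hx) _
    simp only [this, tsum_zero, zero_le]
  · simp only
    rw [tsum_eq_single (Int.log 2 (f x))]
    · rw [Set.indicator_of_mem (show x ∈ dyadicLevel f _ from ⟨hx, rfl⟩), ENNReal.rpow_mul,
        ← coe_zpow_two]
      refine ENNReal.rpow_le_rpow ?_ hp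
      exact_mod_cast Int.zpow_log_le_self one_lt_two (pos_iff_ne_zero.2 hx)
    · intro m hm
      exact Set.indicator_of_notMem (fun h => hm h.2.symm) _

theorem coe_le_two_rpow {x : NNReal} :
    (x : ℝ≥0∞) ≤ (2 : ℝ≥0∞) * (2 : ℝ≥0∞) ^ ((Int.log 2 x : ℤ) : ℝ) := by
  rw [← coe_zpow_two]
  have h := (Int.lt_zpow_succ_log_self (R := NNReal) one_lt_two x).le
  rw [zpow_add_one₀ (by norm_num)] at h
  rw [mul_comm] at h
  exact_mod_cast h

theorem fourForm_le_tsum {X : Type*} [MeasurableSpace X] {μ : Measure X} [SFinite μ]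
    {Q : (X × X) × (X × X) → ℝ≥0∞} (hQ : Measurable Q) {f g : X → NNReal} (hf : Measurable f)
    (hg : Measurable g) :
    fourForm μ Q (fun x => f x) (fun x => f x) (fun x => g x) (fun x => g x) ≤
      ∑' M : (ℤ × ℤ) × (ℤ × ℤ), 16 * (2 : ℝ≥0∞) ^ ((M.1.1 + M.1.2 + M.2.1 + M.2.2 : ℤ) : ℝ) *
        fourForm μ Q ((dyadicLevel f M.1.1).indicator 1) ((dyadicLevel f M.1.2).indicator 1)
        ((dyadicLevel g M.2.1).indicator 1) ((dyadicLevel g M.2.2).indicator 1) := by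
  have hm : ∀ {h : X → NNReal}, Measurable h → ∀ m, Measurable
      ((dyadicLevel h m).indicator (1 : X → ℝ≥0∞)) := fun hh m =>
    measurable_one.indicator (measurableSet_dyadicLevel hh m)
  have hmeas : ∀ M : (ℤ × ℤ) × (ℤ × ℤ), Measurable fun z : (X × X) × (X × X) =>
      (dyadicLevel f M.1.1).indicator (1 : X → ℝ≥0∞) z.1.1 *
      (dyadicLevel f M.1.2).indicator 1 z.1.2 * ((dyadicLevel g M.2.1).indicator 1 z.2.1 *
      (dyadicLevel g M.2.2).indicator 1 z.2.2) * Q z := by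
    intro M
    have h1 := hm hf M.1.1
    have h2 := hm hf M.1.2
    have h3 := hm hg M.2.1
    have h4 := hm hg M.2.2
    fun_prop
  simp only [fourForm]
  simp only [← lintegral_const_mul _ (hmeas _)]
  rw [← lintegral_tsum fun M => ((hmeas M).const_mul _).aemeasurable]
  refine lintegral_mono fun z => ?_
  simp only
  by_cases h0 : f z.1.1 = 0 ∨ f z.1.2 = 0 ∨ g z.2.1 = 0 ∨ g z.2.2 = 0
  · rcases h0 with h | h | h | h <;> simp [h]
  push Not at h0
  obtain ⟨h1, h2, h3, h4⟩ := h0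
  refine le_trans ?_ (ENNReal.le_tsum ((Int.log 2 (f z.1.1), Int.log 2 (f z.1.2)),
    (Int.log 2 (g z.2.1), Int.log 2 (g z.2.2))))
  simp only
  rw [Set.indicator_of_mem (show z.1.1 ∈ dyadicLevel f _ from ⟨h1, rfl⟩),
    Set.indicator_of_mem (show z.1.2 ∈ dyadicLevel f _ from ⟨h2, rfl⟩),
    Set.indicator_of_mem (show z.2.1 ∈ dyadicLevel g _ from ⟨h3, rfl⟩),
    Set.indicator_of_mem (show z.2.2 ∈ dyadicLevel g _ from ⟨h4, rfl⟩)]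
  simp only [Pi.one_apply, one_mul]
  refine mul_le_mul_left ?_ _
  push_cast
  rw [ENNReal.rpow_add _ _ (by norm_num) (by norm_num), ENNReal.rpow_add _ _ (by norm_num)
    (by norm_num), ENNReal.rpow_add _ _ (by norm_num) (by norm_num)]
  calc _ ≤ (2 * (2 : ℝ≥0∞) ^ ((Int.log 2 (f z.1.1) : ℤ) : ℝ)) *
        (2 * (2 : ℝ≥0∞) ^ ((Int.log 2 (f z.1.2) : ℤ) : ℝ)) *
        ((2 * (2 : ℝ≥0∞) ^ ((Int.log 2 (g z.2.1) : ℤ) : ℝ)) *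
        (2 * (2 : ℝ≥0∞) ^ ((Int.log 2 (g z.2.2) : ℤ) : ℝ))) := by
        gcongr <;> exact coe_le_two_rpow
    _ = _ := by ring

theorem exists_min_exponent_le {a : ℝ} (ha : 0 < a) (ha' : a ≤ 1 / 2) (m₁ m₂ n₁ n₂ : ℝ) :
    (-a * (m₁ + m₂) + n₁ + (2 * a - 1) * n₂ ≤ -(a / 12) * (|m₁ - m₂| + |n₁ - n₂| + |m₁ - n₁|) ∨
      -a * (m₁ + m₂) + n₂ + (2 * a - 1) * n₁ ≤ -(a / 12) * (|m₁ - m₂| + |n₁ - n₂| + |m₁ - n₁|)) ∨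
    (-a * (n₁ + n₂) + m₁ + (2 * a - 1) * m₂ ≤ -(a / 12) * (|m₁ - m₂| + |n₁ - n₂| + |m₁ - n₁|) ∨
      -a * (n₁ + n₂) + m₂ + (2 * a - 1) * m₁ ≤ -(a / 12) * (|m₁ - m₂| + |n₁ - n₂| + |m₁ - n₁|)) := by
  by_contra! h
  obtain ⟨⟨h1, h2⟩, h3, h4⟩ := h
  set S := n₁ + n₂ - m₁ - m₂ with hS
  have hX : a * S - (1 - a) * |n₁ - n₂| > -(a / 12) * (|m₁ - m₂| + |n₁ - n₂| + |m₁ - n₁|) := by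
    rcases le_total 0 (n₁ - n₂) with h | h
    · rw [abs_of_nonneg h] at *
      nlinarith
    · rw [abs_of_nonpos h] at *
      nlinarith
  have hY : -(a * S) - (1 - a) * |m₁ - m₂| >
      -(a / 12) * (|m₁ - m₂| + |n₁ - n₂| + |m₁ - n₁|) := by
    rcases le_total 0 (m₁ - m₂) with h | h
    · rw [abs_of_nonneg h] at *
      nlinarith
    · rw [abs_of_nonpos h] at *
      nlinarith
  have hmn : |m₁ - n₁| ≤ (|S| + |m₁ - m₂| + |n₁ - n₂|) / 2 := by
    have e : m₁ - n₁ = (-S + (m₁ - m₂) - (n₁ - n₂)) / 2 := by rw [hS]; ring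
    rw [e, abs_div, abs_two]
    gcongr
    refine (abs_sub _ _).trans ?_
    gcongr
    refine (abs_add_le _ _).trans ?_
    rw [abs_neg]
  have hN := abs_nonneg (n₁ - n₂)
  have hMm := abs_nonneg (m₁ - m₂)
  have p1 : a * |n₁ - n₂| ≤ 1 / 2 * |n₁ - n₂| := by gcongr
  have p2 : a * |m₁ - m₂| ≤ 1 / 2 * |m₁ - m₂| := by gcongr
  have p3 := mul_le_mul_of_nonneg_left hmn ha.le
  rcases le_total 0 S with h | h
  · rw [abs_of_nonneg h] at *
    nlinarith
  · rw [abs_of_nonpos h] at *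
    nlinarith

/-- A geometric weight on the integers. -/
def geomWeight (c : ℝ) (j : ℤ) : ℝ≥0∞ := (2 : ℝ≥0∞) ^ (-c * |(j : ℝ)|)

theorem tsum_geomWeight_ne_top {c : ℝ} (hc : 0 < c) : ∑' j, geomWeight c j ≠ ∞ := by
  have e : ∀ j : ℤ, geomWeight c j = ENNReal.ofReal ((2 : ℝ) ^ (-c * |(j : ℝ)|)) := fun j => by
    rw [← ENNReal.ofReal_rpow_of_pos two_pos]
    simp [geomWeight]
  simp only [e]
  refine Summable.tsum_ofReal_ne_top ?_
  have hn : Summable fun n : ℕ => ((2 : ℝ) ^ (-c)) ^ n :=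
    summable_geometric_of_lt_one (by positivity)
      (Real.rpow_lt_one_of_one_lt_of_neg one_lt_two (by linarith))
  refine Summable.of_nat_of_neg (hn.congr fun n => ?_) (hn.congr fun n => ?_)
  · rw [← Real.rpow_natCast, ← Real.rpow_mul two_pos.le]
    simp
  · rw [← Real.rpow_natCast, ← Real.rpow_mul two_pos.le]
    simp

theorem tsum_geomWeight_sub_left (c : ℝ) (i : ℤ) :
    ∑' j, geomWeight c (i - j) = ∑' j, geomWeight c j :=
  (Equiv.subLeft i).tsum_eq (geomWeight c)

theorem tsum_geomWeight_sub_right (c : ℝ) (i : ℤ) :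
    ∑' j, geomWeight c (j - i) = ∑' j, geomWeight c j :=
  (Equiv.subRight i).tsum_eq (geomWeight c)

theorem tsum_geomWeight_mul (c : ℝ) (e : ℤ → ℝ≥0∞) :
    ∑' M : (ℤ × ℤ) × (ℤ × ℤ), geomWeight c (M.1.1 - M.1.2) * geomWeight c (M.2.1 - M.2.2) *
      geomWeight c (M.1.1 - M.2.1) * e M.1.1 = (∑' j, geomWeight c j) ^ 3 * ∑' m, e m ∧
    ∑' M : (ℤ × ℤ) × (ℤ × ℤ), geomWeight c (M.1.1 - M.1.2) * geomWeight c (M.2.1 - M.2.2) *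
      geomWeight c (M.1.1 - M.2.1) * e M.1.2 = (∑' j, geomWeight c j) ^ 3 * ∑' m, e m ∧
    ∑' M : (ℤ × ℤ) × (ℤ × ℤ), geomWeight c (M.1.1 - M.1.2) * geomWeight c (M.2.1 - M.2.2) *
      geomWeight c (M.1.1 - M.2.1) * e M.2.1 = (∑' j, geomWeight c j) ^ 3 * ∑' m, e m ∧
    ∑' M : (ℤ × ℤ) × (ℤ × ℤ), geomWeight c (M.1.1 - M.1.2) * geomWeight c (M.2.1 - M.2.2) *
      geomWeight c (M.1.1 - M.2.1) * e M.2.2 = (∑' j, geomWeight c j) ^ 3 * ∑' m, e m := by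
  set K := ∑' j, geomWeight c j with hK
  have hl : ∀ i, ∑' j, geomWeight c (i - j) = K := tsum_geomWeight_sub_left c
  have hr : ∀ i, ∑' j, geomWeight c (j - i) = K := tsum_geomWeight_sub_right c
  have A : ∀ F : ℤ → ℤ → ℤ → ℤ → ℝ≥0∞, ∑' M : (ℤ × ℤ) × (ℤ × ℤ), F M.1.1 M.1.2 M.2.1 M.2.2 =
      ∑' m₁, ∑' m₂, ∑' n₁, ∑' n₂, F m₁ m₂ n₁ n₂ := by
    intro F
    rw [ENNReal.tsum_prod (f := fun (u v : ℤ × ℤ) => F u.1 u.2 v.1 v.2),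
      ENNReal.tsum_prod (f := fun m₁ m₂ => ∑' v : ℤ × ℤ, F m₁ m₂ v.1 v.2)]
    refine tsum_congr fun m₁ => tsum_congr fun m₂ => ?_
    rw [ENNReal.tsum_prod]
  refine ⟨?_, ?_, ?_, ?_⟩
  · rw [A fun m₁ m₂ n₁ n₂ => geomWeight c (m₁ - m₂) * geomWeight c (n₁ - n₂) *
      geomWeight c (m₁ - n₁) * e m₁]
    simp only [ENNReal.tsum_mul_right, ENNReal.tsum_mul_left, hl]
    ring
  · rw [A fun m₁ m₂ n₁ n₂ => geomWeight c (m₁ - m₂) * geomWeight c (n₁ - n₂) *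
      geomWeight c (m₁ - n₁) * e m₂]
    simp only [ENNReal.tsum_mul_right, ENNReal.tsum_mul_left, hl]
    rw [ENNReal.tsum_comm]
    simp only [ENNReal.tsum_mul_right, ENNReal.tsum_mul_left, hr]
    ring
  · rw [A fun m₁ m₂ n₁ n₂ => geomWeight c (m₁ - m₂) * geomWeight c (n₁ - n₂) *
      geomWeight c (m₁ - n₁) * e n₁]
    have : ∀ m₁ m₂ : ℤ, ∑' n₁, ∑' n₂, geomWeight c (m₁ - m₂) * geomWeight c (n₁ - n₂) *
      geomWeight c (m₁ - n₁) * e n₁ = geomWeight c (m₁ - m₂) * ∑' n₁, K *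
      geomWeight c (m₁ - n₁) * e n₁ := fun m₁ m₂ => by
      simp only [ENNReal.tsum_mul_right, ENNReal.tsum_mul_left, hl, mul_assoc]
    simp only [this]
    simp only [ENNReal.tsum_mul_right, hl]
    rw [ENNReal.tsum_mul_left, ENNReal.tsum_comm]
    simp only [ENNReal.tsum_mul_right, ENNReal.tsum_mul_left, hr]
    ring
  · rw [A fun m₁ m₂ n₁ n₂ => geomWeight c (m₁ - m₂) * geomWeight c (n₁ - n₂) *
      geomWeight c (m₁ - n₁) * e n₂]
    have : ∀ m₁ m₂ : ℤ, ∑' n₁, ∑' n₂, geomWeight c (m₁ - m₂) * geomWeight c (n₁ - n₂) *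
      geomWeight c (m₁ - n₁) * e n₂ = geomWeight c (m₁ - m₂) * ∑' n₁, ∑' n₂, geomWeight c (n₁ - n₂) *
      geomWeight c (m₁ - n₁) * e n₂ := fun m₁ m₂ => by
      simp only [← ENNReal.tsum_mul_left, mul_assoc]
    simp only [this]
    simp only [ENNReal.tsum_mul_right, hl]
    rw [ENNReal.tsum_mul_left, ENNReal.tsum_comm]
    have : ∀ n₁ : ℤ, ∑' m₁, ∑' n₂, geomWeight c (n₁ - n₂) * geomWeight c (m₁ - n₁) * e n₂ =
        ∑' n₂, K * geomWeight c (n₁ - n₂) * e n₂ := fun n₁ => by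
      rw [ENNReal.tsum_comm]
      refine tsum_congr fun n₂ => ?_
      rw [ENNReal.tsum_mul_right, ENNReal.tsum_mul_left, hr, mul_comm K]
    simp only [this]
    rw [ENNReal.tsum_comm]
    simp only [ENNReal.tsum_mul_right, ENNReal.tsum_mul_left, hr]
    ring

theorem mul_rpow_le_add {x y : ℝ≥0∞} (hx : x ≤ 1) (hy : y ≤ 1) {r : ℝ} (hr : 1 / 2 ≤ r) :
    (x * y) ^ r ≤ x + y := by
  have h1 : x * y ≤ 1 := mul_le_one' hx hy
  calc (x * y) ^ r ≤ (x * y) ^ (1 / 2 : ℝ) := ENNReal.rpow_le_rpow_of_exponent_ge h1 hr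
    _ ≤ ((x + y) ^ (2 : ℝ)) ^ (1 / 2 : ℝ) := by
        refine ENNReal.rpow_le_rpow ?_ (by norm_num)
        rw [ENNReal.rpow_two, sq]
        exact mul_le_mul' le_self_add le_add_self
    _ = x + y := by
        rw [← ENNReal.rpow_mul]
        norm_num

theorem two_rpow_mul_level_le {a : ℝ} (ha : 0 < a) (ha' : a ≤ 1 / 2) {e₁ e₂ e₄ : ℝ≥0∞}
    (h₁ : e₁ ≤ 1) (h₂ : e₂ ≤ 1) (h₄ : e₄ ≤ 1) (m₁ m₂ n₁ n₂ : ℝ) :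
    (2 : ℝ≥0∞) ^ (m₁ + m₂ + n₁ + n₂) * (((2 : ℝ≥0∞) ^ (-(m₁ * (2 * (1 - a)))) * e₁ *
      ((2 : ℝ≥0∞) ^ (-(m₂ * (2 * (1 - a)))) * e₂)) ^ ((1 + a) / (2 * (1 - a))) *
      ((2 : ℝ≥0∞) ^ (-(n₂ * (2 * (1 - a)))) * e₄)) ≤
    (2 : ℝ≥0∞) ^ (-a * (m₁ + m₂) + n₁ + (2 * a - 1) * n₂) * (e₁ + e₂) := by
  have hr0 : 0 ≤ (1 + a) / (2 * (1 - a)) := div_nonneg (by linarith) (by linarith)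
  have hr : 1 / 2 ≤ (1 + a) / (2 * (1 - a)) := by
    rw [div_le_div_iff₀ two_pos (by linarith)]
    linarith
  have h20 : (2 : ℝ≥0∞) ≠ 0 := two_ne_zero
  have h2t : (2 : ℝ≥0∞) ≠ ∞ := by norm_num
  rw [mul_mul_mul_comm, ENNReal.mul_rpow_of_nonneg _ _ hr0, ← ENNReal.rpow_add _ _ h20 h2t,
    ← ENNReal.rpow_mul]
  have e : (2 : ℝ≥0∞) ^ (m₁ + m₂ + n₁ + n₂) *
      (2 ^ ((-(m₁ * (2 * (1 - a))) + -(m₂ * (2 * (1 - a)))) * ((1 + a) / (2 * (1 - a)))) *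
      (e₁ * e₂) ^ ((1 + a) / (2 * (1 - a))) * (2 ^ (-(n₂ * (2 * (1 - a)))) * e₄)) =
      ((2 : ℝ≥0∞) ^ (m₁ + m₂ + n₁ + n₂) *
      2 ^ ((-(m₁ * (2 * (1 - a))) + -(m₂ * (2 * (1 - a)))) * ((1 + a) / (2 * (1 - a)))) *
      2 ^ (-(n₂ * (2 * (1 - a))))) * ((e₁ * e₂) ^ ((1 + a) / (2 * (1 - a))) * e₄) := by ring
  rw [e, ← ENNReal.rpow_add _ _ h20 h2t, ← ENNReal.rpow_add _ _ h20 h2t]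
  have e2 : m₁ + m₂ + n₁ + n₂ +
      (-(m₁ * (2 * (1 - a))) + -(m₂ * (2 * (1 - a)))) * ((1 + a) / (2 * (1 - a))) +
      -(n₂ * (2 * (1 - a))) = -a * (m₁ + m₂) + n₁ + (2 * a - 1) * n₂ := by
    have : 1 - a ≠ 0 := by linarith
    field_simp
    ring
  rw [e2]
  gcongr
  calc _ ≤ (e₁ + e₂) * 1 := mul_le_mul' (mul_rpow_le_add h₁ h₂ hr) h₄
    _ = _ := mul_one _

/-- Interpolation of restricted bounds for a quadrilinear form. -/
theorem exists_fourForm_le {a : ℝ} (ha : 0 < a) (ha' : a ≤ 1 / 2) :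
    ∃ C₀ : ℝ≥0∞, C₀ ≠ ∞ ∧ ∀ (X : Type) (_ : MeasurableSpace X) (μ : Measure X) (_ : SFinite μ)
      (Q : (X × X) × (X × X) → ℝ≥0∞) (_ : Measurable Q) (A B : Set X) (C : ℝ≥0∞)
      (_ : ∀ E₁ ⊆ A, MeasurableSet E₁ → ∀ E₂ ⊆ A, MeasurableSet E₂ → ∀ F₁ ⊆ B, MeasurableSet F₁ →
        ∀ F₂ ⊆ B, MeasurableSet F₂ →
        fourForm μ Q (E₁.indicator 1) (E₂.indicator 1) (F₁.indicator 1) (F₂.indicator 1) ≤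
          C * ((μ E₁ * μ E₂) ^ ((1 + a) / (2 * (1 - a))) * μ F₂) ∧
        fourForm μ Q (E₁.indicator 1) (E₂.indicator 1) (F₁.indicator 1) (F₂.indicator 1) ≤
          C * ((μ E₁ * μ E₂) ^ ((1 + a) / (2 * (1 - a))) * μ F₁) ∧
        fourForm μ Q (E₁.indicator 1) (E₂.indicator 1) (F₁.indicator 1) (F₂.indicator 1) ≤
          C * ((μ F₁ * μ F₂) ^ ((1 + a) / (2 * (1 - a))) * μ E₂) ∧
        fourForm μ Q (E₁.indicator 1) (E₂.indicator 1) (F₁.indicator 1) (F₂.indicator 1) ≤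
          C * ((μ F₁ * μ F₂) ^ ((1 + a) / (2 * (1 - a))) * μ E₁))
      (f g : X → NNReal), Measurable f → Measurable g → (∀ x ∉ A, f x = 0) →
      (∀ x ∉ B, g x = 0) → ∫⁻ x, (f x : ℝ≥0∞) ^ (2 * (1 - a)) ∂μ ≤ 1 →
      ∫⁻ x, (g x : ℝ≥0∞) ^ (2 * (1 - a)) ∂μ ≤ 1 →
      fourForm μ Q (fun x => f x) (fun x => f x) (fun x => g x) (fun x => g x) ≤ C₀ * C := by
  set K := ∑' j, geomWeight (a / 12) j with hK
  have hKt : K ≠ ∞ := tsum_geomWeight_ne_top (by positivity)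
  refine ⟨64 * K ^ 3, ENNReal.mul_ne_top (by norm_num) (ENNReal.pow_ne_top hKt), ?_⟩
  intro X _ μ _ Q hQ A B C H f g hf hg hfA hgB hf1 hg1
  set p := 2 * (1 - a) with hp
  set r := (1 + a) / p with hr
  have hp0 : 0 ≤ p := by rw [hp]; linarith
  have h20 : (2 : ℝ≥0∞) ≠ 0 := two_ne_zero
  have h2t : (2 : ℝ≥0∞) ≠ ∞ := by norm_num
  let e : (X → NNReal) → ℤ → ℝ≥0∞ := fun h m => (2 : ℝ≥0∞) ^ (m * p) * μ (dyadicLevel h m)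
  have he : ∀ h m, μ (dyadicLevel h m) = (2 : ℝ≥0∞) ^ (-(m * p)) * e h m := by
    intro h m
    simp only [e]
    rw [← mul_assoc, ← ENNReal.rpow_add _ _ h20 h2t, neg_add_cancel, ENNReal.rpow_zero, one_mul]
  have hsum : ∀ {h : X → NNReal}, Measurable h → ∫⁻ x, (h x : ℝ≥0∞) ^ p ∂μ ≤ 1 →
      ∑' m, e h m ≤ 1 := fun hh h1 => (tsum_dyadicLevel_le hh hp0).trans h1
  have he1 : ∀ {h : X → NNReal}, Measurable h → ∫⁻ x, (h x : ℝ≥0∞) ^ p ∂μ ≤ 1 →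
      ∀ m, e h m ≤ 1 := fun hh h1 m => (ENNReal.le_tsum m).trans (hsum hh h1)
  have hsub : ∀ {h : X → NNReal} {A : Set X}, (∀ x ∉ A, h x = 0) → ∀ m, dyadicLevel h m ⊆ A := by
    intro h A hA m x hx
    by_contra h'
    exact hx.1 (hA x h')
  let W : (ℤ × ℤ) × (ℤ × ℤ) → ℝ≥0∞ := fun M => geomWeight (a / 12) (M.1.1 - M.1.2) *
    geomWeight (a / 12) (M.2.1 - M.2.2) * geomWeight (a / 12) (M.1.1 - M.2.1)
  have hW : ∀ M, (2 : ℝ≥0∞) ^ (-(a / 12) * (|(M.1.1 : ℝ) - M.1.2| + |(M.2.1 : ℝ) - M.2.2| +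
      |(M.1.1 : ℝ) - M.2.1|)) = W M := by
    intro M
    simp only [W, geomWeight]
    rw [mul_add, mul_add, ENNReal.rpow_add _ _ h20 h2t, ENNReal.rpow_add _ _ h20 h2t]
    push_cast
    rfl
  have hterm : ∀ M : (ℤ × ℤ) × (ℤ × ℤ), 16 *
      (2 : ℝ≥0∞) ^ ((M.1.1 + M.1.2 + M.2.1 + M.2.2 : ℤ) : ℝ) *
        fourForm μ Q ((dyadicLevel f M.1.1).indicator 1) ((dyadicLevel f M.1.2).indicator 1)
        ((dyadicLevel g M.2.1).indicator 1) ((dyadicLevel g M.2.2).indicator 1) ≤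
      16 * C * (W M * e f M.1.1 + W M * e f M.1.2 + W M * e g M.2.1 + W M * e g M.2.2) := by
    rintro ⟨⟨m₁, m₂⟩, n₁, n₂⟩
    obtain ⟨H1, H2, H3, H4⟩ := H _ (hsub hfA m₁) (measurableSet_dyadicLevel hf m₁) _ (hsub hfA m₂)
      (measurableSet_dyadicLevel hf m₂) _ (hsub hgB n₁) (measurableSet_dyadicLevel hg n₁) _
      (hsub hgB n₂) (measurableSet_dyadicLevel hg n₂)
    simp only [he] at H1 H2 H3 H4
    simp only [← mul_add]
    have hW' := hW ((m₁, m₂), n₁, n₂)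
    simp only at hW' ⊢
    have fin : ∀ {T Y L : ℝ≥0∞} {s : ℝ}, T ≤ C * Y → (2 : ℝ≥0∞) ^ s * Y ≤ L →
        16 * (2 : ℝ≥0∞) ^ s * T ≤ 16 * C * L := by
      intro T Y L s h1 h2
      calc 16 * (2 : ℝ≥0∞) ^ s * T ≤ 16 * (2 : ℝ≥0∞) ^ s * (C * Y) := by gcongr
        _ = 16 * C * ((2 : ℝ≥0∞) ^ s * Y) := by ring
        _ ≤ _ := by gcongr
    have two_le : ∀ {x y : ℝ}, x ≤ y → (2 : ℝ≥0∞) ^ x ≤ (2 : ℝ≥0∞) ^ y := fun h =>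
      ENNReal.rpow_le_rpow_of_exponent_le (by norm_num) h
    rcases exists_min_exponent_le ha ha' (m₁ : ℝ) m₂ n₁ n₂ with (h | h) | (h | h)
    · refine fin H1 ?_
      have := two_rpow_mul_level_le ha ha' (he1 hf hf1 m₁) (he1 hf hf1 m₂) (he1 hg hg1 n₂)
        (m₁ : ℝ) m₂ n₁ n₂
      push_cast
      refine this.trans (mul_le_mul' ((two_le h).trans_eq hW') ?_)
      rw [add_assoc _ (e g n₁)]
      exact le_self_add
    · refine fin H2 ?_
      have := two_rpow_mul_level_le ha ha' (he1 hf hf1 m₁) (he1 hf hf1 m₂) (he1 hg hg1 n₁)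
        (m₁ : ℝ) m₂ n₂ n₁
      push_cast
      rw [add_right_comm ((m₁ : ℝ) + m₂)]
      refine this.trans (mul_le_mul' ((two_le h).trans_eq hW') ?_)
      rw [add_assoc _ (e g n₁)]
      exact le_self_add
    · refine fin H3 ?_
      have := two_rpow_mul_level_le ha ha' (he1 hg hg1 n₁) (he1 hg hg1 n₂) (he1 hf hf1 m₂)
        (n₁ : ℝ) n₂ m₁ m₂
      push_cast
      rw [show (m₁ : ℝ) + m₂ + n₁ + n₂ = n₁ + n₂ + m₁ + m₂ by ring]
      refine this.trans (mul_le_mul' ((two_le h).trans_eq hW') ?_)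
      rw [add_assoc _ (e g n₁)]
      exact le_add_self
    · refine fin H4 ?_
      have := two_rpow_mul_level_le ha ha' (he1 hg hg1 n₁) (he1 hg hg1 n₂) (he1 hf hf1 m₁)
        (n₁ : ℝ) n₂ m₂ m₁
      push_cast
      rw [show (m₁ : ℝ) + m₂ + n₁ + n₂ = n₁ + n₂ + m₂ + m₁ by ring]
      refine this.trans (mul_le_mul' ((two_le h).trans_eq hW') ?_)
      rw [add_assoc _ (e g n₁)]
      exact le_add_self
  refine (fourForm_le_tsum hQ hf hg).trans ((ENNReal.tsum_le_tsum hterm).trans ?_)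
  rw [ENNReal.tsum_mul_left, ENNReal.tsum_add, ENNReal.tsum_add, ENNReal.tsum_add,
    (tsum_geomWeight_mul (a / 12) (e f)).1, (tsum_geomWeight_mul (a / 12) (e f)).2.1,
    (tsum_geomWeight_mul (a / 12) (e g)).2.2.1, (tsum_geomWeight_mul (a / 12) (e g)).2.2.2, ← hK]
  have hf2 := hsum hf hf1
  have hg2 := hsum hg hg1
  calc _ ≤ 16 * C * (K ^ 3 * 1 + K ^ 3 * 1 + K ^ 3 * 1 + K ^ 3 * 1) := by gcongr
    _ = _ := by ring

section

/-- The kernel of the quadrilinear form obtained by expanding `|Ef · Eg|²` against a weight. -/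
def pairKernel {d k : ℕ} (Φ : (Fin d → ℝ) → Fin k → ℝ) (K : (Fin d → ℝ) → ℝ) (g : (Fin k → ℝ) → ℝ)
    (z : ((Fin d → ℝ) × (Fin d → ℝ)) × ((Fin d → ℝ) × (Fin d → ℝ))) : ℝ≥0∞ :=
  ENNReal.ofReal (K (z.1.1 + z.2.1 - z.1.2 - z.2.2)) *
    ENNReal.ofReal (g (Φ z.1.1 + Φ z.2.1 - Φ z.1.2 - Φ z.2.2))

theorem fourForm_swap {X : Type*} [MeasurableSpace X] {μ : Measure X} [SFinite μ]
    {Q : (X × X) × (X × X) → ℝ≥0∞} (hQ : ∀ z, Q z.swap = Q z) (f₁ f₂ g₁ g₂ : X → ℝ≥0∞) :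
    fourForm μ Q f₁ f₂ g₁ g₂ = fourForm μ Q g₁ g₂ f₁ f₂ := by
  rw [fourForm, ← lintegral_prod_swap, fourForm]
  refine lintegral_congr fun z => ?_
  rw [hQ]
  simp only [Prod.fst_swap, Prod.snd_swap]
  ring

theorem fourForm_swap_swap {X : Type*} [MeasurableSpace X] {μ : Measure X} [SFinite μ]
    {Q : (X × X) × (X × X) → ℝ≥0∞} (hQ : ∀ z, Q (z.1.swap, z.2.swap) = Q z)
    (f₁ f₂ g₁ g₂ : X → ℝ≥0∞) :
    fourForm μ Q f₁ f₂ g₁ g₂ = fourForm μ Q f₂ f₁ g₂ g₁ := by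
  have hmp : MeasurePreserving (MeasurableEquiv.prodCongr (MeasurableEquiv.prodComm (α := X)
      (β := X)) (MeasurableEquiv.prodComm (α := X) (β := X))) ((μ.prod μ).prod (μ.prod μ))
      ((μ.prod μ).prod (μ.prod μ)) :=
    (Measure.measurePreserving_swap).prod (Measure.measurePreserving_swap)
  rw [fourForm, fourForm, ← hmp.lintegral_comp_emb (MeasurableEquiv.measurableEmbedding _)]
  refine lintegral_congr fun z => ?_
  change f₁ z.1.2 * f₂ z.1.1 * (g₁ z.2.2 * g₂ z.2.1) * Q (z.1.swap, z.2.swap) = _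
  rw [hQ z]
  ring

theorem lintegral_shear {G : Type*} [MeasurableSpace G] [AddCommGroup G] [MeasurableAdd₂ G]
    [MeasurableSub₂ G] {μ : Measure G} [SFinite μ] [μ.IsAddRightInvariant]
    {H : (G × G) × (G × G) → ℝ≥0∞} (hH : Measurable H) :
    ∫⁻ z, H z ∂(μ.prod μ).prod (μ.prod μ) =
      ∫⁻ z, H (z.1, (z.2.1 + (z.1.2 + z.2.2 - z.1.1), z.2.2)) ∂(μ.prod μ).prod (μ.prod μ) := by
  have hH' : Measurable fun z : (G × G) × (G × G) =>
      H (z.1, (z.2.1 + (z.1.2 + z.2.2 - z.1.1), z.2.2)) := hH.comp (by fun_prop)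
  rw [lintegral_prod _ hH.aemeasurable, lintegral_prod _ hH'.aemeasurable]
  refine lintegral_congr fun ξ => ?_
  rw [lintegral_prod_symm _ (by fun_prop), lintegral_prod_symm _ (by fun_prop)]
  refine lintegral_congr fun η => ?_
  exact (lintegral_add_right_eq_self (μ := μ) (fun y => H (ξ, (y, η))) (ξ.2 + η - ξ.1)).symm

variable {d k : ℕ}

theorem measurable_pairKernel {Φ : (Fin d → ℝ) → Fin k → ℝ} (hΦ : Continuous Φ)
    {K : (Fin d → ℝ) → ℝ} (hK : Continuous K) {g : (Fin k → ℝ) → ℝ} (hg : Continuous g) :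
    Measurable (pairKernel Φ K g) := by
  unfold pairKernel
  refine Measurable.mul (ENNReal.continuous_ofReal.comp ?_).measurable
    (ENNReal.continuous_ofReal.comp ?_).measurable <;> fun_prop

theorem fourForm_pairKernel_indicator_le {Φ : (Fin d → ℝ) → Fin k → ℝ} (hΦ : Continuous Φ)
    {K : (Fin d → ℝ) → ℝ} (hK : Continuous K) (hK1 : ∫⁻ u, ENNReal.ofReal (K u) = 1)
    {g : (Fin k → ℝ) → ℝ} (hg : Continuous g) {B E₁ E₂ F₁ F₂ : Set (Fin d → ℝ)}
    (hB : MeasurableSet B) (hE₁ : MeasurableSet E₁) (hE₂ : MeasurableSet E₂)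
    (hF₁ : MeasurableSet F₁) (hF₂ : MeasurableSet F₂) (hFB : F₁ ⊆ B) {D : ℝ≥0∞}
    (hD : ∀ ζ c, ∫⁻ y in E₂, ∫⁻ x in E₁, B.indicator 1 (y - x + ζ) *
      ENNReal.ofReal (g (radonTheta Φ ζ x y - c)) ≤ D) :
    fourForm volume (pairKernel Φ K g) (E₁.indicator 1) (E₂.indicator 1) (F₁.indicator 1)
      (F₂.indicator 1) ≤ D * volume F₂ := by
  have hQ := measurable_pairKernel hΦ hK hg
  have m1 : ∀ {s : Set (Fin d → ℝ)}, MeasurableSet s →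
      Measurable (s.indicator (1 : (Fin d → ℝ) → ℝ≥0∞)) := fun h => measurable_one.indicator h
  have hE₁' := m1 hE₁
  have hE₂' := m1 hE₂
  have hF₂' := m1 hF₂
  have hB' := m1 hB
  have hF₁' := m1 hF₁
  have hrad : Continuous fun q : ((Fin d → ℝ) × (Fin d → ℝ)) × ((Fin d → ℝ) × (Fin d → ℝ)) =>
      radonTheta Φ (q.2.2 + q.2.1) q.1.1 q.1.2 - Φ q.2.2 := by
    unfold radonTheta; fun_prop
  have hH : Measurable fun z : ((Fin d → ℝ) × (Fin d → ℝ)) × ((Fin d → ℝ) × (Fin d → ℝ)) =>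
      E₁.indicator (1 : (Fin d → ℝ) → ℝ≥0∞) z.1.1 * E₂.indicator 1 z.1.2 *
        (F₁.indicator 1 z.2.1 * F₂.indicator 1 z.2.2) * pairKernel Φ K g z :=
    (((hE₁'.comp (measurable_fst.comp measurable_fst)).mul
      (hE₂'.comp (measurable_snd.comp measurable_fst))).mul
      ((hF₁'.comp (measurable_fst.comp measurable_snd)).mul
      (hF₂'.comp (measurable_snd.comp measurable_snd)))).mul hQ
  let R : ((Fin d → ℝ) × (Fin d → ℝ)) × ((Fin d → ℝ) × (Fin d → ℝ)) → ℝ≥0∞ := fun q =>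
    F₂.indicator 1 q.2.2 * ENNReal.ofReal (K q.2.1) * (E₂.indicator 1 q.1.2 *
      (E₁.indicator 1 q.1.1 * (B.indicator 1 (q.1.2 - q.1.1 + (q.2.2 + q.2.1)) *
        ENNReal.ofReal (g (radonTheta Φ (q.2.2 + q.2.1) q.1.1 q.1.2 - Φ q.2.2)))))
  have hR : Measurable R := by
    have h1 : Measurable fun q : ((Fin d → ℝ) × (Fin d → ℝ)) × ((Fin d → ℝ) × (Fin d → ℝ)) =>
      ENNReal.ofReal (g (radonTheta Φ (q.2.2 + q.2.1) q.1.1 q.1.2 - Φ q.2.2)) :=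
      (ENNReal.continuous_ofReal.comp (hg.comp hrad)).measurable
    have h2 : Measurable fun q : ((Fin d → ℝ) × (Fin d → ℝ)) × ((Fin d → ℝ) × (Fin d → ℝ)) =>
      ENNReal.ofReal (K q.2.1) := (ENNReal.continuous_ofReal.comp (by fun_prop)).measurable
    have h3 : Measurable fun q : ((Fin d → ℝ) × (Fin d → ℝ)) × ((Fin d → ℝ) × (Fin d → ℝ)) =>
      q.1.2 - q.1.1 + (q.2.2 + q.2.1) := Continuous.measurable (by fun_prop)
    exact ((hF₂'.comp (measurable_snd.comp measurable_snd)).mul h2).mul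
      ((hE₂'.comp (measurable_snd.comp measurable_fst)).mul
      ((hE₁'.comp (measurable_fst.comp measurable_fst)).mul ((hB'.comp h3).mul h1)))
  rw [fourForm, lintegral_shear hH]
  calc _ ≤ ∫⁻ q, R q ∂((volume : Measure (Fin d → ℝ)).prod volume).prod (volume.prod volume) := by
        refine lintegral_mono fun q => ?_
        simp only [R, pairKernel, radonTheta]
        have e1 : q.2.1 + (q.1.2 + q.2.2 - q.1.1) = q.1.2 - q.1.1 + (q.2.2 + q.2.1) := by abel
        have e2 : q.1.1 + (q.2.1 + (q.1.2 + q.2.2 - q.1.1)) - q.1.2 - q.2.2 = q.2.1 := by abel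
        have e3 : Φ q.1.1 - Φ q.1.2 + Φ (q.1.2 - q.1.1 + (q.2.2 + q.2.1)) - Φ q.2.2 =
          Φ q.1.1 + Φ (q.1.2 - q.1.1 + (q.2.2 + q.2.1)) - Φ q.1.2 - Φ q.2.2 := by abel
        rw [e2, e1, e3]
        have h4 := Set.indicator_le_indicator_of_subset hFB
          (f := (1 : (Fin d → ℝ) → ℝ≥0∞)) (fun _ => zero_le_one)
          (q.1.2 - q.1.1 + (q.2.2 + q.2.1))
        calc _ ≤ E₁.indicator (1 : (Fin d → ℝ) → ℝ≥0∞) q.1.1 * E₂.indicator 1 q.1.2 *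
            (B.indicator 1 (q.1.2 - q.1.1 + (q.2.2 + q.2.1)) * F₂.indicator 1 q.2.2) * _ := by
              gcongr
          _ = _ := by ring
    _ ≤ ∫⁻ η, ∫⁻ u, F₂.indicator 1 η * ENNReal.ofReal (K u) * D := by
        rw [lintegral_prod_symm _ hR.aemeasurable]
        have hR1 : Measurable fun y : (Fin d → ℝ) × (Fin d → ℝ) =>
          ∫⁻ x, R (x, y) ∂((volume : Measure (Fin d → ℝ)).prod volume) := hR.lintegral_prod_left'
        rw [lintegral_prod_symm _ hR1.aemeasurable]
        refine lintegral_mono fun η => lintegral_mono fun u => ?_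
        simp only
        have hR2 : Measurable fun x => R (x, (u, η)) := hR.comp (measurable_id.prodMk measurable_const)
        rw [lintegral_prod_symm _ hR2.aemeasurable]
        have hs : Measurable fun q : (Fin d → ℝ) × (Fin d → ℝ) =>
            (B.indicator (1 : (Fin d → ℝ) → ℝ≥0∞) (q.2 - q.1 + (η + u)) *
              ENNReal.ofReal (g (radonTheta Φ (η + u) q.1 q.2 - Φ η))) := by
          have h1 : Measurable fun q : ((Fin d → ℝ) × (Fin d → ℝ)) =>
            ENNReal.ofReal (g (radonTheta Φ (η + u) q.1 q.2 - Φ η)) :=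
            (ENNReal.continuous_ofReal.comp (by unfold radonTheta; fun_prop)).measurable
          have h2 : Measurable fun q : (Fin d → ℝ) × (Fin d → ℝ) => q.2 - q.1 + (η + u) :=
            Continuous.measurable (by fun_prop)
          exact (hB'.comp h2).mul h1
        have hs1 : ∀ y, Measurable fun x : Fin d → ℝ => E₁.indicator (1 : (Fin d → ℝ) → ℝ≥0∞) x *
            (B.indicator (1 : (Fin d → ℝ) → ℝ≥0∞) (y - x + (η + u)) *
              ENNReal.ofReal (g (radonTheta Φ (η + u) x y - Φ η))) := fun y =>
          hE₁'.mul (hs.comp (measurable_id.prodMk measurable_const))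
        have hs2 : Measurable fun y => ∫⁻ x, E₁.indicator (1 : (Fin d → ℝ) → ℝ≥0∞) x *
            (B.indicator (1 : (Fin d → ℝ) → ℝ≥0∞) (y - x + (η + u)) *
              ENNReal.ofReal (g (radonTheta Φ (η + u) x y - Φ η))) :=
          Measurable.lintegral_prod_left' (f := fun q : (Fin d → ℝ) × (Fin d → ℝ) =>
            E₁.indicator (1 : (Fin d → ℝ) → ℝ≥0∞) q.1 *
            (B.indicator (1 : (Fin d → ℝ) → ℝ≥0∞) (q.2 - q.1 + (η + u)) *
              ENNReal.ofReal (g (radonTheta Φ (η + u) q.1 q.2 - Φ η))))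
            ((hE₁'.comp measurable_fst).mul hs)
        have hind : ∀ {s : Set (Fin d → ℝ)} (hs : MeasurableSet s) (φ : (Fin d → ℝ) → ℝ≥0∞),
            ∫⁻ x, s.indicator 1 x * φ x = ∫⁻ x in s, φ x := by
          intro s hs φ
          rw [← lintegral_indicator hs]
          refine lintegral_congr fun x => ?_
          by_cases hx : x ∈ s <;> simp [hx]
        calc _ = F₂.indicator 1 η * ENNReal.ofReal (K u) * ∫⁻ y in E₂, ∫⁻ x in E₁,
            B.indicator 1 (y - x + (η + u)) *
              ENNReal.ofReal (g (radonTheta Φ (η + u) x y - Φ η)) := by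
              simp only [R]
              rw [← hind hE₂, ← lintegral_const_mul _ (by simp only [← hind hE₁]; exact hE₂'.mul hs2)]
              refine lintegral_congr fun y => ?_
              rw [← hind hE₁, lintegral_const_mul _ ((hs1 y).const_mul _),
                lintegral_const_mul _ (hs1 y)]
          _ ≤ _ := by gcongr; exact hD _ _
    _ = D * volume F₂ := by
        have hK' : Measurable fun u => ENNReal.ofReal (K u) :=
          (ENNReal.continuous_ofReal.comp hK).measurable
        simp only [mul_assoc]
        have : ∀ η, ∫⁻ u, F₂.indicator (1 : (Fin d → ℝ) → ℝ≥0∞) η * (ENNReal.ofReal (K u) * D) =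
            F₂.indicator 1 η * D := by
          intro η
          rw [lintegral_const_mul _ (hK'.mul_const _), lintegral_mul_const _ hK', hK1, one_mul]
        simp only [this]
        rw [lintegral_mul_const _ hF₂', lintegral_indicator_one hF₂, mul_comm]

end

section

theorem det_fromBlocks_smul_ne_zero {m n : Type*} [Fintype m] [Fintype n] [DecidableEq m]
    [DecidableEq n] {D : Matrix m n ℝ} {H : Matrix n n ℝ}
    (h : (Matrix.fromBlocks 0 D Dᵀ H).det ≠ 0) {a b : ℝ} (ha : a ≠ 0) (hb : b ≠ 0) :
    (Matrix.fromBlocks 0 (a • D) (a • D)ᵀ (b • H)).det ≠ 0 := by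
  intro h0
  obtain ⟨v, hv, hv0⟩ := Matrix.exists_mulVec_eq_zero_iff.2 h0
  refine h (Matrix.exists_mulVec_eq_zero_iff.1 ⟨Sum.elim ((a / b) • (v ∘ Sum.inl)) (v ∘ Sum.inr),
    ?_, ?_⟩)
  · intro h1
    refine hv (funext fun i => ?_)
    rcases i with i | i
    · have := congrFun h1 (Sum.inl i)
      simpa [ha, hb] using this
    · simpa using congrFun h1 (Sum.inr i)
  · rw [Matrix.fromBlocks_mulVec] at hv0 ⊢
    have e1 : D *ᵥ (v ∘ Sum.inr) = 0 := by
      funext i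
      have := congrFun hv0 (Sum.inl i)
      simpa [Matrix.smul_mulVec, ha] using this
    have e2 : a • (Dᵀ *ᵥ (v ∘ Sum.inl)) + b • (H *ᵥ (v ∘ Sum.inr)) = 0 := by
      funext i
      have := congrFun hv0 (Sum.inr i)
      simpa [Matrix.smul_mulVec, Matrix.transpose_smul] using this
    have e3 : Dᵀ *ᵥ ((a / b) • (v ∘ Sum.inl)) + H *ᵥ (v ∘ Sum.inr) = 0 := by
      rw [Matrix.mulVec_smul]
      have : b • ((a / b) • Dᵀ *ᵥ (v ∘ Sum.inl) + H *ᵥ (v ∘ Sum.inr)) = 0 := by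
        rw [smul_add, smul_smul, mul_div_cancel₀ _ hb]; exact e2
      exact (smul_eq_zero.1 this).resolve_left hb
    funext i
    rcases i with i | i
    · simpa using congrFun e1 i
    · simpa using congrFun e3 i

variable {d k : ℕ}

theorem det_Mmat_ne_zero {Φ : (Fin d → ℝ) → Fin k → ℝ} {ν₁ ν₂ ν : Fin d → ℝ}
    (h : ∀ t : Fin k → ℝ, (∑ i, t i ^ 2) = 1 → (Mmat d k Φ t ν₁ ν₂ ν).det ≠ 0)
    {t : Fin k → ℝ} (ht : t ≠ 0) :
    (Mmat d k Φ t ν₁ ν₂ ν).det ≠ 0 ∧ (Mmat d k Φ t ν₂ ν₁ ν).det ≠ 0 := by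
  have hs : 0 < ∑ i, t i ^ 2 := by
    refine lt_of_le_of_ne (Finset.sum_nonneg fun i _ => sq_nonneg _) fun h0 => ht (funext fun i => ?_)
    have := (Finset.sum_eq_zero_iff_of_nonneg fun i _ => sq_nonneg (t i)).1 h0.symm i
      (Finset.mem_univ i)
    simpa using this
  set r := Real.sqrt (∑ i, t i ^ 2) with hr
  have hr0 : 0 < r := Real.sqrt_pos.2 hs
  have h1 := h (r⁻¹ • t) (by
    simp only [Pi.smul_apply, smul_eq_mul, mul_pow, ← Finset.mul_sum]
    rw [inv_pow, hr, Real.sq_sqrt hs.le, inv_mul_cancel₀ hs.ne'])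
  have e1 : tHess d k Φ t ν = r • tHess d k Φ (r⁻¹ • t) ν := by
    simp only [tHess, Pi.smul_apply, smul_eq_mul, Finset.smul_sum, smul_smul]
    refine Finset.sum_congr rfl fun i _ => ?_
    rw [mul_inv_cancel_left₀ hr0.ne']
  have e2 : Dmat d k Φ ν₂ ν₁ = (-1 : ℝ) • Dmat d k Φ ν₁ ν₂ := by
    ext i j
    simp [Dmat]
  constructor
  · have := det_fromBlocks_smul_ne_zero h1 one_ne_zero hr0.ne'
    rwa [one_smul, ← e1] at this
  · have := det_fromBlocks_smul_ne_zero h1 (neg_ne_zero.2 one_ne_zero) hr0.ne'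
    rwa [← e2, ← e1] at this

theorem IsFourierPair.even {w g : (Fin k → ℝ) → ℝ} (h : IsFourierPair w g) (u : Fin k → ℝ) :
    g (-u) = g u := by
  have h1 := h.g_eq u
  have h2 := congrArg (starRingEnd ℂ) h1
  rw [Complex.conj_ofReal, ← integral_conj] at h2
  have h3 := h.g_eq (-u)
  refine Complex.ofReal_injective (h3.trans (Eq.trans ?_ h2.symm))
  refine integral_congr_ae (.of_forall fun t => ?_)
  simp only [map_mul, Complex.conj_ofReal, ← Complex.exp_conj, Complex.conj_I]
  congr 2
  push_cast [dotProduct_neg]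
  ring

theorem IsFourierPair.lintegral_eq_one {w g : (Fin k → ℝ) → ℝ} (h : IsFourierPair w g)
    (hw : w 0 = 1) : ∫⁻ u, ENNReal.ofReal (g u) = 1 := by
  rw [← ofReal_integral_eq_lintegral_ofReal h.integrable_g (.of_forall h.g_nonneg), ← h.w_zero, hw,
    ENNReal.ofReal_one]

theorem pairKernel_swap (Φ : (Fin d → ℝ) → Fin k → ℝ) (K : (Fin d → ℝ) → ℝ)
    (g : (Fin k → ℝ) → ℝ) (z : ((Fin d → ℝ) × (Fin d → ℝ)) × ((Fin d → ℝ) × (Fin d → ℝ))) :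
    pairKernel Φ K g z.swap = pairKernel Φ K g z := by
  simp only [pairKernel, Prod.fst_swap, Prod.snd_swap]
  rw [add_comm z.2.1, add_comm (Φ z.2.1), sub_right_comm, sub_right_comm (Φ z.1.1 + _)]

theorem pairKernel_swap_swap (Φ : (Fin d → ℝ) → Fin k → ℝ) {K : (Fin d → ℝ) → ℝ}
    {g : (Fin k → ℝ) → ℝ} (hK : ∀ u, K (-u) = K u) (hg : ∀ u, g (-u) = g u)
    (z : ((Fin d → ℝ) × (Fin d → ℝ)) × ((Fin d → ℝ) × (Fin d → ℝ))) :
    pairKernel Φ K g (z.1.swap, z.2.swap) = pairKernel Φ K g z := by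
  simp only [pairKernel, Prod.fst_swap, Prod.snd_swap]
  rw [← hK, ← hg]
  congr 3 <;> abel_nf

/-- Dividing by norms in a normalised bound for the quadrilinear form. -/
theorem fourForm_le_of_normalized {X : Type*} [MeasurableSpace X] {μ : Measure X} [SFinite μ]
    {Q : (X × X) × (X × X) → ℝ≥0∞} {p : ℝ} (hp : 0 < p) {A B : Set X} {C : ℝ≥0∞}
    (H : ∀ f g : X → NNReal, Measurable f → Measurable g → (∀ x ∉ A, f x = 0) →
      (∀ x ∉ B, g x = 0) → ∫⁻ x, (f x : ℝ≥0∞) ^ p ∂μ ≤ 1 → ∫⁻ x, (g x : ℝ≥0∞) ^ p ∂μ ≤ 1 →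
      fourForm μ Q (fun x => f x) (fun x => f x) (fun x => g x) (fun x => g x) ≤ C)
    {f g : X → NNReal} (hf : Measurable f) (hg : Measurable g) (hfA : ∀ x ∉ A, f x = 0)
    (hgB : ∀ x ∉ B, g x = 0) (hf' : ∫⁻ x, (f x : ℝ≥0∞) ^ p ∂μ ≠ ∞)
    (hg' : ∫⁻ x, (g x : ℝ≥0∞) ^ p ∂μ ≠ ∞) :
    fourForm μ Q (fun x => f x) (fun x => f x) (fun x => g x) (fun x => g x) ≤
      C * (∫⁻ x, (f x : ℝ≥0∞) ^ p ∂μ) ^ (2 / p) * (∫⁻ x, (g x : ℝ≥0∞) ^ p ∂μ) ^ (2 / p) := by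
  have key : ∀ {h : X → NNReal}, Measurable h → ∫⁻ x, (h x : ℝ≥0∞) ^ p ∂μ = 0 →
      ∀ᵐ x ∂μ, h x = 0 := by
    intro h hh h0
    rw [lintegral_eq_zero_iff (by fun_prop)] at h0
    filter_upwards [h0] with x hx
    simpa [hp.le, not_lt.2 hp.le, hp] using hx
  by_cases hf0 : ∫⁻ x, (f x : ℝ≥0∞) ^ p ∂μ = 0
  · have h1 := key hf hf0
    have h2 : ∀ᵐ z ∂(μ.prod μ).prod (μ.prod μ), f z.1.1 = 0 :=
      Measure.quasiMeasurePreserving_fst.ae (Measure.quasiMeasurePreserving_fst.ae h1)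
    rw [fourForm, lintegral_congr_ae (g := fun _ => 0) (by filter_upwards [h2] with z hz; simp [hz])]
    simp
  by_cases hg0 : ∫⁻ x, (g x : ℝ≥0∞) ^ p ∂μ = 0
  · have h1 := key hg hg0
    have h2 : ∀ᵐ z ∂(μ.prod μ).prod (μ.prod μ), g z.2.1 = 0 :=
      Measure.quasiMeasurePreserving_snd.ae (Measure.quasiMeasurePreserving_fst.ae h1)
    rw [fourForm, lintegral_congr_ae (g := fun _ => 0) (by filter_upwards [h2] with z hz; simp [hz])]
    simp
  have hnorm : ∀ {h : X → NNReal}, Measurable h → ∫⁻ x, (h x : ℝ≥0∞) ^ p ∂μ ≠ 0 →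
      ∫⁻ x, (h x : ℝ≥0∞) ^ p ∂μ ≠ ∞ → ∃ c : NNReal, c ≠ 0 ∧
        (c : ℝ≥0∞) ^ 2 = (∫⁻ x, (h x : ℝ≥0∞) ^ p ∂μ) ^ (2 / p) ∧
        ∫⁻ x, ((c⁻¹ * h x : NNReal) : ℝ≥0∞) ^ p ∂μ ≤ 1 := by
    intro h hh h0 hi
    set I := ∫⁻ x, (h x : ℝ≥0∞) ^ p ∂μ
    have hI1 : I ^ (1 / p) ≠ ∞ := ENNReal.rpow_ne_top_of_nonneg (by positivity) hi
    have hI0 : I ^ (1 / p) ≠ 0 := (ENNReal.rpow_pos (pos_iff_ne_zero.2 h0) hi).ne'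
    have hc0 : (I ^ (1 / p)).toNNReal ≠ 0 := (ENNReal.toNNReal_pos hI0 hI1).ne'
    refine ⟨(I ^ (1 / p)).toNNReal, hc0, ?_, ?_⟩
    · rw [ENNReal.coe_toNNReal hI1, ← ENNReal.rpow_natCast, ← ENNReal.rpow_mul]
      congr 1
      push_cast; ring
    · simp only [ENNReal.coe_mul, ENNReal.mul_rpow_of_nonneg _ _ hp.le]
      rw [lintegral_const_mul _ (by fun_prop), ENNReal.coe_inv hc0, ENNReal.coe_toNNReal hI1,
        ENNReal.inv_rpow, ← ENNReal.rpow_mul, one_div_mul_cancel hp.ne', ENNReal.rpow_one]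
      exact ENNReal.inv_mul_le_one I
  obtain ⟨c, hc, hc2, hc1⟩ := hnorm hf hf0 hf'
  obtain ⟨e, he, he2, he1⟩ := hnorm hg hg0 hg'
  have h1 := H (fun x => c⁻¹ * f x) (fun x => e⁻¹ * g x) (by fun_prop) (by fun_prop)
    (fun x hx => by simp [hfA x hx]) (fun x hx => by simp [hgB x hx]) hc1 he1
  rw [← hc2, ← he2]
  have h2 : fourForm μ Q (fun x => f x) (fun x => f x) (fun x => g x) (fun x => g x) =
      (c : ℝ≥0∞) ^ 2 * (e : ℝ≥0∞) ^ 2 * fourForm μ Q (fun x => (c⁻¹ * f x : NNReal))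
        (fun x => (c⁻¹ * f x : NNReal)) (fun x => (e⁻¹ * g x : NNReal))
        (fun x => (e⁻¹ * g x : NNReal)) := by
    rw [fourForm, fourForm, ← lintegral_const_mul' _ _ (by finiteness)]
    refine lintegral_congr fun z => ?_
    have hcf : ∀ x, (f x : ℝ≥0∞) = c * (c⁻¹ * f x : NNReal) := fun x => by
      rw [← ENNReal.coe_mul, mul_inv_cancel_left₀ hc]
    have heg : ∀ x, (g x : ℝ≥0∞) = e * (e⁻¹ * g x : NNReal) := fun x => by
      rw [← ENNReal.coe_mul, mul_inv_cancel_left₀ he]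
    rw [hcf z.1.1, hcf z.1.2, heg z.2.1, heg z.2.2]
    ring
  rw [h2]
  calc _ ≤ (c : ℝ≥0∞) ^ 2 * (e : ℝ≥0∞) ^ 2 * C := by gcongr
    _ = _ := by ring

end

section

theorem endpoint_exponent_identities {x y : ℝ} (hy : 0 ≤ y) (h : y < x) :
    4 * (x + y) / (3 * x + y) = 2 * (1 - (x - y) / (3 * x + y)) ∧
    x / (x + y) = (1 + (x - y) / (3 * x + y)) /
      (2 * (1 - (x - y) / (3 * x + y))) := by
  have h1 : 3 * x + y ≠ 0 := by linarith
  have h2 : x + y ≠ 0 := by linarith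
  have e1 : 1 - (x - y) / (3 * x + y) = 2 * (x + y) / (3 * x + y) := by
    rw [eq_div_iff h1, sub_mul, div_mul_cancel₀ _ h1]; ring
  have e2 : 1 + (x - y) / (3 * x + y) = 4 * x / (3 * x + y) := by
    rw [eq_div_iff h1, add_mul, div_mul_cancel₀ _ h1]; ring
  rw [e1, e2]
  constructor
  · ring
  · rw [← mul_div_assoc, div_div_div_cancel_right₀ h1]
    rw [show 2 * (2 * (x + y)) = 4 * (x + y) by ring, mul_div_mul_left _ _ four_ne_zero]

variable {d k : ℕ}

theorem exists_fourForm_pairKernel_le_of_lt (hdk : k < d) {Φ : (Fin d → ℝ) → Fin k → ℝ}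
    (hΦ : ContDiff ℝ (⊤ : ℕ∞) Φ) (ν₁ ν₂ : Fin d → ℝ)
    (hM : ∀ t : Fin k → ℝ, (∑ i, t i ^ 2) = 1 →
      ∀ ν, (ν = ν₁ ∨ ν = ν₂) → (Mmat d k Φ t ν₁ ν₂ ν).det ≠ 0) :
    ∃ δ : ℝ, 0 < δ ∧ ∃ C : ℝ≥0∞, C ≠ ∞ ∧ ∀ (v K : (Fin d → ℝ) → ℝ) (w g : (Fin k → ℝ) → ℝ),
      IsFourierPair v K → v 0 = 1 → IsFourierPair w g → w 0 = 1 →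
      ∀ f h : (Fin d → ℝ) → NNReal, Measurable f → Measurable h →
      (∀ x ∉ Metric.closedBall ν₁ δ, f x = 0) → (∀ x ∉ Metric.closedBall ν₂ δ, h x = 0) →
      ∫⁻ x, (f x : ℝ≥0∞) ^ (4 * ((d : ℝ) + k) / (3 * d + k)) ≠ ∞ →
      ∫⁻ x, (h x : ℝ≥0∞) ^ (4 * ((d : ℝ) + k) / (3 * d + k)) ≠ ∞ →
      fourForm volume (pairKernel Φ K g) (fun x => f x) (fun x => f x) (fun x => h x)
        (fun x => h x) ≤
      C * (∫⁻ x, (f x : ℝ≥0∞) ^ (4 * ((d : ℝ) + k) / (3 * d + k))) ^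
          (2 / (4 * ((d : ℝ) + k) / (3 * d + k))) *
        (∫⁻ x, (h x : ℝ≥0∞) ^ (4 * ((d : ℝ) + k) / (3 * d + k))) ^
          (2 / (4 * ((d : ℝ) + k) / (3 * d + k))) := by
  obtain ⟨δ₁, hδ₁, C₁, hC₁, H₁⟩ := exists_average_bound hdk hΦ ν₁ ν₂
    fun t ht => (det_Mmat_ne_zero (fun t ht => hM t ht ν₂ (Or.inr rfl)) ht).1
  obtain ⟨δ₂, hδ₂, C₂, hC₂, H₂⟩ := exists_average_bound hdk hΦ ν₂ ν₁
    fun t ht => (det_Mmat_ne_zero (fun t ht => hM t ht ν₁ (Or.inl rfl)) ht).2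
  have hdk' : (k : ℝ) < d := by exact_mod_cast hdk
  have hk0 : (0 : ℝ) ≤ k := k.cast_nonneg
  have hden : (0 : ℝ) < 3 * d + k := by linarith
  set a : ℝ := ((d : ℝ) - k) / (3 * d + k) with ha
  have ha0 : 0 < a := div_pos (by linarith) hden
  have ha1 : a ≤ 1 / 2 := by rw [ha, div_le_div_iff₀ hden two_pos]; linarith
  obtain ⟨hp, hr⟩ := endpoint_exponent_identities hk0 hdk'
  rw [← ha] at hp hr
  rw [hp]
  rw [hr] at H₁ H₂
  obtain ⟨C₀, hC₀, H₀⟩ := exists_fourForm_le ha0 ha1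
  refine ⟨min δ₁ δ₂, lt_min hδ₁ hδ₂, C₀ * (ENNReal.ofReal C₁ + ENNReal.ofReal C₂),
    by finiteness, ?_⟩
  intro v K w g hvK hv hwg hw f h hf hh hfA hhB hf' hh'
  refine fourForm_le_of_normalized (A := Metric.closedBall ν₁ (min δ₁ δ₂))
    (B := Metric.closedBall ν₂ (min δ₁ δ₂)) (by linarith) ?_ hf hh hfA hhB hf' hh'
  refine H₀ _ _ _ inferInstance _
    (measurable_pairKernel hΦ.continuous hvK.continuous_g hwg.continuous_g) _ _ _ ?_
  intro E₁ hE₁ mE₁ E₂ hE₂ mE₂ F₁ hF₁ mF₁ F₂ hF₂ mF₂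
  have hsub : ∀ {ν : Fin d → ℝ} {E}, E ⊆ Metric.closedBall ν (min δ₁ δ₂) →
      E ⊆ Metric.closedBall ν δ₁ ∧ E ⊆ Metric.closedBall ν δ₂ := fun h =>
    ⟨h.trans (Metric.closedBall_subset_closedBall (min_le_left _ _)),
      h.trans (Metric.closedBall_subset_closedBall (min_le_right _ _))⟩
  have b1 : ∀ E ⊆ Metric.closedBall ν₁ (min δ₁ δ₂), MeasurableSet E →
      ∀ E' ⊆ Metric.closedBall ν₁ (min δ₁ δ₂), MeasurableSet E' →
      ∀ F ⊆ Metric.closedBall ν₂ (min δ₁ δ₂), MeasurableSet F →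
      ∀ F' ⊆ Metric.closedBall ν₂ (min δ₁ δ₂), MeasurableSet F' →
      fourForm volume (pairKernel Φ K g) (E.indicator 1) (E'.indicator 1) (F.indicator 1)
        (F'.indicator 1) ≤ (ENNReal.ofReal C₁ + ENNReal.ofReal C₂) *
          ((volume E * volume E') ^ ((1 + a) / (2 * (1 - a))) * volume F') := by
    intro E hE mE E' hE' mE' F hF mF F' hF' mF'
    rw [← mul_assoc]
    refine (fourForm_pairKernel_indicator_le hΦ.continuous hvK.continuous_g
      (hvK.lintegral_eq_one hv) hwg.continuous_g Metric.isClosed_closedBall.measurableSet mE mE' mF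
      mF' (hsub hF).1 fun ζ c => H₁ w g hwg hw ζ c E (hsub hE).1 mE E' (hsub hE').1 mE').trans ?_
    gcongr
    exact le_self_add
  have b2 : ∀ F ⊆ Metric.closedBall ν₂ (min δ₁ δ₂), MeasurableSet F →
      ∀ F' ⊆ Metric.closedBall ν₂ (min δ₁ δ₂), MeasurableSet F' →
      ∀ E ⊆ Metric.closedBall ν₁ (min δ₁ δ₂), MeasurableSet E →
      ∀ E' ⊆ Metric.closedBall ν₁ (min δ₁ δ₂), MeasurableSet E' →
      fourForm volume (pairKernel Φ K g) (F.indicator 1) (F'.indicator 1) (E.indicator 1)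
        (E'.indicator 1) ≤ (ENNReal.ofReal C₁ + ENNReal.ofReal C₂) *
          ((volume F * volume F') ^ ((1 + a) / (2 * (1 - a))) * volume E') := by
    intro E hE mE E' hE' mE' F hF mF F' hF' mF'
    rw [← mul_assoc]
    refine (fourForm_pairKernel_indicator_le hΦ.continuous hvK.continuous_g
      (hvK.lintegral_eq_one hv) hwg.continuous_g Metric.isClosed_closedBall.measurableSet mE mE' mF
      mF' (hsub hF).2 fun ζ c => H₂ w g hwg hw ζ c E (hsub hE).2 mE E' (hsub hE').2 mE').trans ?_
    gcongr
    exact le_add_self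
  have s1 := fun f₁ f₂ g₁ g₂ => fourForm_swap (μ := (volume : Measure (Fin d → ℝ)))
    (pairKernel_swap Φ K g) f₁ f₂ g₁ g₂
  have s2 := fun f₁ f₂ g₁ g₂ => fourForm_swap_swap (μ := (volume : Measure (Fin d → ℝ)))
    (pairKernel_swap_swap Φ hvK.even hwg.even) f₁ f₂ g₁ g₂
  refine ⟨b1 _ hE₁ mE₁ _ hE₂ mE₂ _ hF₁ mF₁ _ hF₂ mF₂, ?_, ?_, ?_⟩
  · rw [s2, mul_comm (volume E₁)]
    exact b1 _ hE₂ mE₂ _ hE₁ mE₁ _ hF₂ mF₂ _ hF₁ mF₁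
  · rw [s1]
    exact b2 _ hF₁ mF₁ _ hF₂ mF₂ _ hE₁ mE₁ _ hE₂ mE₂
  · rw [s1, s2, mul_comm (volume F₁)]
    exact b2 _ hF₂ mF₂ _ hF₁ mF₁ _ hE₂ mE₂ _ hE₁ mE₁

end

section

/-- A map is locally injective with bounded inverse Jacobian near a point where its derivative is
injective. -/
theorem exists_lintegral_comp_le {E : Type*} [NormedAddCommGroup E] [NormedSpace ℝ E]
    [FiniteDimensional ℝ E] [MeasurableSpace E] [BorelSpace E] (μ : Measure E) [μ.IsAddHaarMeasure]
    {Ψ : E → E} (hΨ : ContDiff ℝ (⊤ : ℕ∞) Ψ) {y₀ : E}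
    (hinj : ∀ e, fderiv ℝ Ψ y₀ e = 0 → e = 0) :
    ∃ δ : ℝ, 0 < δ ∧ ∃ C : ℝ≥0∞, C ≠ ∞ ∧ ∀ F : E → ℝ≥0∞,
      ∫⁻ y in Metric.closedBall y₀ δ, F (Ψ y) ∂μ ≤ C * ∫⁻ y, F y ∂μ := by
  have hinj' : Function.Injective (fderiv ℝ Ψ y₀ : E →ₗ[ℝ] E) :=
    (injective_iff_map_eq_zero _).2 hinj
  let e : E ≃L[ℝ] E := (LinearEquiv.ofInjectiveEndo _ hinj').toContinuousLinearEquiv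
  have he : (e : E →L[ℝ] E) = fderiv ℝ Ψ y₀ := by ext x; rfl
  have hst : HasStrictFDerivAt Ψ (e : E →L[ℝ] E) y₀ := by
    rw [he]
    exact hΨ.contDiffAt.hasStrictFDerivAt (by simp)
  have hdet : (fderiv ℝ Ψ y₀).det ≠ 0 := by
    rw [← he]
    exact (LinearEquiv.isUnit_det' e.toLinearEquiv).ne_zero
  have hcont : Continuous fun y => |(fderiv ℝ Ψ y).det| :=
    (ContinuousLinearMap.continuous_det.comp (hΨ.continuous_fderiv (by simp))).abs
  set c := |(fderiv ℝ Ψ y₀).det| / 2 with hc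
  have hc0 : 0 < c := by have := abs_pos.2 hdet; positivity
  have h1 : ∀ᶠ y in nhds y₀, c ≤ |(fderiv ℝ Ψ y).det| :=
    (hcont.continuousAt.eventually (lt_mem_nhds (show c < |(fderiv ℝ Ψ y₀).det| by
      rw [hc]; linarith [abs_pos.2 hdet]))).mono fun y hy => hy.le
  have h2 : ∀ᶠ y in nhds y₀, y ∈ (hst.toOpenPartialHomeomorph Ψ).source :=
    (hst.toOpenPartialHomeomorph Ψ).open_source.mem_nhds
      hst.mem_toOpenPartialHomeomorph_source
  obtain ⟨δ, hδ, hball⟩ := Metric.nhds_basis_closedBall.eventually_iff.1 (h1.and h2)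
  refine ⟨δ, hδ, (ENNReal.ofReal c)⁻¹, ENNReal.inv_ne_top.2 (by simpa using hc0), fun F => ?_⟩
  have hinjOn : Set.InjOn Ψ (Metric.closedBall y₀ δ) := by
    have := (hst.toOpenPartialHomeomorph Ψ).injOn
    rw [hst.toOpenPartialHomeomorph_coe] at this
    exact this.mono fun y hy => (hball hy).2
  have hcv := lintegral_image_eq_lintegral_abs_det_fderiv_mul μ
    Metric.isClosed_closedBall.measurableSet
    (fun y _ => ((hΨ.differentiable (by simp) y).hasFDerivAt.hasFDerivWithinAt)) hinjOn F
  rw [← ENNReal.mul_le_iff_le_inv (by simpa using hc0) ENNReal.ofReal_ne_top,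
    ← lintegral_const_mul' _ _ ENNReal.ofReal_ne_top]
  calc _ ≤ ∫⁻ y in Metric.closedBall y₀ δ, ENNReal.ofReal |(fderiv ℝ Ψ y).det| * F (Ψ y) ∂μ := by
        refine setLIntegral_mono' Metric.isClosed_closedBall.measurableSet fun y hy => ?_
        gcongr
        exact (hball hy).1
    _ = ∫⁻ y in Ψ '' Metric.closedBall y₀ δ, F y ∂μ := hcv.symm
    _ ≤ _ := setLIntegral_le_lintegral _ _

variable {d : ℕ}

theorem fderiv_pairSum_injective {Φ : (Fin d → ℝ) → Fin d → ℝ} (hΦ : ContDiff ℝ (⊤ : ℕ∞) Φ)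
    {ν₁ ν₂ : Fin d → ℝ} {t : Fin d → ℝ} {ν : Fin d → ℝ} (hM : (Mmat d d Φ t ν₁ ν₂ ν).det ≠ 0)
    (e : (Fin d → ℝ) × (Fin d → ℝ))
    (he : fderiv ℝ (fun y : (Fin d → ℝ) × (Fin d → ℝ) => (y.1 + y.2, Φ y.1 + Φ y.2)) (ν₁, ν₂) e = 0) :
    e = 0 := by
  have hd : ∀ ν, HasFDerivAt Φ (fderiv ℝ Φ ν) ν := fun ν =>
    (hΦ.differentiable (by simp) ν).hasFDerivAt
  have h1 : HasFDerivAt (fun y : (Fin d → ℝ) × (Fin d → ℝ) => (y.1 + y.2, Φ y.1 + Φ y.2))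
      (ContinuousLinearMap.prod (ContinuousLinearMap.fst ℝ _ _ + ContinuousLinearMap.snd ℝ _ _)
        ((fderiv ℝ Φ ν₁).comp (ContinuousLinearMap.fst ℝ _ _) +
          (fderiv ℝ Φ ν₂).comp (ContinuousLinearMap.snd ℝ _ _))) (ν₁, ν₂) :=
    (hasFDerivAt_fst.add hasFDerivAt_snd).prodMk
      (((hd ν₁).comp (ν₁, ν₂) hasFDerivAt_fst).add ((hd ν₂).comp (ν₁, ν₂) hasFDerivAt_snd))
  rw [h1.fderiv] at he
  have e1 : e.1 + e.2 = 0 := congrArg Prod.fst he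
  have e2 : fderiv ℝ Φ ν₁ e.1 + fderiv ℝ Φ ν₂ e.2 = 0 := congrArg Prod.snd he
  have e3 : e.1 = -e.2 := eq_neg_of_add_eq_zero_left e1
  have hD0 : Dmat d d Φ ν₁ ν₂ *ᵥ e.2 = 0 := by
    funext j
    have hj := congrFun e2 j
    have hc : ∀ ν a, fderiv ℝ Φ ν a j = gradPhi d (fun x => Φ x j) ν ⬝ᵥ a := fun ν a => by
      rw [← fderiv_eq_gradPhi, fderiv_pi (fun i => (hasFDerivAt_pi'.1 (hd ν) i).differentiableAt)]
      rfl
    rw [Pi.add_apply, hc, hc, e3, dotProduct_neg] at hj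
    change (gradPhi d (fun x => Φ x j) ν₂ - gradPhi d (fun x => Φ x j) ν₁) ⬝ᵥ e.2 = 0
    rw [sub_dotProduct]
    simp only [Pi.zero_apply] at hj
    linarith
  have h2 : e.2 = 0 := by
    by_contra h0
    have hdet : (Dmat d d Φ ν₁ ν₂).det = 0 := Matrix.exists_mulVec_eq_zero_iff.1 ⟨_, h0, hD0⟩
    rw [← Matrix.det_transpose] at hdet
    obtain ⟨x, hx, hx0⟩ := Matrix.exists_mulVec_eq_zero_iff.2 hdet
    refine hM (Matrix.exists_mulVec_eq_zero_iff.1 ⟨Sum.elim x 0, fun h => hx ?_, ?_⟩)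
    · funext i
      exact congrFun h (Sum.inl i)
    · rw [Mmat, Matrix.fromBlocks_mulVec]
      funext i
      rcases i with i | i
      · simp
      · simpa using congrFun hx0 i
  exact Prod.ext (by rw [e3, h2, neg_zero]; rfl) h2

theorem exists_fourForm_pairKernel_le_of_eq (hd : 1 ≤ d) {Φ : (Fin d → ℝ) → Fin d → ℝ}
    (hΦ : ContDiff ℝ (⊤ : ℕ∞) Φ) (ν₁ ν₂ : Fin d → ℝ)
    (hM : ∀ t : Fin d → ℝ, (∑ i, t i ^ 2) = 1 →
      ∀ ν, (ν = ν₁ ∨ ν = ν₂) → (Mmat d d Φ t ν₁ ν₂ ν).det ≠ 0) :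
    ∃ δ : ℝ, 0 < δ ∧ ∃ C : ℝ≥0∞, C ≠ ∞ ∧ ∀ (v K : (Fin d → ℝ) → ℝ) (w g : (Fin d → ℝ) → ℝ),
      IsFourierPair v K → v 0 = 1 → IsFourierPair w g → w 0 = 1 →
      ∀ f h : (Fin d → ℝ) → NNReal, Measurable f → Measurable h →
      (∀ x ∉ Metric.closedBall ν₁ δ, f x = 0) → (∀ x ∉ Metric.closedBall ν₂ δ, h x = 0) →
      fourForm volume (pairKernel Φ K g) (fun x => f x) (fun x => f x) (fun x => h x)
        (fun x => h x) ≤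
      C * (∫⁻ x, (f x : ℝ≥0∞) ^ 2) * (∫⁻ x, (h x : ℝ≥0∞) ^ 2) := by
  have : (volume : Measure ((Fin d → ℝ) × (Fin d → ℝ))).IsAddHaarMeasure :=
    Measure.prod.instIsAddHaarMeasure volume volume
  have hM' := hM (Pi.single ⟨0, hd⟩ 1) (by simp [Pi.single_apply]) ν₁ (Or.inl rfl)
  obtain ⟨δ, hδ, C, hC, H⟩ := exists_lintegral_comp_le
    (volume : Measure ((Fin d → ℝ) × (Fin d → ℝ)))
    (Ψ := fun y => (y.1 + y.2, Φ y.1 + Φ y.2)) (y₀ := (ν₁, ν₂))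
    ((contDiff_fst.add contDiff_snd).prodMk
      ((hΦ.comp contDiff_fst).add (hΦ.comp contDiff_snd)))
    (fderiv_pairSum_injective hΦ hM')
  refine ⟨δ, hδ, 2 * C, by finiteness, ?_⟩
  intro v K w g hvK hv hwg hw f h hf hh hfA hhB
  let A : Set (Fin d → ℝ) := Metric.closedBall ν₁ δ
  let B : Set (Fin d → ℝ) := Metric.closedBall ν₂ δ
  have mA : MeasurableSet A := Metric.isClosed_closedBall.measurableSet
  have mB : MeasurableSet B := Metric.isClosed_closedBall.measurableSet
  have mA' : Measurable (A.indicator (1 : (Fin d → ℝ) → ℝ≥0∞)) := measurable_one.indicator mA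
  have mB' : Measurable (B.indicator (1 : (Fin d → ℝ) → ℝ≥0∞)) := measurable_one.indicator mB
  have hQ := measurable_pairKernel hΦ.continuous hvK.continuous_g hwg.continuous_g
  have hone : ∀ {w g : (Fin d → ℝ) → ℝ}, IsFourierPair w g → w 0 = 1 → ∀ a,
      ∫⁻ u, ENNReal.ofReal (g (a - u)) = 1 := by
    intro w g hwg hw a
    rw [lintegral_sub_left_eq_self (fun u => ENNReal.ofReal (g u)) a]
    exact hwg.lintegral_eq_one hw
  have inner : ∀ ξ η : Fin d → ℝ, ∫⁻ y : (Fin d → ℝ) × (Fin d → ℝ), A.indicator 1 y.1 *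
      B.indicator 1 y.2 * pairKernel Φ K g ((ξ, y.1), (η, y.2)) ≤ C := by
    intro ξ η
    have h1 := H fun q => ENNReal.ofReal (K (ξ + η - q.1)) *
      ENNReal.ofReal (g (Φ ξ + Φ η - q.2))
    have h2 : ∫⁻ q : (Fin d → ℝ) × (Fin d → ℝ), ENNReal.ofReal (K (ξ + η - q.1)) *
      ENNReal.ofReal (g (Φ ξ + Φ η - q.2)) = 1 := by
      have m1 : Measurable fun q : Fin d → ℝ => ENNReal.ofReal (K (ξ + η - q)) :=
        (ENNReal.continuous_ofReal.comp (hvK.continuous_g.comp (by fun_prop))).measurable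
      have m2 : Measurable fun q : Fin d → ℝ => ENNReal.ofReal (g (Φ ξ + Φ η - q)) :=
        (ENNReal.continuous_ofReal.comp (hwg.continuous_g.comp (by fun_prop))).measurable
      refine (lintegral_prod_mul m1.aemeasurable m2.aemeasurable).trans ?_
      rw [hone hvK hv, hone hwg hw, one_mul]
    rw [h2, mul_one] at h1
    refine le_trans (le_of_eq ?_) h1
    rw [← closedBall_prod_same, ← lintegral_indicator (mA.prod mB)]
    refine lintegral_congr fun y => ?_
    by_cases hy1 : y.1 ∈ A <;> by_cases hy2 : y.2 ∈ B <;>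
      simp [hy1, hy2, pairKernel, Set.indicator, A, B, sub_sub] at *
  let T : ℝ≥0∞ := fourForm volume (pairKernel Φ K g) (fun x => (f x : ℝ≥0∞) ^ 2) (A.indicator 1)
    (fun x => (h x : ℝ≥0∞) ^ 2) (B.indicator 1)
  have hT : T ≤ C * (∫⁻ x, (f x : ℝ≥0∞) ^ 2) * (∫⁻ x, (h x : ℝ≥0∞) ^ 2) := by
    have mH : Measurable fun z : ((Fin d → ℝ) × (Fin d → ℝ)) × ((Fin d → ℝ) × (Fin d → ℝ)) =>
        (f z.1.1 : ℝ≥0∞) ^ 2 * A.indicator 1 z.1.2 * ((h z.2.1 : ℝ≥0∞) ^ 2 *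
          B.indicator 1 z.2.2) * pairKernel Φ K g z := by fun_prop
    calc T = ∫⁻ ξ : Fin d → ℝ, ∫⁻ x : Fin d → ℝ, ∫⁻ η : Fin d → ℝ, ∫⁻ y : Fin d → ℝ,
          (f ξ : ℝ≥0∞) ^ 2 * A.indicator 1 x * ((h η : ℝ≥0∞) ^ 2 *
          B.indicator 1 y) * pairKernel Φ K g ((ξ, x), (η, y)) := by
          simp only [T]
          rw [fourForm, lintegral_prod _ mH.aemeasurable,
            lintegral_prod _ mH.lintegral_prod_right'.aemeasurable]
          refine lintegral_congr fun ξ => lintegral_congr fun x => ?_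
          exact lintegral_prod _ (mH.comp measurable_prodMk_left).aemeasurable
      _ = ∫⁻ ξ : Fin d → ℝ, ∫⁻ η : Fin d → ℝ, ((f ξ : ℝ≥0∞) ^ 2 * (h η : ℝ≥0∞) ^ 2) *
          ∫⁻ y : (Fin d → ℝ) × (Fin d → ℝ), A.indicator 1 y.1 *
          B.indicator 1 y.2 * pairKernel Φ K g ((ξ, y.1), (η, y.2)) := by
          refine lintegral_congr fun ξ => ?_
          have m3 : Measurable fun q : ((Fin d → ℝ) × (Fin d → ℝ)) × (Fin d → ℝ) =>
              (f ξ : ℝ≥0∞) ^ 2 * A.indicator 1 q.1.1 * ((h q.1.2 : ℝ≥0∞) ^ 2 *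
              B.indicator 1 q.2) * pairKernel Φ K g ((ξ, q.1.1), (q.1.2, q.2)) :=
            mH.comp (g := fun z => _) (f := fun q : ((Fin d → ℝ) × (Fin d → ℝ)) × (Fin d → ℝ) =>
              ((ξ, q.1.1), (q.1.2, q.2))) (by fun_prop)
          rw [lintegral_lintegral_swap m3.lintegral_prod_right'.aemeasurable]
          refine lintegral_congr fun η => ?_
          have m4 : Measurable fun y : (Fin d → ℝ) × (Fin d → ℝ) => A.indicator 1 y.1 *
              B.indicator 1 y.2 * pairKernel Φ K g ((ξ, y.1), (η, y.2)) := by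
            have := hQ.comp (f := fun y : (Fin d → ℝ) × (Fin d → ℝ) => ((ξ, y.1), (η, y.2)))
              (by fun_prop)
            exact ((mA'.comp measurable_fst).mul (mB'.comp measurable_snd)).mul this
          rw [← lintegral_const_mul _ m4]
          refine Eq.trans ?_ (lintegral_prod _ (m4.const_mul _).aemeasurable).symm
          refine lintegral_congr fun x => lintegral_congr fun y => ?_
          ring
      _ ≤ ∫⁻ ξ : Fin d → ℝ, ∫⁻ η : Fin d → ℝ, ((f ξ : ℝ≥0∞) ^ 2 * (h η : ℝ≥0∞) ^ 2) * C := by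
          gcongr with ξ η
          exact inner ξ η
      _ = _ := by
          simp only [mul_assoc]
          have : ∀ ξ, ∫⁻ η, (f ξ : ℝ≥0∞) ^ 2 * ((h η : ℝ≥0∞) ^ 2 * C) =
              (f ξ : ℝ≥0∞) ^ 2 * ((∫⁻ η, (h η : ℝ≥0∞) ^ 2) * C) := fun ξ => by
            rw [lintegral_const_mul _ (by fun_prop), lintegral_mul_const _ (by fun_prop)]
          simp only [this]
          rw [lintegral_mul_const _ (by fun_prop)]
          ring
  have hsym : fourForm volume (pairKernel Φ K g) (A.indicator 1) (fun x => (f x : ℝ≥0∞) ^ 2)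
    (B.indicator 1) (fun x => (h x : ℝ≥0∞) ^ 2) = T :=
    fourForm_swap_swap (pairKernel_swap_swap Φ hvK.even hwg.even) _ _ _ _
  have hfA' : ∀ x, (f x : ℝ≥0∞) = A.indicator 1 x * f x := fun x => by
    by_cases hx : x ∈ A
    · simp [hx]
    · simp [hx, hfA x hx]
  have hhB' : ∀ x, (h x : ℝ≥0∞) = B.indicator 1 x * h x := fun x => by
    by_cases hx : x ∈ B
    · simp [hx]
    · simp [hx, hhB x hx]
  have hsq : ∀ {s : Set (Fin d → ℝ)} x, s.indicator (1 : (Fin d → ℝ) → ℝ≥0∞) x ≤ 1 := fun {s} x =>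
    Set.indicator_le_self' (f := (1 : (Fin d → ℝ) → ℝ≥0∞)) (fun _ _ => zero_le_one) x
  calc _ ≤ T + T := by
        nth_rw 2 [← hsym]
        simp only [T, fourForm]
        rw [← lintegral_add_left]
        · refine lintegral_mono fun z => ?_
          simp only
          rw [← add_mul]
          refine mul_le_mul_left ?_ _
          by_cases h0 : z.1.1 ∈ A ∧ z.1.2 ∈ A ∧ z.2.1 ∈ B ∧ z.2.2 ∈ B
          · obtain ⟨h1, h2, h3, h4⟩ := h0
            simp only [Set.indicator_of_mem h1, Set.indicator_of_mem h2, Set.indicator_of_mem h3,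
              Set.indicator_of_mem h4, Pi.one_apply, one_mul, mul_one]
            norm_cast
            nlinarith [sq_nonneg ((f z.1.1 : ℝ) * h z.2.1 - f z.1.2 * h z.2.2)]
          · have : (f z.1.1 : ℝ≥0∞) * f z.1.2 * (h z.2.1 * h z.2.2) = 0 := by
              by_contra hne
              simp only [mul_eq_zero, not_or, ENNReal.coe_eq_zero] at hne
              exact h0 ⟨not_not.1 fun hx => hne.1.1 (hfA _ hx), not_not.1 fun hx => hne.1.2 (hfA _ hx),
                not_not.1 fun hx => hne.2.1 (hhB _ hx), not_not.1 fun hx => hne.2.2 (hhB _ hx)⟩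
            rw [this]
            exact zero_le
        · fun_prop
    _ ≤ _ := by
        rw [← two_mul, mul_assoc, mul_assoc]
        gcongr
        rw [← mul_assoc]
        exact hT

end

section

variable {d k : ℕ}

theorem exists_fourForm_pairKernel_le (hd : 1 ≤ d) (hdk : k ≤ d) {Φ : (Fin d → ℝ) → Fin k → ℝ}
    (hΦ : ContDiff ℝ (⊤ : ℕ∞) Φ) (ν₁ ν₂ : Fin d → ℝ)
    (hM : ∀ t : Fin k → ℝ, (∑ i, t i ^ 2) = 1 →
      ∀ ν, (ν = ν₁ ∨ ν = ν₂) → (Mmat d k Φ t ν₁ ν₂ ν).det ≠ 0) :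
    ∃ δ : ℝ, 0 < δ ∧ ∃ C : ℝ≥0∞, C ≠ ∞ ∧ ∀ (v K : (Fin d → ℝ) → ℝ) (w g : (Fin k → ℝ) → ℝ),
      IsFourierPair v K → v 0 = 1 → IsFourierPair w g → w 0 = 1 →
      ∀ f h : (Fin d → ℝ) → NNReal, Measurable f → Measurable h →
      (∀ x ∉ Metric.closedBall ν₁ δ, f x = 0) → (∀ x ∉ Metric.closedBall ν₂ δ, h x = 0) →
      ∫⁻ x, (f x : ℝ≥0∞) ^ (4 * ((d : ℝ) + k) / (3 * d + k)) ≠ ∞ →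
      ∫⁻ x, (h x : ℝ≥0∞) ^ (4 * ((d : ℝ) + k) / (3 * d + k)) ≠ ∞ →
      fourForm volume (pairKernel Φ K g) (fun x => f x) (fun x => f x) (fun x => h x)
        (fun x => h x) ≤
      C * (∫⁻ x, (f x : ℝ≥0∞) ^ (4 * ((d : ℝ) + k) / (3 * d + k))) ^
          (2 / (4 * ((d : ℝ) + k) / (3 * d + k))) *
        (∫⁻ x, (h x : ℝ≥0∞) ^ (4 * ((d : ℝ) + k) / (3 * d + k))) ^
          (2 / (4 * ((d : ℝ) + k) / (3 * d + k))) := by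
  rcases hdk.lt_or_eq with hlt | heq
  · exact exists_fourForm_pairKernel_le_of_lt hlt hΦ ν₁ ν₂ hM
  · subst heq
    have hk0 : (k : ℝ) ≠ 0 := by positivity
    have e1 : 4 * ((k : ℝ) + k) / (3 * k + k) = 2 := by field_simp; ring
    obtain ⟨δ, hδ, C, hC, H⟩ := exists_fourForm_pairKernel_le_of_eq hd hΦ ν₁ ν₂ hM
    refine ⟨δ, hδ, C, hC, ?_⟩
    intro v K w g hv hv0 hw hw0 f h hf hh hfA hhB _ _
    rw [e1, div_self two_ne_zero, ENNReal.rpow_one, ENNReal.rpow_one]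
    simp only [ENNReal.rpow_two]
    exact H v K w g hv hv0 hw hw0 f h hf hh hfA hhB

/-- The Gaussian `exp (-π a |t|²)`. -/
def gaussWeight (n : ℕ) (a : ℝ) (t : Fin n → ℝ) : ℝ :=
  Real.exp (-(Real.pi * a) * ∑ i, t i ^ 2)

theorem continuous_gaussWeight (n : ℕ) (a : ℝ) : Continuous (gaussWeight n a) := by
  unfold gaussWeight; fun_prop

theorem integral_cexp_mul_gaussWeight (n : ℕ) {a : ℝ} (ha : 0 < a) (u : Fin n → ℝ) :
    ∫ t, Complex.exp (Complex.I * (2 * Real.pi * (t ⬝ᵥ u) : ℝ)) * (gaussWeight n a t : ℂ) =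
      (((1 / a) ^ ((n : ℝ) / 2) * gaussWeight n (1 / a) u : ℝ) : ℂ) := by
  have h := GaussianFourier.integral_cexp_neg_mul_sum_add (ι := Fin n)
    (b := ((Real.pi * a : ℝ) : ℂ)) (by rw [Complex.ofReal_re]; positivity)
    (fun i => 2 * Real.pi * Complex.I * u i)
  have hpi : (Real.pi : ℂ) ≠ 0 := by exact_mod_cast Real.pi_ne_zero
  have ha' : (a : ℂ) ≠ 0 := by exact_mod_cast ha.ne'
  have e1 : ∀ t : Fin n → ℝ, Complex.exp (Complex.I * (2 * Real.pi * (t ⬝ᵥ u) : ℝ)) *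
      (gaussWeight n a t : ℂ) = Complex.exp (-((Real.pi * a : ℝ) : ℂ) * ∑ i, (t i : ℂ) ^ 2 +
        ∑ i, 2 * Real.pi * Complex.I * u i * t i) := by
    intro t
    rw [gaussWeight, Complex.ofReal_exp, ← Complex.exp_add]
    congr 1
    push_cast [dotProduct]
    rw [add_comm, ← mul_assoc, Finset.mul_sum Finset.univ (fun i => (t i : ℂ) * u i)]
    congr 1
    refine Finset.sum_congr rfl fun i _ => ?_
    ring
  simp only [e1]
  rw [h, Fintype.card_fin, gaussWeight, Complex.ofReal_mul ((1 / a) ^ ((n : ℝ) / 2)), Complex.ofReal_exp,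
    Complex.ofReal_cpow (by positivity)]
  congr 2
  · push_cast
    field_simp
  · push_cast; ring
  · push_cast
    simp only [mul_pow, Complex.I_sq, ← Finset.mul_sum]
    field_simp
    ring

theorem integrable_gaussWeight (n : ℕ) {a : ℝ} (ha : 0 < a) : Integrable (gaussWeight n a) := by
  have h := GaussianFourier.integrable_cexp_neg_mul_sum_add (ι := Fin n)
    (b := ((Real.pi * a : ℝ) : ℂ)) (by rw [Complex.ofReal_re]; positivity) (fun i => 0)
  refine (integrable_norm_iff (by exact (continuous_gaussWeight n a).aestronglyMeasurable)).1 ?_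
  refine h.norm.congr (.of_forall fun t => ?_)
  simp only [zero_mul, Finset.sum_const_zero, add_zero, Complex.norm_exp, gaussWeight, Real.norm_eq_abs,
    Real.abs_exp]
  congr 1
  have : (-((Real.pi * a : ℝ) : ℂ) * ∑ i, (t i : ℂ) ^ 2) =
    ((-(Real.pi * a) * ∑ i, t i ^ 2 : ℝ) : ℂ) := by push_cast; ring
  rw [this, Complex.ofReal_re]

theorem isFourierPair_gaussWeight (n : ℕ) {a : ℝ} (ha : 0 < a) :
    IsFourierPair (gaussWeight n a)
      (fun u => (1 / a) ^ ((n : ℝ) / 2) * gaussWeight n (1 / a) u) where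
  continuous_w := continuous_gaussWeight n a
  continuous_g := (continuous_gaussWeight n _).const_mul _
  integrable_w := integrable_gaussWeight n ha
  integrable_g := (integrable_gaussWeight n (by positivity)).const_mul _
  w_nonneg t := (Real.exp_pos _).le
  g_nonneg t := mul_nonneg (by positivity) (Real.exp_pos _).le
  g_eq u := (integral_cexp_mul_gaussWeight n ha u).symm
  w_eq t := by
    have h := integral_cexp_mul_gaussWeight n (a := 1 / a) (by positivity) t
    simp only [one_div_one_div] at h
    have e : ∀ u : Fin n → ℝ, Complex.exp (Complex.I * (2 * Real.pi * (t ⬝ᵥ u) : ℝ)) *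
        (((1 / a) ^ ((n : ℝ) / 2) * gaussWeight n (1 / a) u : ℝ) : ℂ) =
        (((1 / a) ^ ((n : ℝ) / 2) : ℝ) : ℂ) *
        (Complex.exp (Complex.I * (2 * Real.pi * (u ⬝ᵥ t) : ℝ)) *
          (gaussWeight n (1 / a) u : ℂ)) := fun u => by
      rw [dotProduct_comm]; push_cast; ring
    simp only [e]
    rw [integral_const_mul, h, ← Complex.ofReal_mul, ← mul_assoc,
      ← Real.mul_rpow (by positivity) ha.le, one_div_mul_cancel ha.ne', Real.one_rpow, one_mul]

theorem gaussWeight_zero (n : ℕ) (a : ℝ) : gaussWeight n a 0 = 1 := by simp [gaussWeight]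

end

section

variable {d k : ℕ}

/-- The extension operator on functions defined on the whole space. -/
def fullExt (Φ : (Fin d → ℝ) → Fin k → ℝ) (f : (Fin d → ℝ) → ℂ)
    (z : (Fin d → ℝ) × (Fin k → ℝ)) : ℂ :=
  ∫ ξ, Complex.exp (Complex.I * (2 * Real.pi * (z.1 ⬝ᵥ ξ + z.2 ⬝ᵥ Φ ξ) : ℝ)) * f ξ

theorem extOp_eq_fullExt {S : Set (Fin d → ℝ)} (hS : MeasurableSet S)
    (Φ : (Fin d → ℝ) → Fin k → ℝ) (f : (Fin d → ℝ) → ℂ) :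
    extOp d k S Φ f = fullExt Φ (S.indicator f) := by
  funext z
  rw [extOp, fullExt, ← integral_indicator hS]
  congr 1
  funext ξ
  by_cases h : ξ ∈ S
  · simp only [Set.indicator_of_mem h, dotProduct]
    push_cast
    ring_nf
  · simp [Set.indicator_of_notMem h]

theorem integrable_cexp_mul_complex {X : Type*} [MeasurableSpace X] {μ : Measure X} {f : X → ℝ}
    {g : X → ℂ} (hf : AEStronglyMeasurable f μ) (hg : Integrable g μ) :
    Integrable (fun x => Complex.exp (Complex.I * (f x : ℂ)) * g x) μ := by
  refine hg.bdd_mul (c := 1) ?_ (Filter.Eventually.of_forall fun x =>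
    (norm_cexp_I_mul_ofReal _).le)
  exact Complex.continuous_exp.comp_aestronglyMeasurable
    ((Complex.continuous_ofReal.comp_aestronglyMeasurable hf).const_mul _)

theorem fullExt_mul_conj (Φ : (Fin d → ℝ) → Fin k → ℝ) (f h : (Fin d → ℝ) → ℂ)
    (z : (Fin d → ℝ) × (Fin k → ℝ)) :
    ((‖fullExt Φ f z * fullExt Φ h z‖ ^ 2 : ℝ) : ℂ) =
      ∫ y : ((Fin d → ℝ) × (Fin d → ℝ)) × ((Fin d → ℝ) × (Fin d → ℝ)),
        Complex.exp (Complex.I * (2 * Real.pi * (z.1 ⬝ᵥ (y.1.1 + y.2.1 - y.1.2 - y.2.2) +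
          z.2 ⬝ᵥ (Φ y.1.1 + Φ y.2.1 - Φ y.1.2 - Φ y.2.2)) : ℝ)) *
        (f y.1.1 * (starRingEnd ℂ) (f y.1.2) * (h y.2.1 * (starRingEnd ℂ) (h y.2.2))) := by
  have e1 : ∀ f : (Fin d → ℝ) → ℂ, fullExt Φ f z * (starRingEnd ℂ) (fullExt Φ f z) =
      ∫ y : (Fin d → ℝ) × (Fin d → ℝ),
        (Complex.exp (Complex.I * (2 * Real.pi * (z.1 ⬝ᵥ y.1 + z.2 ⬝ᵥ Φ y.1) : ℝ)) * f y.1) *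
        (starRingEnd ℂ) (Complex.exp (Complex.I * (2 * Real.pi * (z.1 ⬝ᵥ y.2 + z.2 ⬝ᵥ Φ y.2) : ℝ))
          * f y.2) := by
    intro f
    rw [fullExt, ← integral_conj]
    exact (integral_prod_mul (μ := volume) (ν := volume) _ _).symm
  have e2 : ((‖fullExt Φ f z * fullExt Φ h z‖ ^ 2 : ℝ) : ℂ) =
      (fullExt Φ f z * (starRingEnd ℂ) (fullExt Φ f z)) *
      (fullExt Φ h z * (starRingEnd ℂ) (fullExt Φ h z)) := by
    rw [Complex.mul_conj, Complex.mul_conj, ← Complex.ofReal_mul, ← map_mul,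
      Complex.normSq_eq_norm_sq]
  rw [e2, e1 f, e1 h, ← integral_prod_mul]
  congr 1
  funext y
  have e3 : ∀ x : ℝ, (starRingEnd ℂ) (Complex.exp (Complex.I * x)) =
      Complex.exp (Complex.I * (-x : ℝ)) := by
    intro x
    rw [← Complex.exp_conj, map_mul, Complex.conj_I, Complex.conj_ofReal]
    push_cast; ring_nf
  rw [map_mul, map_mul, e3, e3]
  have e4 : (2 * Real.pi * (z.1 ⬝ᵥ (y.1.1 + y.2.1 - y.1.2 - y.2.2) +
          z.2 ⬝ᵥ (Φ y.1.1 + Φ y.2.1 - Φ y.1.2 - Φ y.2.2)) : ℝ) =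
      2 * Real.pi * (z.1 ⬝ᵥ y.1.1 + z.2 ⬝ᵥ Φ y.1.1) +
      -(2 * Real.pi * (z.1 ⬝ᵥ y.1.2 + z.2 ⬝ᵥ Φ y.1.2)) +
      2 * Real.pi * (z.1 ⬝ᵥ y.2.1 + z.2 ⬝ᵥ Φ y.2.1) +
      -(2 * Real.pi * (z.1 ⬝ᵥ y.2.2 + z.2 ⬝ᵥ Φ y.2.2)) := by
    simp only [dotProduct_add, dotProduct_sub]; ring
  rw [e4]
  simp only [Complex.ofReal_add, mul_add, Complex.exp_add]
  ring

theorem lintegral_fullExt_mul_sq_le {Φ : (Fin d → ℝ) → Fin k → ℝ} (hΦ : Continuous Φ)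
    {f h : (Fin d → ℝ) → ℂ} (hf : Integrable f) (hh : Integrable h)
    {v K : (Fin d → ℝ) → ℝ} {w g : (Fin k → ℝ) → ℝ} (hv : IsFourierPair v K)
    (hw : IsFourierPair w g) :
    ∫⁻ z, ‖fullExt Φ f z * fullExt Φ h z‖ₑ ^ 2 * ENNReal.ofReal (v z.1 * w z.2) ≤
      fourForm volume (pairKernel Φ K g) (fun x => ‖f x‖ₑ) (fun x => ‖f x‖ₑ)
        (fun x => ‖h x‖ₑ) (fun x => ‖h x‖ₑ) := by
  set F : ((Fin d → ℝ) × (Fin d → ℝ)) × ((Fin d → ℝ) × (Fin d → ℝ)) → ℂ := fun y =>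
    f y.1.1 * (starRingEnd ℂ) (f y.1.2) * (h y.2.1 * (starRingEnd ℂ) (h y.2.2)) with hF
  set V : (Fin d → ℝ) × (Fin k → ℝ) → ℂ := fun z => (v z.1 : ℂ) * (w z.2 : ℂ) with hV
  set ph : ((Fin d → ℝ) × (Fin k → ℝ)) ×
      (((Fin d → ℝ) × (Fin d → ℝ)) × ((Fin d → ℝ) × (Fin d → ℝ))) → ℝ := fun p =>
    2 * Real.pi * (p.1.1 ⬝ᵥ (p.2.1.1 + p.2.2.1 - p.2.1.2 - p.2.2.2) +
          p.1.2 ⬝ᵥ (Φ p.2.1.1 + Φ p.2.2.1 - Φ p.2.1.2 - Φ p.2.2.2)) with hph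
  have hconj : ∀ {f : (Fin d → ℝ) → ℂ}, Integrable f →
      Integrable (fun x => (starRingEnd ℂ) (f x)) := fun hf =>
    (LinearIsometryEquiv.integrable_comp_iff (Complex.conjLIE)).2 hf
  have hFi : Integrable F := (hf.mul_prod (hconj hf)).mul_prod (hh.mul_prod (hconj hh))
  have hVi : Integrable V := hv.integrable_w.ofReal.mul_prod hw.integrable_w.ofReal
  have hphc : Continuous ph := by
    simp only [hph, dotProduct]
    fun_prop
  have hG : Integrable (fun p => Complex.exp (Complex.I * (ph p : ℂ)) * (V p.1 * F p.2))
      (volume.prod volume) :=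
    integrable_cexp_mul_complex hphc.aestronglyMeasurable (hVi.mul_prod hFi)
  have hinner : ∀ z, ∫ y, Complex.exp (Complex.I * (ph (z, y) : ℂ)) * (V z * F y) =
      ((‖fullExt Φ f z * fullExt Φ h z‖ ^ 2 * (v z.1 * w z.2) : ℝ) : ℂ) := by
    intro z
    rw [Complex.ofReal_mul, fullExt_mul_conj, mul_comm, ← integral_const_mul]
    congr 1
    funext y
    simp only [hV, hF, hph]
    push_cast
    ring
  have hInt : Integrable (fun z => ‖fullExt Φ f z * fullExt Φ h z‖ ^ 2 * (v z.1 * w z.2))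
      (volume : Measure ((Fin d → ℝ) × (Fin k → ℝ))) := by
    have := hG.integral_prod_left
    simp only [hinner] at this
    exact this.re
  have houter : ∀ y, ∫ z, Complex.exp (Complex.I * (ph (z, y) : ℂ)) * (V z * F y) =
      F y * ((K (y.1.1 + y.2.1 - y.1.2 - y.2.2) : ℂ) *
        (g (Φ y.1.1 + Φ y.2.1 - Φ y.1.2 - Φ y.2.2) : ℂ)) := by
    intro y
    rw [hv.g_eq, hw.g_eq, ← integral_prod_mul, ← integral_const_mul]
    congr 1
    funext z
    simp only [hV, hph]
    rw [mul_add, Complex.ofReal_add, mul_add, Complex.exp_add]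
    ring
  have hLHS : ∫⁻ z, ‖fullExt Φ f z * fullExt Φ h z‖ₑ ^ 2 * ENNReal.ofReal (v z.1 * w z.2) =
      ‖∫ z, ((‖fullExt Φ f z * fullExt Φ h z‖ ^ 2 * (v z.1 * w z.2) : ℝ) : ℂ)‖ₑ := by
    have hnn : ∀ z : (Fin d → ℝ) × (Fin k → ℝ),
        0 ≤ ‖fullExt Φ f z * fullExt Φ h z‖ ^ 2 * (v z.1 * w z.2) := fun z =>
      mul_nonneg (by positivity) (mul_nonneg (hv.w_nonneg _) (hw.w_nonneg _))
    rw [integral_complex_ofReal, ← ofReal_norm, Complex.norm_real, Real.norm_of_nonneg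
      (integral_nonneg hnn), ofReal_integral_eq_lintegral_ofReal hInt (.of_forall hnn)]
    refine lintegral_congr fun z => ?_
    rw [ENNReal.ofReal_mul (p := ‖fullExt Φ f z * fullExt Φ h z‖ ^ 2) (by positivity),
      ENNReal.ofReal_pow (norm_nonneg _),
      ofReal_norm]
  rw [hLHS]
  simp only [← hinner]
  rw [integral_integral_swap hG]
  refine (enorm_integral_le_lintegral_enorm _).trans (le_of_eq ?_)
  rw [fourForm]
  refine lintegral_congr fun y => ?_
  rw [houter y]
  simp only [hF, pairKernel, enorm_mul]
  have hc : ∀ c : ℂ, ‖(starRingEnd ℂ) c‖ₑ = ‖c‖ₑ := fun c => by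
    rw [← ofReal_norm, Complex.norm_conj, ofReal_norm]
  have hr : ∀ x : ℝ, 0 ≤ x → ‖(x : ℂ)‖ₑ = ENNReal.ofReal x := fun x hx => by
    rw [← ofReal_norm, Complex.norm_real, Real.norm_of_nonneg hx]
  rw [hc, hc, hr _ (hv.g_nonneg _), hr _ (hw.g_nonneg _)]

end

section

variable {d k : ℕ}

theorem continuous_fullExt {Φ : (Fin d → ℝ) → Fin k → ℝ} (hΦ : Continuous Φ)
    {f : (Fin d → ℝ) → ℂ} (hf : Integrable f) : Continuous (fullExt Φ f) := by
  refine continuous_of_dominated (bound := fun ξ => ‖f ξ‖) (fun z => ?_) (fun z => ?_) hf.norm ?_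
  · refine (integrable_cexp_mul_complex ?_ hf).aestronglyMeasurable
    exact Continuous.aestronglyMeasurable (by simp only [dotProduct]; fun_prop)
  · refine .of_forall fun ξ => ?_
    rw [norm_mul, norm_cexp_I_mul_ofReal, one_mul]
  · refine .of_forall fun ξ => ?_
    simp only [dotProduct]
    fun_prop

theorem fullExt_add {Φ : (Fin d → ℝ) → Fin k → ℝ} (hΦ : Continuous Φ)
    {f g : (Fin d → ℝ) → ℂ} (hf : Integrable f) (hg : Integrable g)
    (z : (Fin d → ℝ) × (Fin k → ℝ)) :
    fullExt Φ (fun x => f x + g x) z = fullExt Φ f z + fullExt Φ g z := by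
  rw [fullExt, fullExt, fullExt, ← integral_add]
  · simp only [mul_add]
  all_goals
    refine integrable_cexp_mul_complex ?_ ‹_›
    exact Continuous.aestronglyMeasurable (by simp only [dotProduct]; fun_prop)

/-- The `L^P × L^P → L²` estimate for the product of extensions of functions supported in
`T₁` and `T₂`. -/
def BilinearBound (Φ : (Fin d → ℝ) → Fin k → ℝ) (P : ℝ≥0∞) (T₁ T₂ : Set (Fin d → ℝ)) : Prop :=
  ∃ C : ℝ≥0∞, C ≠ ∞ ∧ ∀ f h : (Fin d → ℝ) → ℂ, Measurable f → Measurable h →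
    Integrable f → Integrable h → MemLp f P → MemLp h P →
    (∀ x ∉ T₁, f x = 0) → (∀ x ∉ T₂, h x = 0) →
    eLpNorm (fun z => fullExt Φ f z * fullExt Φ h z) 2 volume ≤
      C * eLpNorm f P volume * eLpNorm h P volume

theorem BilinearBound.mono {Φ : (Fin d → ℝ) → Fin k → ℝ} {P : ℝ≥0∞}
    {T₁ T₂ T₁' T₂' : Set (Fin d → ℝ)} (H : BilinearBound Φ P T₁ T₂) (h₁ : T₁' ⊆ T₁)
    (h₂ : T₂' ⊆ T₂) : BilinearBound Φ P T₁' T₂' := by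
  obtain ⟨C, hC, H⟩ := H
  exact ⟨C, hC, fun f h a b c d e g hf hh => H f h a b c d e g (fun x hx => hf x fun hx' => hx (h₁ hx'))
    fun x hx => hh x fun hx' => hx (h₂ hx')⟩

theorem BilinearBound.symm {Φ : (Fin d → ℝ) → Fin k → ℝ} {P : ℝ≥0∞}
    {T₁ T₂ : Set (Fin d → ℝ)} (H : BilinearBound Φ P T₁ T₂) : BilinearBound Φ P T₂ T₁ := by
  obtain ⟨C, hC, H⟩ := H
  refine ⟨C, hC, fun f h a b c d e g hf hh => ?_⟩
  have := H h f b a d c g e hh hf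
  rw [mul_right_comm]
  simpa only [mul_comm (fullExt Φ h _)] using this

theorem BilinearBound.empty_left (Φ : (Fin d → ℝ) → Fin k → ℝ) (P : ℝ≥0∞)
    (T₂ : Set (Fin d → ℝ)) : BilinearBound Φ P ∅ T₂ := by
  refine ⟨0, ENNReal.zero_ne_top, fun f h a b c d e g hf hh => ?_⟩
  have : f = 0 := funext fun x => hf x (by simp)
  subst this
  simp [fullExt]

theorem BilinearBound.union_left {Φ : (Fin d → ℝ) → Fin k → ℝ} (hΦ : Continuous Φ) {P : ℝ≥0∞}
    {T₁ T₁' T₂ : Set (Fin d → ℝ)} (hT : MeasurableSet T₁) (H : BilinearBound Φ P T₁ T₂)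
    (H' : BilinearBound Φ P T₁' T₂) : BilinearBound Φ P (T₁ ∪ T₁') T₂ := by
  obtain ⟨C, hC, H⟩ := H
  obtain ⟨C', hC', H'⟩ := H'
  refine ⟨C + C', ENNReal.add_ne_top.2 ⟨hC, hC'⟩, fun f h mf mh i_f i_h lf lh sf sh => ?_⟩
  have e1 := H (T₁.indicator f) h (mf.indicator hT) mh (i_f.indicator hT) i_h (lf.indicator hT) lh
    (fun x hx => Set.indicator_of_notMem hx _) sh
  have e2 := H' (T₁ᶜ.indicator f) h (mf.indicator hT.compl) mh (i_f.indicator hT.compl) i_h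
    (lf.indicator hT.compl) lh (fun x hx => by
      by_cases h : x ∈ T₁
      · exact Set.indicator_of_notMem (by simpa using h) _
      · rw [Set.indicator_of_mem (by simpa using h)]
        exact sf x (by simp [h, hx])) sh
  have e3 : (fun z => fullExt Φ f z * fullExt Φ h z) =
      (fun z => fullExt Φ (T₁.indicator f) z * fullExt Φ h z) +
      (fun z => fullExt Φ (T₁ᶜ.indicator f) z * fullExt Φ h z) := by
    funext z
    rw [Pi.add_apply, ← add_mul, ← fullExt_add hΦ (i_f.indicator hT) (i_f.indicator hT.compl)]
    congr 2
    funext x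
    exact (congrFun (Set.indicator_self_add_compl T₁ f) x).symm
  rw [e3]
  have hc : ∀ T, MeasurableSet T →
      AEStronglyMeasurable (fun z => fullExt Φ (T.indicator f) z * fullExt Φ h z) volume :=
    fun T hT => ((continuous_fullExt hΦ (i_f.indicator hT)).mul
      (continuous_fullExt hΦ i_h)).aestronglyMeasurable
  refine (eLpNorm_add_le (hc _ hT) (hc _ hT.compl) (by norm_num)).trans ?_
  refine (add_le_add e1 e2).trans ?_
  rw [add_mul, add_mul]
  have hi : ∀ T : Set (Fin d → ℝ), eLpNorm (T.indicator f) P volume ≤ eLpNorm f P volume := fun T =>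
    eLpNorm_indicator_le f
  gcongr <;> exact hi _

theorem tendsto_gaussWeight (n : ℕ) (t : Fin n → ℝ) :
    Filter.Tendsto (fun m : ℕ => gaussWeight n (1 / ((m : ℝ) + 1)) t) Filter.atTop (nhds 1) := by
  have h := tendsto_one_div_add_atTop_nhds_zero_nat (𝕜 := ℝ)
  have hc : Continuous fun a : ℝ => gaussWeight n a t := by unfold gaussWeight; fun_prop
  have := (hc.tendsto 0).comp h
  have h0 : gaussWeight n 0 t = 1 := by simp [gaussWeight]
  rw [h0] at this
  exact this

theorem exists_bilinearBound_closedBall (hd : 1 ≤ d) (hdk : k ≤ d)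
    {Φ : (Fin d → ℝ) → Fin k → ℝ} (hΦ : ContDiff ℝ (⊤ : ℕ∞) Φ) (ν₁ ν₂ : Fin d → ℝ)
    (hM : ∀ t : Fin k → ℝ, (∑ i, t i ^ 2) = 1 →
      ∀ ν, (ν = ν₁ ∨ ν = ν₂) → (Mmat d k Φ t ν₁ ν₂ ν).det ≠ 0) :
    ∃ δ : ℝ, 0 < δ ∧ BilinearBound Φ (ENNReal.ofReal (4 * ((d : ℝ) + k) / (3 * d + k)))
      (Metric.closedBall ν₁ δ) (Metric.closedBall ν₂ δ) := by
  obtain ⟨δ, hδ, C, hC, H⟩ := exists_fourForm_pairKernel_le hd hdk hΦ ν₁ ν₂ hM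
  have hd0 : (0 : ℝ) < d := by exact_mod_cast hd
  have hP : 0 < 4 * ((d : ℝ) + k) / (3 * d + k) := by positivity
  set P := 4 * ((d : ℝ) + k) / (3 * d + k)
  have hPe0 : ENNReal.ofReal P ≠ 0 := by simpa using hP
  refine ⟨δ, hδ, C ^ (1 / 2 : ℝ), ENNReal.rpow_ne_top_of_nonneg (by norm_num) hC,
    fun f h mf mh i_f i_h lf lh sf sh => ?_⟩
  have key : ∀ m : ℕ, ∫⁻ z : (Fin d → ℝ) × (Fin k → ℝ), ‖fullExt Φ f z * fullExt Φ h z‖ₑ ^ 2 *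
      ENNReal.ofReal (gaussWeight d (1 / ((m : ℝ) + 1)) z.1 *
        gaussWeight k (1 / ((m : ℝ) + 1)) z.2) ≤
      C * (∫⁻ x, ‖f x‖ₑ ^ P) ^ (2 / P) * (∫⁻ x, ‖h x‖ₑ ^ P) ^ (2 / P) := by
    intro m
    have hv := isFourierPair_gaussWeight d (a := 1 / ((m : ℝ) + 1)) (by positivity)
    have hw := isFourierPair_gaussWeight k (a := 1 / ((m : ℝ) + 1)) (by positivity)
    refine (lintegral_fullExt_mul_sq_le hΦ.continuous i_f i_h hv hw).trans ?_
    refine H _ _ _ _ hv (gaussWeight_zero _ _) hw (gaussWeight_zero _ _) (fun x => ‖f x‖₊)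
      (fun x => ‖h x‖₊) mf.nnnorm mh.nnnorm (fun x hx => by simp [sf x hx])
      (fun x hx => by simp [sh x hx]) ?_ ?_
    · have := (lintegral_rpow_enorm_lt_top_of_eLpNorm_lt_top hPe0 ENNReal.ofReal_ne_top lf.2).ne
      rwa [ENNReal.toReal_ofReal hP.le] at this
    · have := (lintegral_rpow_enorm_lt_top_of_eLpNorm_lt_top hPe0 ENNReal.ofReal_ne_top lh.2).ne
      rwa [ENNReal.toReal_ofReal hP.le] at this
  have hcont : Continuous fun z => fullExt Φ f z * fullExt Φ h z :=
    (continuous_fullExt hΦ.continuous i_f).mul (continuous_fullExt hΦ.continuous i_h)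
  have hlim : ∫⁻ z : (Fin d → ℝ) × (Fin k → ℝ), ‖fullExt Φ f z * fullExt Φ h z‖ₑ ^ 2 ≤
      C * (∫⁻ x, ‖f x‖ₑ ^ P) ^ (2 / P) * (∫⁻ x, ‖h x‖ₑ ^ P) ^ (2 / P) := by
    have hpt : ∀ z : (Fin d → ℝ) × (Fin k → ℝ), ‖fullExt Φ f z * fullExt Φ h z‖ₑ ^ 2 =
        Filter.liminf (fun m : ℕ => ‖fullExt Φ f z * fullExt Φ h z‖ₑ ^ 2 *
          ENNReal.ofReal (gaussWeight d (1 / ((m : ℝ) + 1)) z.1 *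
            gaussWeight k (1 / ((m : ℝ) + 1)) z.2)) Filter.atTop := by
      intro z
      refine (Filter.Tendsto.liminf_eq ?_).symm
      have h1 := ENNReal.tendsto_ofReal ((tendsto_gaussWeight d z.1).mul (tendsto_gaussWeight k z.2))
      have h2 := ENNReal.Tendsto.const_mul (a := ‖fullExt Φ f z * fullExt Φ h z‖ₑ ^ 2) h1
        (.inl (by simp))
      simpa using h2
    rw [lintegral_congr hpt]
    refine (lintegral_liminf_le fun m => ?_).trans ?_
    · refine (hcont.measurable.enorm.pow_const 2).mul (ENNReal.continuous_ofReal.comp ?_).measurable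
      exact ((continuous_gaussWeight _ _).comp continuous_fst).mul
        ((continuous_gaussWeight _ _).comp continuous_snd)
    · exact (Filter.liminf_le_liminf (.of_forall key)).trans (by simp)
  rw [eLpNorm_eq_lintegral_rpow_enorm_toReal two_ne_zero ENNReal.ofNat_ne_top,
    eLpNorm_eq_lintegral_rpow_enorm_toReal hPe0 ENNReal.ofReal_ne_top,
    eLpNorm_eq_lintegral_rpow_enorm_toReal hPe0 ENNReal.ofReal_ne_top,
    ENNReal.toReal_ofReal hP.le, ENNReal.toReal_ofNat]
  simp only [ENNReal.rpow_two]
  refine (ENNReal.rpow_le_rpow hlim (by norm_num)).trans (le_of_eq ?_)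
  rw [ENNReal.mul_rpow_of_nonneg _ _ (by norm_num), ENNReal.mul_rpow_of_nonneg _ _ (by norm_num),
    ← ENNReal.rpow_mul, ← ENNReal.rpow_mul, show 2 / P * (1 / 2) = 1 / P by ring]

theorem bilinearBound_of_isCompact (hd : 1 ≤ d) (hdk : k ≤ d)
    {Φ : (Fin d → ℝ) → Fin k → ℝ} (hΦ : ContDiff ℝ (⊤ : ℕ∞) Φ) {S₁ S₂ : Set (Fin d → ℝ)}
    (hS₁ : IsCompact S₁) (hS₂ : IsCompact S₂)
    (hM : ∀ ν₁ ∈ S₁, ∀ ν₂ ∈ S₂, ∀ t : Fin k → ℝ, (∑ i, t i ^ 2) = 1 →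
      ∀ ν, (ν = ν₁ ∨ ν = ν₂) → (Mmat d k Φ t ν₁ ν₂ ν).det ≠ 0) :
    BilinearBound Φ (ENNReal.ofReal (4 * ((d : ℝ) + k) / (3 * d + k))) S₁ S₂ := by
  set P := ENNReal.ofReal (4 * ((d : ℝ) + k) / (3 * d + k))
  have h1 : ∀ ν₁ ∈ S₁, ∃ δ > 0, BilinearBound Φ P (Metric.closedBall ν₁ δ) S₂ := by
    intro ν₁ hν₁
    have : ∃ T, MeasurableSet T ∧ S₂ ⊆ T ∧ ∃ δ > 0, BilinearBound Φ P (Metric.closedBall ν₁ δ) T := by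
      refine hS₂.induction_on (p := fun S => ∃ T, MeasurableSet T ∧ S ⊆ T ∧
        ∃ δ > 0, BilinearBound Φ P (Metric.closedBall ν₁ δ) T) ?_ ?_ ?_ ?_
      · exact ⟨∅, .empty, subset_rfl, 1, one_pos, (BilinearBound.empty_left Φ P _).symm⟩
      · rintro s t hst ⟨T, hT, hs, H⟩
        exact ⟨T, hT, hst.trans hs, H⟩
      · rintro s t ⟨T, hT, hs, δ, hδ, H⟩ ⟨T', hT', hs', δ', hδ', H'⟩
        refine ⟨T ∪ T', hT.union hT', Set.union_subset_union hs hs', min δ δ', lt_min hδ hδ', ?_⟩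
        have a := H.mono (Metric.closedBall_subset_closedBall (min_le_left δ δ')) subset_rfl
        have b := H'.mono (Metric.closedBall_subset_closedBall (min_le_right δ δ')) subset_rfl
        exact (a.symm.union_left hΦ.continuous hT b.symm).symm
      · intro ν₂ hν₂
        obtain ⟨δ, hδ, H⟩ := exists_bilinearBound_closedBall hd hdk hΦ ν₁ ν₂ (hM ν₁ hν₁ ν₂ hν₂)
        exact ⟨Metric.closedBall ν₂ δ, mem_nhdsWithin_of_mem_nhds (Metric.closedBall_mem_nhds _ hδ),
          _, Metric.isClosed_closedBall.measurableSet, subset_rfl, δ, hδ, H⟩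
    obtain ⟨T, -, hT, δ, hδ, H⟩ := this
    exact ⟨δ, hδ, H.mono subset_rfl hT⟩
  have : ∃ T, MeasurableSet T ∧ S₁ ⊆ T ∧ BilinearBound Φ P T S₂ := by
    refine hS₁.induction_on (p := fun S => ∃ T, MeasurableSet T ∧ S ⊆ T ∧
      BilinearBound Φ P T S₂) ?_ ?_ ?_ ?_
    · exact ⟨∅, .empty, subset_rfl, BilinearBound.empty_left Φ P _⟩
    · rintro s t hst ⟨T, hT, hs, H⟩
      exact ⟨T, hT, hst.trans hs, H⟩
    · rintro s t ⟨T, hT, hs, H⟩ ⟨T', hT', hs', H'⟩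
      exact ⟨T ∪ T', hT.union hT', Set.union_subset_union hs hs', H.union_left hΦ.continuous hT H'⟩
    · intro ν₁ hν₁
      obtain ⟨δ, hδ, H⟩ := h1 ν₁ hν₁
      exact ⟨Metric.closedBall ν₁ δ, mem_nhdsWithin_of_mem_nhds (Metric.closedBall_mem_nhds _ hδ),
        _, Metric.isClosed_closedBall.measurableSet, subset_rfl, H⟩
  obtain ⟨T, -, hT, H⟩ := this
  exact H.mono hT subset_rfl

end

/-- Entire functions that are bounded on the closed strip `0 ≤ re s ≤ 1`. -/
def StripBounded (F : ℂ → ℂ) : Prop :=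
  Differentiable ℂ F ∧ ∃ M : ℝ, ∀ s ∈ Complex.HadamardThreeLines.verticalClosedStrip 0 1, ‖F s‖ ≤ M

theorem StripBounded.const (c : ℂ) : StripBounded fun _ => c :=
  ⟨differentiable_const c, ‖c‖, fun _ _ => le_rfl⟩

theorem StripBounded.mul {F G : ℂ → ℂ} (hF : StripBounded F) (hG : StripBounded G) :
    StripBounded fun s => F s * G s := by
  obtain ⟨hF, M, hM⟩ := hF
  obtain ⟨hG, N, hN⟩ := hG
  refine ⟨hF.mul hG, M * N, fun s hs => ?_⟩
  rw [norm_mul]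
  exact mul_le_mul (hM s hs) (hN s hs) (norm_nonneg _) ((norm_nonneg _).trans (hM s hs))

theorem StripBounded.sum {ι : Type*} (t : Finset ι) {F : ι → ℂ → ℂ}
    (hF : ∀ i ∈ t, StripBounded (F i)) : StripBounded fun s => ∑ i ∈ t, F i s := by
  choose! h M hM using hF
  refine ⟨Differentiable.fun_sum fun i hi => h i hi, ∑ i ∈ t, M i, fun s hs => ?_⟩
  exact (norm_sum_le _ _).trans (Finset.sum_le_sum fun i hi => hM i hi s hs)

theorem StripBounded.enorm_le {F : ℂ → ℂ} (hF : StripBounded F) {a b : ℝ≥0∞} (ha : a ≠ ∞)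
    (hb : b ≠ ∞) (h0 : ∀ s : ℂ, s.re = 0 → ‖F s‖ₑ ≤ a) (h1 : ∀ s : ℂ, s.re = 1 → ‖F s‖ₑ ≤ b)
    {θ : ℝ} (hθ0 : 0 ≤ θ) (hθ1 : θ ≤ 1) : ‖F θ‖ₑ ≤ a ^ (1 - θ) * b ^ θ := by
  obtain ⟨hd, M, hM⟩ := hF
  have hr : ∀ {c : ℝ≥0∞} {z : ℂ}, c ≠ ∞ → ‖z‖ₑ ≤ c → ‖z‖ ≤ c.toReal := fun hc h => by
    rw [← ofReal_norm] at h
    exact (ENNReal.ofReal_le_iff_le_toReal hc).1 h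
  have h := Complex.HadamardThreeLines.norm_le_interp_of_mem_verticalClosedStrip₀₁' F
    (z := (θ : ℂ)) (a := a.toReal) (b := b.toReal) ⟨by simpa using hθ0, by simpa using hθ1⟩
    hd.diffContOnCl ⟨M, by rintro _ ⟨s, hs, rfl⟩; exact hM s hs⟩
    (fun s hs => hr ha (h0 s hs)) (fun s hs => hr hb (h1 s hs))
  rw [Complex.ofReal_re] at h
  rw [← ofReal_norm]
  refine (ENNReal.ofReal_le_ofReal h).trans (le_of_eq ?_)
  rw [ENNReal.ofReal_mul (by positivity), ENNReal.toReal_rpow, ENNReal.toReal_rpow,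
    ENNReal.ofReal_toReal (ENNReal.rpow_ne_top_of_nonneg (by linarith) ha),
    ENNReal.ofReal_toReal (ENNReal.rpow_ne_top_of_nonneg hθ0 hb)]

/-- The analytic family `s ↦ (a / |a|) |a| ^ (r ((1 - s) + κ s))` used in complex interpolation. -/
def interpPow (r κ : ℝ) (s a : ℂ) : ℂ :=
  if a = 0 then 0 else a / ‖a‖ * Complex.exp (r * ((1 - s) + κ * s) * (Real.log ‖a‖ : ℝ))

@[simp] theorem interpPow_zero (r κ : ℝ) (s : ℂ) : interpPow r κ s 0 = 0 := by simp [interpPow]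

theorem interpPow_eq_self {r κ θ : ℝ} (h : r * ((1 - θ) + κ * θ) = 1) (a : ℂ) :
    interpPow r κ θ a = a := by
  by_cases ha : a = 0
  · simp [ha]
  · have h' : (r : ℂ) * ((1 - θ) + κ * θ) = 1 := by exact_mod_cast h
    have hn : (‖a‖ : ℂ) ≠ 0 := by exact_mod_cast norm_ne_zero_iff.2 ha
    rw [interpPow, if_neg ha, h', one_mul, ← Complex.ofReal_exp, Real.exp_log (norm_pos_iff.2 ha),
      div_mul_cancel₀ _ hn]

theorem norm_interpPow {r κ : ℝ} {s : ℂ} (h : r * ((1 - s.re) + κ * s.re) ≠ 0) (a : ℂ) :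
    ‖interpPow r κ s a‖ = ‖a‖ ^ (r * ((1 - s.re) + κ * s.re)) := by
  by_cases ha : a = 0
  · simp [ha, Real.zero_rpow h]
  · have hn := norm_pos_iff.2 ha
    rw [interpPow, if_neg ha, norm_mul, norm_div, Complex.norm_real, norm_norm, div_self hn.ne',
      one_mul, Complex.norm_exp, Real.rpow_def_of_pos hn, mul_comm (Real.log _)]
    simp

theorem stripBounded_interpPow (r κ : ℝ) (a : ℂ) : StripBounded fun s => interpPow r κ s a := by
  by_cases ha : a = 0
  · simpa [ha] using StripBounded.const 0
  · simp only [interpPow, if_neg ha]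
    refine ⟨by fun_prop, Real.exp (|r| * (1 + |κ|) * |Real.log ‖a‖|), fun s hs => ?_⟩
    have hn := norm_pos_iff.2 ha
    rw [norm_mul, norm_div, Complex.norm_real, norm_norm, div_self hn.ne', one_mul,
      Complex.norm_exp]
    refine Real.exp_le_exp.2 ?_
    have hs0 : 0 ≤ s.re := hs.1
    have hs1 : s.re ≤ 1 := hs.2
    have e : ((r : ℂ) * ((1 - s) + κ * s) * (Real.log ‖a‖ : ℝ)).re =
        r * ((1 - s.re) + κ * s.re) * Real.log ‖a‖ := by simp
    rw [e]
    refine (le_abs_self _).trans ?_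
    rw [abs_mul, abs_mul]
    gcongr
    refine (abs_add_le _ _).trans ?_
    rw [abs_mul, abs_of_nonneg hs0, abs_of_nonneg (by linarith : 0 ≤ 1 - s.re)]
    nlinarith [abs_nonneg κ]

section

variable {d k : ℕ}

theorem MeasureTheory.SimpleFunc.apply_eq_sum_indicator {X : Type*} [MeasurableSpace X]
    (f : SimpleFunc X ℂ) {φ : ℂ → ℂ} (hφ : φ 0 = 0) (x : X) :
    φ (f x) = ∑ a ∈ f.range.erase 0, φ a * (f ⁻¹' {a}).indicator 1 x := by
  by_cases h : f x = 0
  · rw [h, hφ, Finset.sum_eq_zero]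
    intro a ha
    rw [Set.indicator_of_notMem, mul_zero]
    intro hx
    exact (Finset.mem_erase.1 ha).1 (by rw [← h]; exact (Set.mem_singleton_iff.1 hx).symm)
  · rw [Finset.sum_eq_single (f x)]
    · rw [Set.indicator_of_mem (by simp), Pi.one_apply, mul_one]
    · intro b _ hb
      rw [Set.indicator_of_notMem, mul_zero]
      exact fun hx => hb (Set.mem_singleton_iff.1 hx).symm
    · intro hn
      exact absurd (Finset.mem_erase.2 ⟨h, f.mem_range_self x⟩) hn

theorem integrable_indicator_preimage {X : Type*} [MeasurableSpace X] {μ : Measure X}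
    {f : SimpleFunc X ℂ} (hf : f.FinMeasSupp μ) {a : ℂ} (ha : a ≠ 0) :
    Integrable ((f ⁻¹' {a}).indicator (1 : X → ℂ)) μ :=
  (integrable_indicator_iff (f.measurableSet_fiber a)).2
    (integrableOn_const (SimpleFunc.finMeasSupp_iff.1 hf a ha).ne)

theorem fullExt_simpleFunc {Φ : (Fin d → ℝ) → Fin k → ℝ} (hΦ : Continuous Φ)
    {f : SimpleFunc (Fin d → ℝ) ℂ} (hf : f.FinMeasSupp volume) {φ : ℂ → ℂ} (hφ : φ 0 = 0)
    (z : (Fin d → ℝ) × (Fin k → ℝ)) :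
    fullExt Φ (fun x => φ (f x)) z =
      ∑ a ∈ f.range.erase 0, φ a * fullExt Φ ((f ⁻¹' {a}).indicator 1) z := by
  simp only [fullExt, f.apply_eq_sum_indicator hφ, Finset.mul_sum]
  rw [integral_finsetSum]
  · refine Finset.sum_congr rfl fun a _ => ?_
    rw [← integral_const_mul]
    congr 1; funext x; ring
  · intro a ha
    refine integrable_cexp_mul_complex ?_
      ((integrable_indicator_preimage hf (Finset.mem_erase.1 ha).1).const_mul _)
    exact Continuous.aestronglyMeasurable (by simp only [dotProduct]; fun_prop)

theorem norm_fullExt_le (Φ : (Fin d → ℝ) → Fin k → ℝ) (f : (Fin d → ℝ) → ℂ)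
    (z : (Fin d → ℝ) × (Fin k → ℝ)) : ‖fullExt Φ f z‖ ≤ ∫ x, ‖f x‖ := by
  refine (norm_integral_le_integral_norm _).trans (le_of_eq ?_)
  simp only [norm_mul, norm_cexp_I_mul_ofReal, one_mul]

theorem enorm_fullExt_le (Φ : (Fin d → ℝ) → Fin k → ℝ) (f : (Fin d → ℝ) → ℂ)
    (z : (Fin d → ℝ) × (Fin k → ℝ)) : ‖fullExt Φ f z‖ₑ ≤ ∫⁻ x, ‖f x‖ₑ := by
  refine (enorm_integral_le_lintegral_enorm _).trans (le_of_eq ?_)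
  refine lintegral_congr fun x => ?_
  rw [enorm_mul, ← ofReal_norm, norm_cexp_I_mul_ofReal, ENNReal.ofReal_one, one_mul]

theorem stripBounded_trilinear {Φ : (Fin d → ℝ) → Fin k → ℝ} (hΦ : Continuous Φ)
    {f g : SimpleFunc (Fin d → ℝ) ℂ} {h : SimpleFunc ((Fin d → ℝ) × (Fin k → ℝ)) ℂ}
    (hf : f.FinMeasSupp volume) (hg : g.FinMeasSupp volume) (hh : h.FinMeasSupp volume)
    {u : (Fin d → ℝ) × (Fin k → ℝ) → ℂ} (hu : Measurable u) (hu1 : ∀ z, ‖u z‖ ≤ 1)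
    (r κ ρ κ' : ℝ) :
    StripBounded fun s => ∫ z, fullExt Φ (fun x => interpPow r κ s (f x)) z *
      fullExt Φ (fun x => interpPow r κ s (g x)) z * (u z * interpPow ρ κ' s (h z)) := by
  have e : ∀ s, ∫ z, fullExt Φ (fun x => interpPow r κ s (f x)) z *
      fullExt Φ (fun x => interpPow r κ s (g x)) z * (u z * interpPow ρ κ' s (h z)) =
      ∑ c ∈ h.range.erase 0, ∑ a ∈ f.range.erase 0, ∑ b ∈ g.range.erase 0,
        interpPow r κ s a * interpPow r κ s b * interpPow ρ κ' s c *
        ∫ z, fullExt Φ ((f ⁻¹' {a}).indicator 1) z * fullExt Φ ((g ⁻¹' {b}).indicator 1) z *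
          (u z * (h ⁻¹' {c}).indicator 1 z) := by
    intro s
    have hInt : ∀ a ∈ f.range.erase 0, ∀ b ∈ g.range.erase 0, ∀ c ∈ h.range.erase 0,
        Integrable (fun z => fullExt Φ ((f ⁻¹' {a}).indicator 1) z *
          fullExt Φ ((g ⁻¹' {b}).indicator 1) z * (u z * (h ⁻¹' {c}).indicator 1 z)) volume := by
      intro a ha b hb c hc
      have i1 := integrable_indicator_preimage hf (Finset.mem_erase.1 ha).1
      have i2 := integrable_indicator_preimage hg (Finset.mem_erase.1 hb).1
      have i3 := integrable_indicator_preimage hh (Finset.mem_erase.1 hc).1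
      refine Integrable.bdd_mul (c := (∫ x, ‖(f ⁻¹' {a}).indicator (1 : (Fin d → ℝ) → ℂ) x‖) *
        ∫ x, ‖(g ⁻¹' {b}).indicator (1 : (Fin d → ℝ) → ℂ) x‖) (i3.bdd_mul hu.aestronglyMeasurable (.of_forall hu1))
        ((continuous_fullExt hΦ i1).mul (continuous_fullExt hΦ i2)).aestronglyMeasurable
        (.of_forall fun z => ?_)
      rw [norm_mul]
      exact mul_le_mul (norm_fullExt_le Φ _ z) (norm_fullExt_le Φ _ z) (norm_nonneg _)
        (integral_nonneg fun _ => norm_nonneg _)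
    have hInt' : ∀ a ∈ f.range.erase 0, ∀ b ∈ g.range.erase 0, ∀ c ∈ h.range.erase 0,
        Integrable (fun z => interpPow r κ s a * interpPow r κ s b * interpPow ρ κ' s c *
          (fullExt Φ ((f ⁻¹' {a}).indicator 1) z * fullExt Φ ((g ⁻¹' {b}).indicator 1) z *
            (u z * (h ⁻¹' {c}).indicator 1 z))) volume :=
      fun a ha b hb c hc => (hInt a ha b hb c hc).const_mul _
    trans ∫ z, ∑ c ∈ h.range.erase 0, ∑ a ∈ f.range.erase 0, ∑ b ∈ g.range.erase 0,
        interpPow r κ s a * interpPow r κ s b * interpPow ρ κ' s c *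
        (fullExt Φ ((f ⁻¹' {a}).indicator 1) z * fullExt Φ ((g ⁻¹' {b}).indicator 1) z *
          (u z * (h ⁻¹' {c}).indicator 1 z))
    · refine integral_congr_ae (.of_forall fun z => ?_)
      simp only
      rw [fullExt_simpleFunc hΦ hf (interpPow_zero r κ s),
        fullExt_simpleFunc hΦ hg (interpPow_zero r κ s),
        h.apply_eq_sum_indicator (interpPow_zero ρ κ' s), Finset.sum_mul_sum, Finset.mul_sum,
        Finset.mul_sum]
      refine Finset.sum_congr rfl fun c _ => ?_
      rw [Finset.sum_mul]
      refine Finset.sum_congr rfl fun a _ => ?_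
      rw [Finset.sum_mul]
      refine Finset.sum_congr rfl fun b _ => ?_
      ring
    · rw [integral_finsetSum _ fun c hc => integrable_finsetSum _ fun a ha =>
        integrable_finsetSum _ fun b hb => hInt' a ha b hb c hc]
      refine Finset.sum_congr rfl fun c hc => ?_
      rw [integral_finsetSum _ fun a ha => integrable_finsetSum _ fun b hb => hInt' a ha b hb c hc]
      refine Finset.sum_congr rfl fun a ha => ?_
      rw [integral_finsetSum _ fun b hb => hInt' a ha b hb c hc]
      exact Finset.sum_congr rfl fun b hb => integral_const_mul _ _
  simp only [e]
  refine StripBounded.sum _ fun c _ => StripBounded.sum _ fun a _ => StripBounded.sum _ fun b _ => ?_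
  exact (((stripBounded_interpPow r κ a).mul (stripBounded_interpPow r κ b)).mul
    (stripBounded_interpPow ρ κ' c)).mul (.const _)

end

section

variable {d k : ℕ}

theorem enorm_interpPow {r κ : ℝ} {s : ℂ} (h : 0 < r * ((1 - s.re) + κ * s.re)) (a : ℂ) :
    ‖interpPow r κ s a‖ₑ = ‖a‖ₑ ^ (r * ((1 - s.re) + κ * s.re)) := by
  rw [← ofReal_norm, norm_interpPow h.ne', ← ENNReal.ofReal_rpow_of_nonneg (norm_nonneg _) h.le,
    ofReal_norm]

theorem BilinearBound.exists_trilinear_le {Φ : (Fin d → ℝ) → Fin k → ℝ} (hΦ : Continuous Φ)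
    {P : ℝ} (hP : 0 < P) {S₁ S₂ : Set (Fin d → ℝ)}
    (H : BilinearBound Φ (ENNReal.ofReal P) S₁ S₂) :
    ∃ C : ℝ≥0∞, C ≠ ∞ ∧ ∀ (f g : SimpleFunc (Fin d → ℝ) ℂ)
      (h : SimpleFunc ((Fin d → ℝ) × (Fin k → ℝ)) ℂ) (u : (Fin d → ℝ) × (Fin k → ℝ) → ℂ),
      f.FinMeasSupp volume → g.FinMeasSupp volume → h.FinMeasSupp volume → Measurable u →
      (∀ z, ‖u z‖ ≤ 1) → (∀ x ∉ S₁, f x = 0) → (∀ x ∉ S₂, g x = 0) →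
      ∀ r ρ θ : ℝ, 0 < r → 0 < ρ → 0 ≤ θ → θ ≤ 1 → r * ((1 - θ) + P⁻¹ * θ) = 1 →
      ρ * ((1 - θ) + 2⁻¹ * θ) = 1 →
      ‖∫ z, fullExt Φ f z * fullExt Φ g z * (u z * h z)‖ₑ ≤
        ((∫⁻ x, ‖f x‖ₑ ^ r) * (∫⁻ x, ‖g x‖ₑ ^ r) * (∫⁻ z, ‖h z‖ₑ ^ ρ)) ^ (1 - θ) *
        (C * (∫⁻ x, ‖f x‖ₑ ^ r) ^ P⁻¹ * (∫⁻ x, ‖g x‖ₑ ^ r) ^ P⁻¹ *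
          (∫⁻ z, ‖h z‖ₑ ^ ρ) ^ (2⁻¹ : ℝ)) ^ θ := by
  obtain ⟨C, hC, H⟩ := H
  refine ⟨C, hC, ?_⟩
  intro f g h u hf hg hh hu hu1 sf sg r ρ θ hr hρ hθ0 hθ1 hrθ hρθ
  have hfin : ∀ {X : Type} [MeasureSpace X] {f : SimpleFunc X ℂ}, f.FinMeasSupp volume →
      ∀ {r : ℝ}, 0 < r → ∫⁻ x, ‖f x‖ₑ ^ r ≠ ∞ := by
    intro X _ f hf r hr
    have h1 : MemLp f (ENNReal.ofReal r) volume :=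
      SimpleFunc.memLp_of_finite_measure_preimage _ fun y hy => SimpleFunc.finMeasSupp_iff.1 hf y hy
    have := (lintegral_rpow_enorm_lt_top_of_eLpNorm_lt_top (by simpa using hr)
      ENNReal.ofReal_ne_top h1.2).ne
    rwa [ENNReal.toReal_ofReal hr.le] at this
  have hA := hfin hf hr
  have hB := hfin hg hr
  have hD := hfin hh hρ
  have hF := stripBounded_trilinear hΦ hf hg hh hu hu1 r P⁻¹ ρ 2⁻¹
  have huE : ∀ z c, ‖u z * c‖ₑ ≤ ‖c‖ₑ := by
    intro z c
    rw [enorm_mul]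
    refine mul_le_of_le_one_left (_root_.zero_le) ?_
    rw [← ofReal_norm]
    exact ENNReal.ofReal_le_one.2 (hu1 z)
  have hmap : ∀ (s : ℂ) (f : SimpleFunc (Fin d → ℝ) ℂ), (f.map (interpPow r P⁻¹ s) : _ → ℂ) =
      fun x => interpPow r P⁻¹ s (f x) := fun s f => rfl
  have hInt : ∀ (s : ℂ) {f : SimpleFunc (Fin d → ℝ) ℂ}, f.FinMeasSupp volume →
      Integrable (fun x => interpPow r P⁻¹ s (f x)) ∧
      Measurable (fun x => interpPow r P⁻¹ s (f x)) ∧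
      MemLp (fun x => interpPow r P⁻¹ s (f x)) (ENNReal.ofReal P) volume := by
    intro s f hf
    have h1 : (f.map (interpPow r P⁻¹ s)).FinMeasSupp volume := hf.map (interpPow_zero _ _ _)
    rw [← hmap]
    exact ⟨h1.integrable, (f.map (interpPow r P⁻¹ s)).measurable,
      SimpleFunc.memLp_of_finite_measure_preimage _ fun y hy => SimpleFunc.finMeasSupp_iff.1 h1 y hy⟩
  have key := hF.enorm_le (θ := θ) (a := (∫⁻ x, ‖f x‖ₑ ^ r) * (∫⁻ x, ‖g x‖ₑ ^ r) * (∫⁻ z, ‖h z‖ₑ ^ ρ))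
    (b := C * (∫⁻ x, ‖f x‖ₑ ^ r) ^ P⁻¹ * (∫⁻ x, ‖g x‖ₑ ^ r) ^ P⁻¹ *
          (∫⁻ z, ‖h z‖ₑ ^ ρ) ^ (2⁻¹ : ℝ)) (ENNReal.mul_ne_top (ENNReal.mul_ne_top hA hB) hD)
    (ENNReal.mul_ne_top (ENNReal.mul_ne_top (ENNReal.mul_ne_top hC
      (ENNReal.rpow_ne_top_of_nonneg (by positivity) hA))
      (ENNReal.rpow_ne_top_of_nonneg (by positivity) hB))
      (ENNReal.rpow_ne_top_of_nonneg (by positivity) hD)) ?_ ?_ hθ0 hθ1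
  · simp only [interpPow_eq_self hrθ, interpPow_eq_self hρθ] at key
    exact key
  · intro s hs
    have e1 : ∀ a, ‖interpPow r P⁻¹ s a‖ₑ = ‖a‖ₑ ^ r := fun a => by
      rw [enorm_interpPow (by rw [hs]; linarith), hs]; simp
    have e2 : ∀ a, ‖interpPow ρ 2⁻¹ s a‖ₑ = ‖a‖ₑ ^ ρ := fun a => by
      rw [enorm_interpPow (by rw [hs]; linarith), hs]; simp
    refine (enorm_integral_le_lintegral_enorm _).trans ?_
    rw [← lintegral_const_mul' _ _ (ENNReal.mul_ne_top hA hB)]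
    refine lintegral_mono fun z => ?_
    rw [enorm_mul, enorm_mul]
    refine mul_le_mul' (mul_le_mul' ?_ ?_) ((huE _ _).trans (e2 _).le)
    · exact (enorm_fullExt_le _ _ _).trans (by simp only [e1]; exact le_rfl)
    · exact (enorm_fullExt_le _ _ _).trans (by simp only [e1]; exact le_rfl)
  · intro s hs
    have e1 : ∀ a, ‖interpPow r P⁻¹ s a‖ₑ ^ P = ‖a‖ₑ ^ r := fun a => by
      rw [enorm_interpPow (by rw [hs]; simp only [sub_self, zero_add, mul_one]; positivity), hs,
        ← ENNReal.rpow_mul]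
      congr 1; field_simp; ring
    have e2 : ∀ a, ‖interpPow ρ 2⁻¹ s a‖ₑ ^ (2 : ℝ) = ‖a‖ₑ ^ ρ := fun a => by
      rw [enorm_interpPow (by rw [hs]; simp only [sub_self, zero_add, mul_one]; positivity), hs,
        ← ENNReal.rpow_mul]
      congr 1; ring
    have e3 : ∀ f : SimpleFunc (Fin d → ℝ) ℂ,
        eLpNorm (fun x => interpPow r P⁻¹ s (f x)) (ENNReal.ofReal P) volume =
        (∫⁻ x, ‖f x‖ₑ ^ r) ^ P⁻¹ := by
      intro f
      rw [eLpNorm_eq_lintegral_rpow_enorm_toReal (by simpa using hP) ENNReal.ofReal_ne_top,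
        ENNReal.toReal_ofReal hP.le, one_div]
      simp only [e1]
    obtain ⟨if1, mf1, lf1⟩ := hInt s hf
    obtain ⟨ig1, mg1, lg1⟩ := hInt s hg
    have hL2 := H _ _ mf1 mg1 if1 ig1 lf1 lg1 (fun x hx => by simp [sf x hx])
      (fun x hx => by simp [sg x hx])
    rw [e3, e3, eLpNorm_eq_lintegral_rpow_enorm_toReal two_ne_zero ENNReal.ofNat_ne_top,
      ENNReal.toReal_ofNat] at hL2
    refine (enorm_integral_le_lintegral_enorm _).trans ?_
    have hHol := ENNReal.lintegral_mul_le_Lp_mul_Lq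
      (volume : Measure ((Fin d → ℝ) × (Fin k → ℝ))) Real.HolderConjugate.two_two
      (f := fun z => ‖fullExt Φ (fun x => interpPow r P⁻¹ s (f x)) z *
        fullExt Φ (fun x => interpPow r P⁻¹ s (g x)) z‖ₑ)
      (g := fun z => ‖interpPow ρ 2⁻¹ s (h z)‖ₑ)
      ((continuous_fullExt hΦ if1).mul (continuous_fullExt hΦ ig1)).enorm.measurable.aemeasurable
      (h.map (interpPow ρ 2⁻¹ s)).measurable.enorm.aemeasurable
    simp only [e2] at hHol
    refine (lintegral_mono fun z => ?_).trans (hHol.trans ?_)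
    · rw [enorm_mul]
      exact mul_le_mul' le_rfl (huE _ _)
    · rw [one_div] at *
      exact mul_le_mul' hL2 le_rfl

end

/-- The converse of Hölder's inequality, tested on simple functions. -/
theorem lintegral_rpow_le_of_forall_simpleFunc {X : Type*} [MeasurableSpace X] {μ : Measure X}
    [SigmaFinite μ] {ρ q : ℝ} (hρq : ρ.HolderConjugate q) {G : X → ℝ≥0∞} (hG : Measurable G)
    {N : ℝ≥0∞} (H : ∀ φ : SimpleFunc X ℝ≥0∞, (∀ x, φ x ≠ ∞) → μ (Function.support φ) < ∞ →
      ∫⁻ x, G x * φ x ∂μ ≤ N * (∫⁻ x, φ x ^ ρ ∂μ) ^ ρ⁻¹) :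
    ∫⁻ x, G x ^ q ∂μ ≤ N ^ q := by
  have hq := hρq.symm.pos
  have hρ := hρq.pos
  have hq1 : 0 < q - 1 := by linarith [hρq.symm.lt]
  set L : ℕ → X → ℝ≥0∞ := fun n => (spanningSets μ n).indicator fun x => min (G x) n with hL
  have hLm : ∀ n, Measurable (L n) := fun n =>
    (hG.min measurable_const).indicator (measurableSet_spanningSets μ n)
  have hLG : ∀ n x, L n x ≤ G x := fun n x =>
    (Set.indicator_le_self' (fun _ _ => _root_.zero_le) x).trans (min_le_left _ _)
  have hLn : ∀ n x, L n x ≤ n := fun n x =>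
    (Set.indicator_le_self' (fun _ _ => _root_.zero_le) x).trans (min_le_right _ _)
  have hL0 : ∀ n, ∀ x ∉ spanningSets μ n, L n x = 0 := fun n x hx =>
    Set.indicator_of_notMem hx _
  have hfin : ∀ n, ∫⁻ x, L n x ^ q ∂μ ≠ ∞ := by
    intro n
    have : ∀ x, L n x ^ q ≤ (spanningSets μ n).indicator (fun _ => (n : ℝ≥0∞) ^ q) x := by
      intro x
      by_cases hx : x ∈ spanningSets μ n
      · rw [Set.indicator_of_mem hx]
        exact ENNReal.rpow_le_rpow (hLn n x) hq.le
      · rw [hL0 n x hx, ENNReal.zero_rpow_of_pos hq]; exact _root_.zero_le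
    refine ((lintegral_mono this).trans_lt ?_).ne
    rw [lintegral_indicator (measurableSet_spanningSets μ n), setLIntegral_const]
    exact ENNReal.mul_lt_top (ENNReal.rpow_lt_top_of_nonneg hq.le (ENNReal.natCast_ne_top n))
      (measure_spanningSets_lt_top μ n)
  have hbound : ∀ n, ∫⁻ x, L n x ^ q ∂μ ≤ N ^ q := by
    intro n
    have hm : Measurable fun x => L n x ^ (q - 1) := (hLm n).pow_const _
    have h1 : ∫⁻ x, G x * L n x ^ (q - 1) ∂μ ≤ N * (∫⁻ x, L n x ^ q ∂μ) ^ ρ⁻¹ := by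
      have e : ∀ x, G x * L n x ^ (q - 1) =
          ⨆ m, G x * SimpleFunc.eapprox (fun x => L n x ^ (q - 1)) m x := fun x => by
        rw [← ENNReal.mul_iSup, SimpleFunc.iSup_eapprox_apply hm]
      simp only [e]
      have hle : ∀ m x, SimpleFunc.eapprox (fun x => L n x ^ (q - 1)) m x ≤ L n x ^ (q - 1) := by
        intro m x
        rw [← SimpleFunc.iSup_eapprox_apply hm x]
        exact le_iSup (fun m => SimpleFunc.eapprox (fun x => L n x ^ (q - 1)) m x) m
      rw [lintegral_iSup (f := fun m x => G x *
        SimpleFunc.eapprox (fun x => L n x ^ (q - 1)) m x)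
        (fun m => hG.mul (SimpleFunc.measurable _))
        (fun i j hij x => mul_le_mul' le_rfl (SimpleFunc.monotone_eapprox _ hij x))]
      refine iSup_le fun m => (H _ (fun x => (SimpleFunc.eapprox_lt_top _ m x).ne) ?_).trans ?_
      · refine (measure_mono fun x hx => ?_).trans_lt (measure_spanningSets_lt_top μ n)
        by_contra hx'
        refine hx (le_antisymm ((hle m x).trans ?_) _root_.zero_le)
        rw [hL0 n x hx', ENNReal.zero_rpow_of_pos hq1]
      · refine mul_le_mul' le_rfl (ENNReal.rpow_le_rpow (lintegral_mono fun x => ?_)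
          (inv_nonneg.2 hρ.le))
        refine (ENNReal.rpow_le_rpow (hle m x) hρ.le).trans (le_of_eq ?_)
        rw [← ENNReal.rpow_mul, hρq.symm.sub_one_mul_conj]
    have h2 : ∫⁻ x, L n x ^ q ∂μ ≤ N * (∫⁻ x, L n x ^ q ∂μ) ^ ρ⁻¹ := by
      refine (lintegral_mono fun x => ?_).trans h1
      have : L n x ^ q = L n x * L n x ^ (q - 1) := by
        conv_lhs => rw [show q = 1 + (q - 1) by ring]
        rw [ENNReal.rpow_add_of_nonneg _ _ zero_le_one hq1.le, ENNReal.rpow_one]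
      rw [this]
      exact mul_le_mul' (hLG n x) le_rfl
    set J := ∫⁻ x, L n x ^ q ∂μ
    by_cases hJ : J = 0
    · rw [hJ]; exact _root_.zero_le
    have h3 : J ^ q⁻¹ ≤ N := by
      have e : J = J ^ q⁻¹ * J ^ ρ⁻¹ := by
        rw [← ENNReal.rpow_add _ _ hJ (hfin n), add_comm, hρq.inv_add_inv_eq_one, ENNReal.rpow_one]
      have h4 : J ^ q⁻¹ * J ^ ρ⁻¹ ≤ N * J ^ ρ⁻¹ := by rwa [← e]
      exact (ENNReal.mul_le_mul_iff_left (fun h => hJ ((ENNReal.rpow_eq_zero_iff_of_pos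
        (inv_pos.2 hρ)).1 h)) (ENNReal.rpow_ne_top_of_nonneg (inv_nonneg.2 hρ.le) (hfin n))).1 h4
    calc J = (J ^ q⁻¹) ^ q := by rw [← ENNReal.rpow_mul, inv_mul_cancel₀ hq.ne', ENNReal.rpow_one]
      _ ≤ N ^ q := ENNReal.rpow_le_rpow h3 hq.le
  have hlim : ∀ x, Filter.liminf (fun n => L n x ^ q) Filter.atTop = G x ^ q := by
    intro x
    refine Filter.Tendsto.liminf_eq ?_
    have h1 : Filter.Tendsto (fun n : ℕ => min (G x) n) Filter.atTop (nhds (min (G x) ∞)) :=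
      tendsto_const_nhds.min ENNReal.tendsto_nat_nhds_top
    rw [min_eq_left le_top] at h1
    have h2 : Filter.Tendsto (fun n => L n x) Filter.atTop (nhds (G x)) := by
      refine h1.congr' ?_
      obtain ⟨m, hm⟩ := Set.mem_iUnion.1 ((iUnion_spanningSets μ).symm ▸ Set.mem_univ x)
      filter_upwards [Filter.eventually_ge_atTop m] with n hn
      simp only [hL]
      rw [Set.indicator_of_mem (monotone_spanningSets μ hn hm)]
    exact (ENNReal.continuous_rpow_const.tendsto _).comp h2
  simp only [← hlim]
  refine (lintegral_liminf_le fun n => (hLm n).pow_const q).trans ?_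
  exact (Filter.liminf_le_liminf (.of_forall hbound)).trans (by simp)

section

variable {d k : ℕ}

theorem BilinearBound.exists_simpleFunc_lintegral_le {Φ : (Fin d → ℝ) → Fin k → ℝ}
    (hΦ : Continuous Φ) {P : ℝ} (hP : 0 < P) {S₁ S₂ : Set (Fin d → ℝ)}
    (H : BilinearBound Φ (ENNReal.ofReal P) S₁ S₂) {q r : ℝ} (hq : 2 ≤ q) (hr : 0 < r)
    (hrq : r⁻¹ = (1 - 2 / q) + P⁻¹ * (2 / q)) :
    ∃ C : ℝ≥0∞, C ≠ ∞ ∧ ∀ f g : SimpleFunc (Fin d → ℝ) ℂ, f.FinMeasSupp volume →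
      g.FinMeasSupp volume → (∀ x ∉ S₁, f x = 0) → (∀ x ∉ S₂, g x = 0) →
      ∫⁻ z, ‖fullExt Φ f z * fullExt Φ g z‖ₑ ^ q ≤
        (C * (∫⁻ x, ‖f x‖ₑ ^ r) ^ r⁻¹ * (∫⁻ x, ‖g x‖ₑ ^ r) ^ r⁻¹) ^ q := by
  obtain ⟨C, hC, H⟩ := H.exists_trilinear_le hΦ hP
  have hq0 : 0 < q := by linarith
  have hθ0 : 0 < 2 / q := by positivity
  have hθ1 : 2 / q ≤ 1 := (div_le_one hq0).2 hq
  refine ⟨C ^ (2 / q), ENNReal.rpow_ne_top_of_nonneg hθ0.le hC, ?_⟩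
  intro f g hf hg sf sg
  have hρq : (Real.conjExponent q).HolderConjugate q :=
    (Real.HolderConjugate.conjExponent (by linarith)).symm
  have hρ : (Real.conjExponent q)⁻¹ = (1 - 2 / q) + 2⁻¹ * (2 / q) := by
    have := hρq.inv_add_inv_eq_one
    have e : 2 / q = 2 * q⁻¹ := div_eq_mul_inv _ _
    rw [e]; linarith
  set ρ := Real.conjExponent q
  have cf := continuous_fullExt hΦ hf.integrable
  have cg := continuous_fullExt hΦ hg.integrable
  have cT : Continuous fun z => fullExt Φ f z * fullExt Φ g z := cf.mul cg
  refine lintegral_rpow_le_of_forall_simpleFunc hρq cT.measurable.enorm fun φ hφ hφs => ?_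
  set T : (Fin d → ℝ) × (Fin k → ℝ) → ℂ := fun z => fullExt Φ f z * fullExt Φ g z with hT
  set u : (Fin d → ℝ) × (Fin k → ℝ) → ℂ := fun z => (starRingEnd ℂ) (T z) / ‖T z‖ with hu
  have um : Measurable u :=
    (Complex.continuous_conj.measurable.comp cT.measurable).div
      (Complex.measurable_ofReal.comp cT.measurable.norm)
  have u1 : ∀ z, ‖u z‖ ≤ 1 := fun z => by
    simp only [hu]
    rw [norm_div, Complex.norm_conj, Complex.norm_real, norm_norm]
    exact div_self_le_one _
  have uT : ∀ z, T z * u z = (‖T z‖ : ℂ) := fun z => by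
    simp only [hu]
    rw [mul_div_assoc', Complex.mul_conj, Complex.normSq_eq_norm_sq]
    by_cases h : ‖T z‖ = 0
    · simp [h]
    · have : (‖T z‖ : ℂ) ≠ 0 := by exact_mod_cast h
      push_cast
      field_simp
  set h : SimpleFunc ((Fin d → ℝ) × (Fin k → ℝ)) ℂ := φ.map fun c => ((c.toReal : ℝ) : ℂ) with hh
  have hval : ∀ z, h z = (((φ z).toReal : ℝ) : ℂ) := fun z => rfl
  have henorm : ∀ z, ‖h z‖ₑ = φ z := fun z => by
    rw [hval, ← ofReal_norm, Complex.norm_real, Real.norm_of_nonneg ENNReal.toReal_nonneg,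
      ENNReal.ofReal_toReal (hφ z)]
  have hfin : h.FinMeasSupp volume := by
    refine SimpleFunc.finMeasSupp_iff_support.2 ((measure_mono fun z hz => ?_).trans_lt hφs)
    intro h0
    refine hz ?_
    rw [hval, h0]; simp
  have hInt : Integrable (fun z => ‖T z‖ * (φ z).toReal) := by
    have h1 : Integrable (fun z => ‖h z‖) := hfin.integrable.norm
    refine (h1.bdd_mul (c := (∫ x, ‖f x‖) * ∫ x, ‖g x‖)
      cT.norm.aestronglyMeasurable (.of_forall fun z => ?_)).congr (.of_forall fun z => ?_)
    · rw [norm_norm, norm_mul]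
      exact mul_le_mul (norm_fullExt_le Φ _ z) (norm_fullExt_le Φ _ z) (norm_nonneg _)
        (integral_nonneg fun _ => norm_nonneg _)
    · simp only [hval, Complex.norm_real, Real.norm_of_nonneg ENNReal.toReal_nonneg, hT]
  have hnn : ∀ z, 0 ≤ ‖T z‖ * (φ z).toReal := fun z =>
    mul_nonneg (norm_nonneg _) ENNReal.toReal_nonneg
  have e1 : ∫⁻ z, ‖T z‖ₑ * φ z = ‖∫ z, fullExt Φ f z * fullExt Φ g z * (u z * h z)‖ₑ := by
    have e2 : ∀ z, fullExt Φ f z * fullExt Φ g z * (u z * h z) =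
        ((‖T z‖ * (φ z).toReal : ℝ) : ℂ) := fun z => by
      rw [← mul_assoc, hval, Complex.ofReal_mul, ← uT z]
    simp only [e2]
    rw [integral_complex_ofReal, ← ofReal_norm, Complex.norm_real,
      Real.norm_of_nonneg (integral_nonneg hnn),
      ofReal_integral_eq_lintegral_ofReal hInt (.of_forall hnn)]
    refine lintegral_congr fun z => ?_
    rw [ENNReal.ofReal_mul (norm_nonneg _), ofReal_norm, ENNReal.ofReal_toReal (hφ z)]
  refine e1.trans_le ?_
  refine (H f g h u hf hg hfin um u1 sf sg r ρ (2 / q) hr hρq.pos hθ0.le hθ1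
    (by rw [← hrq, mul_inv_cancel₀ hr.ne']) (by rw [← hρ, mul_inv_cancel₀ hρq.pos.ne'])).trans ?_
  simp only [henorm]
  have h10 : 0 ≤ 1 - 2 / q := by linarith
  rw [hrq, hρ]
  have h2 : 0 ≤ P⁻¹ * (2 / q) := by positivity
  have h3 : 0 ≤ (2⁻¹ : ℝ) * (2 / q) := by positivity
  simp only [ENNReal.rpow_add_of_nonneg _ _ h10 h2, ENNReal.rpow_add_of_nonneg _ _ h10 h3,
    ENNReal.mul_rpow_of_nonneg _ _ h10, ENNReal.mul_rpow_of_nonneg _ _ hθ0.le, ENNReal.rpow_mul]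
  refine le_of_eq ?_
  ring

/-- The `L^r × L^r → L^q` estimate for measurable functions supported in sets of finite measure. -/
theorem BilinearBound.exists_lintegral_le {Φ : (Fin d → ℝ) → Fin k → ℝ}
    (hΦ : Continuous Φ) {P : ℝ} (hP : 0 < P) {S₁ S₂ : Set (Fin d → ℝ)} (hS₁ : volume S₁ ≠ ∞)
    (hS₂ : volume S₂ ≠ ∞)
    (H : BilinearBound Φ (ENNReal.ofReal P) S₁ S₂) {q r : ℝ} (hq : 2 ≤ q) (hr : 0 < r)
    (hrq : r⁻¹ = (1 - 2 / q) + P⁻¹ * (2 / q)) :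
    ∃ C : ℝ≥0∞, C ≠ ∞ ∧ ∀ f g : (Fin d → ℝ) → ℂ, Measurable f → Measurable g → Integrable f →
      Integrable g → (∀ x ∉ S₁, f x = 0) → (∀ x ∉ S₂, g x = 0) →
      ∫⁻ z, ‖fullExt Φ f z * fullExt Φ g z‖ₑ ^ q ≤
        (C * (∫⁻ x, ‖f x‖ₑ ^ r) ^ r⁻¹ * (∫⁻ x, ‖g x‖ₑ ^ r) ^ r⁻¹) ^ q := by
  obtain ⟨C, hC, H⟩ := H.exists_simpleFunc_lintegral_le hΦ hP hq hr hrq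
  have hq0 : 0 < q := by linarith
  refine ⟨C * 2 * 2, by finiteness, ?_⟩
  intro f g mf mg i_f i_g sf sg
  have happ : ∀ {f : (Fin d → ℝ) → ℂ} {S : Set (Fin d → ℝ)}, Measurable f → Integrable f →
      volume S ≠ ∞ → (∀ x ∉ S, f x = 0) → ∃ F : ℕ → SimpleFunc (Fin d → ℝ) ℂ,
      (∀ n, (F n).FinMeasSupp volume) ∧ (∀ n, ∀ x ∉ S, F n x = 0) ∧
      (∀ n, (∫⁻ x, ‖F n x‖ₑ ^ r) ^ r⁻¹ ≤ 2 * (∫⁻ x, ‖f x‖ₑ ^ r) ^ r⁻¹) ∧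
      ∀ z, Filter.Tendsto (fun n => fullExt Φ (F n) z) Filter.atTop (nhds (fullExt Φ f z)) := by
    intro f S mf i_f hS sf
    set F := SimpleFunc.approxOn f mf Set.univ 0 (Set.mem_univ _) with hF
    have hle : ∀ n x, ‖F n x‖ ≤ 2 * ‖f x‖ := fun n x => by
      rw [two_mul]
      exact SimpleFunc.norm_approxOn_zero_le mf (Set.mem_univ _) x n
    have hsupp : ∀ n, ∀ x ∉ S, F n x = 0 := fun n x hx => by
      have := hle n x
      rw [sf x hx, norm_zero, mul_zero] at this
      exact norm_le_zero_iff.1 this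
    refine ⟨F, fun n => ?_, hsupp, fun n => ?_, fun z => ?_⟩
    · refine SimpleFunc.finMeasSupp_iff_support.2 ((measure_mono fun x hx => ?_).trans_lt hS.lt_top)
      by_contra hx'
      exact hx (hsupp n x hx')
    · have h1 : ∫⁻ x, ‖F n x‖ₑ ^ r ≤ 2 ^ r * ∫⁻ x, ‖f x‖ₑ ^ r := by
        rw [← lintegral_const_mul _ (mf.enorm.pow_const r)]
        refine lintegral_mono fun x => ?_
        rw [← ENNReal.mul_rpow_of_nonneg _ _ hr.le]
        refine ENNReal.rpow_le_rpow ?_ hr.le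
        rw [← ofReal_norm, ← ofReal_norm]
        refine (ENNReal.ofReal_le_ofReal (hle n x)).trans (le_of_eq ?_)
        rw [ENNReal.ofReal_mul zero_le_two]; simp
      refine (ENNReal.rpow_le_rpow h1 (inv_nonneg.2 hr.le)).trans (le_of_eq ?_)
      rw [ENNReal.mul_rpow_of_nonneg _ _ (inv_nonneg.2 hr.le), ← ENNReal.rpow_mul,
        mul_inv_cancel₀ hr.ne', ENNReal.rpow_one]
    · have hph : Continuous fun ξ => 2 * Real.pi * (z.1 ⬝ᵥ ξ + z.2 ⬝ᵥ Φ ξ) := by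
        simp only [dotProduct]; fun_prop
      refine tendsto_integral_of_dominated_convergence (fun x => 2 * ‖f x‖) (fun n => ?_)
        (i_f.norm.const_mul 2) (fun n => .of_forall fun x => ?_) (.of_forall fun x => ?_)
      · refine (Complex.continuous_exp.comp ((Complex.continuous_ofReal.comp hph).const_mul
          _)).aestronglyMeasurable.mul (F n).stronglyMeasurable.aestronglyMeasurable
      · rw [norm_mul, norm_cexp_I_mul_ofReal, one_mul]
        exact hle n x
      · exact (SimpleFunc.tendsto_approxOn mf (Set.mem_univ _) (by simp)).const_mul _
  obtain ⟨F, F1, F2, F3, F4⟩ := happ mf i_f hS₁ sf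
  obtain ⟨G, G1, G2, G3, G4⟩ := happ mg i_g hS₂ sg
  have hlim : ∀ z, Filter.liminf (fun n => ‖fullExt Φ (F n) z * fullExt Φ (G n) z‖ₑ ^ q)
      Filter.atTop = ‖fullExt Φ f z * fullExt Φ g z‖ₑ ^ q := by
    intro z
    refine Filter.Tendsto.liminf_eq ?_
    exact (ENNReal.continuous_rpow_const.tendsto _).comp (((F4 z).mul (G4 z)).enorm)
  simp only [← hlim]
  refine (lintegral_liminf_le fun n => ?_).trans ?_
  · exact ((continuous_fullExt hΦ (F1 n).integrable).mul
      (continuous_fullExt hΦ (G1 n).integrable)).measurable.enorm.pow_const q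
  · refine (Filter.liminf_le_liminf (v := fun _ => (C * 2 * 2 * (∫⁻ x, ‖f x‖ₑ ^ r) ^ r⁻¹ *
      (∫⁻ x, ‖g x‖ₑ ^ r) ^ r⁻¹) ^ q) (.of_forall fun n => ?_)).trans (by simp)
    refine (H _ _ (F1 n) (G1 n) (F2 n) (G2 n)).trans (ENNReal.rpow_le_rpow ?_ hq0.le)
    refine (mul_le_mul' (mul_le_mul' le_rfl (F3 n)) (G3 n)).trans (le_of_eq ?_)
    ring

end

section

variable {d k : ℕ}

theorem IsClosedCube.isCompact {S : Set (Fin d → ℝ)} (hS : IsClosedCube d S)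
    (hSI : S ⊆ Set.Icc (-1) 1) : IsCompact S := by
  obtain ⟨a, r, -, rfl⟩ := hS
  refine isCompact_Icc.of_isClosed_subset ?_ hSI
  simp only [Set.ofPred_forall]
  exact isClosed_iInter fun i => isClosed_le (by fun_prop) continuous_const

theorem IsClosedCube.nonempty {S : Set (Fin d → ℝ)} (hS : IsClosedCube d S) : S.Nonempty := by
  obtain ⟨a, r, hr, rfl⟩ := hS
  exact ⟨a, fun i => by simpa using hr⟩

theorem det_Mmat_eq_zero_of_lt (hdk : d < k) (Φ : (Fin d → ℝ) → Fin k → ℝ) (t : Fin k → ℝ)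
    (ν₁ ν₂ ν : Fin d → ℝ) : (Mmat d k Φ t ν₁ ν₂ ν).det = 0 := by
  have h : (Matrix.toLin' (Dmat d k Φ ν₁ ν₂)ᵀ).ker ≠ ⊥ :=
    LinearMap.ker_ne_bot_of_finrank_lt (by simpa using hdk)
  obtain ⟨v, hv, hv0⟩ := Submodule.exists_mem_ne_zero_of_ne_bot h
  rw [LinearMap.mem_ker, Matrix.toLin'_apply] at hv
  refine Matrix.exists_mulVec_eq_zero_iff.1 ⟨Sum.elim v 0, fun h0 => hv0 ?_, ?_⟩
  · funext i
    exact congrFun h0 (Sum.inl i)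
  · rw [Mmat, Matrix.fromBlocks_mulVec, Sum.elim_comp_inl, Sum.elim_comp_inr, hv]
    simp

theorem fullExt_eq_zero_of_not_integrable {Φ : (Fin d → ℝ) → Fin k → ℝ} (hΦ : Continuous Φ)
    {f : (Fin d → ℝ) → ℂ} (hf : ¬ Integrable f) (z : (Fin d → ℝ) × (Fin k → ℝ)) :
    fullExt Φ f z = 0 := by
  refine integral_undef fun h => hf ?_
  have hph : Continuous fun ξ => -(2 * Real.pi * (z.1 ⬝ᵥ ξ + z.2 ⬝ᵥ Φ ξ)) := by
    simp only [dotProduct]; fun_prop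
  refine (h.bdd_mul (c := 1) (f := fun ξ => Complex.exp (Complex.I *
    ((-(2 * Real.pi * (z.1 ⬝ᵥ ξ + z.2 ⬝ᵥ Φ ξ)) : ℝ) : ℂ)))
    (Complex.continuous_exp.comp ((Complex.continuous_ofReal.comp hph).const_mul
      _)).aestronglyMeasurable (.of_forall fun ξ => (norm_cexp_I_mul_ofReal _).le)).congr
    (.of_forall fun ξ => ?_)
  simp only
  rw [← mul_assoc, ← Complex.exp_add, Complex.ofReal_neg, mul_neg, neg_add_cancel,
    Complex.exp_zero, one_mul]

theorem BilinearBound.exists_eLpNorm_le {Φ : (Fin d → ℝ) → Fin k → ℝ}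
    (hΦ : Continuous Φ) {P : ℝ} (hP : 0 < P) {S₁ S₂ : Set (Fin d → ℝ)} (mS₁ : MeasurableSet S₁)
    (mS₂ : MeasurableSet S₂) (hS₁ : volume S₁ ≠ ∞) (hS₂ : volume S₂ ≠ ∞)
    (H : BilinearBound Φ (ENNReal.ofReal P) S₁ S₂) {q r p : ℝ} (hq : 2 ≤ q) (hr : 0 < r)
    (hrq : r⁻¹ = (1 - 2 / q) + P⁻¹ * (2 / q)) (hrp : r ≤ p) :
    ∃ C : ℝ≥0∞, C ≠ ∞ ∧ ∀ f g : (Fin d → ℝ) → ℂ,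
      eLpNorm (fun z => fullExt Φ (S₁.indicator f) z * fullExt Φ (S₂.indicator g) z)
        (ENNReal.ofReal q) volume ≤
        C * eLpNorm f (ENNReal.ofReal p) volume * eLpNorm g (ENNReal.ofReal p) volume := by
  obtain ⟨C, hC, H⟩ := H.exists_lintegral_le hΦ hP hS₁ hS₂ hq hr hrq
  have hq0 : 0 < q := by linarith
  have hp0 : 0 < p := hr.trans_le hrp
  have hexp : 0 ≤ 1 / r - 1 / p := sub_nonneg.2 (one_div_le_one_div_of_le hr hrp)
  have hrep : ∀ {S : Set (Fin d → ℝ)} {f : (Fin d → ℝ) → ℂ}, MeasurableSet S →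
      Integrable (S.indicator f) → ∃ F : (Fin d → ℝ) → ℂ, Measurable F ∧ Integrable F ∧
      (∀ x ∉ S, F x = 0) ∧ fullExt Φ (S.indicator f) = fullExt Φ F ∧
      (∫⁻ x, ‖F x‖ₑ ^ r) ^ r⁻¹ ≤
        eLpNorm f (ENNReal.ofReal p) volume * volume S ^ (1 / r - 1 / p) := by
    intro S f mS hf
    have hfm : AEStronglyMeasurable f (volume.restrict S) :=
      ((integrable_indicator_iff mS).1 hf).aestronglyMeasurable
    have hae : S.indicator f =ᵐ[volume] S.indicator (hfm.mk f) :=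
      (ae_eq_restrict_iff_indicator_ae_eq mS).1 hfm.ae_eq_mk
    refine ⟨S.indicator (hfm.mk f), hfm.stronglyMeasurable_mk.measurable.indicator mS,
      hf.congr hae, fun x hx => Set.indicator_of_notMem hx _, ?_, ?_⟩
    · funext z
      refine integral_congr_ae ?_
      filter_upwards [hae] with x hx
      rw [hx]
    · have e : (∫⁻ x, ‖S.indicator (hfm.mk f) x‖ₑ ^ r) ^ r⁻¹ =
          eLpNorm f (ENNReal.ofReal r) (volume.restrict S) := by
        rw [← eLpNorm_indicator_eq_eLpNorm_restrict mS, eLpNorm_congr_ae hae,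
          eLpNorm_eq_lintegral_rpow_enorm_toReal (by simpa using hr) (by simp),
          ENNReal.toReal_ofReal hr.le, one_div]
      rw [e]
      refine (eLpNorm_le_eLpNorm_mul_rpow_measure_univ (f := f) (ENNReal.ofReal_le_ofReal hrp) hfm).trans ?_
      rw [ENNReal.toReal_ofReal hr.le, ENNReal.toReal_ofReal hp0.le, Measure.restrict_apply_univ]
      gcongr
      exact Measure.restrict_le_self
  refine ⟨C * volume S₁ ^ (1 / r - 1 / p) * volume S₂ ^ (1 / r - 1 / p),
    ENNReal.mul_ne_top (ENNReal.mul_ne_top hC (ENNReal.rpow_ne_top_of_nonneg hexp hS₁))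
      (ENNReal.rpow_ne_top_of_nonneg hexp hS₂), fun f g => ?_⟩
  by_cases hf : Integrable (S₁.indicator f)
  swap
  · simp [fullExt_eq_zero_of_not_integrable hΦ hf]
  by_cases hg : Integrable (S₂.indicator g)
  swap
  · simp [fullExt_eq_zero_of_not_integrable hΦ hg]
  obtain ⟨F, mF, iF, sF, eF, bF⟩ := hrep mS₁ hf
  obtain ⟨G, mG, iG, sG, eG, bG⟩ := hrep mS₂ hg
  rw [eF, eG, eLpNorm_eq_lintegral_rpow_enorm_toReal (by simpa using hq0) (by simp),
    ENNReal.toReal_ofReal hq0.le]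
  calc (∫⁻ z, ‖fullExt Φ F z * fullExt Φ G z‖ₑ ^ q) ^ (1 / q)
      ≤ ((C * (∫⁻ x, ‖F x‖ₑ ^ r) ^ r⁻¹ * (∫⁻ x, ‖G x‖ₑ ^ r) ^ r⁻¹) ^ q) ^ (1 / q) :=
        ENNReal.rpow_le_rpow (H F G mF mG iF iG sF sG) (by positivity)
    _ = C * (∫⁻ x, ‖F x‖ₑ ^ r) ^ r⁻¹ * (∫⁻ x, ‖G x‖ₑ ^ r) ^ r⁻¹ := by
        rw [← ENNReal.rpow_mul, mul_one_div_cancel hq0.ne', ENNReal.rpow_one]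
    _ ≤ C * (eLpNorm f (ENNReal.ofReal p) volume * volume S₁ ^ (1 / r - 1 / p)) *
          (eLpNorm g (ENNReal.ofReal p) volume * volume S₂ ^ (1 / r - 1 / p)) := by gcongr
    _ = _ := by ring

end

/-- **Proposition (endpoint estimates for `q ≥ 2`).** If `det M(t,ν₁,ν₂,ν) ≠ 0`
for all `ν₁ ∈ S₁`, `ν₂ ∈ S₂`, `|t| = 1` and `ν ∈ {ν₁, ν₂}`, then for `q ≥ 2`
and `1/p + ((d+3k)/(d+k))·(1/(2q)) ≤ 1` the bilinear estimate
`‖E₁f · E₂g‖_{L^q(ℝ^{d+k})} ≤ C ‖f‖_{L^p} ‖g‖_{L^p}` holds. -/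
theorem bilinear_restriction_endpoint
    (d k : ℕ) (hd : 1 ≤ d) (hk : 1 ≤ k)
    (Φ : (Fin d → ℝ) → Fin k → ℝ) (hΦ : ContDiff ℝ (⊤ : ℕ∞) Φ)
    (S₁ S₂ : Set (Fin d → ℝ))
    (hS₁ : IsClosedCube d S₁) (hS₂ : IsClosedCube d S₂)
    (hS₁I : S₁ ⊆ Set.Icc (-1) 1) (hS₂I : S₂ ⊆ Set.Icc (-1) 1)
    (hM : ∀ ν₁ ∈ S₁, ∀ ν₂ ∈ S₂, ∀ t : Fin k → ℝ, (∑ i, t i ^ 2) = 1 →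
      ∀ ν, (ν = ν₁ ∨ ν = ν₂) → (Mmat d k Φ t ν₁ ν₂ ν).det ≠ 0)
    (q p : ℝ) (hp : 1 ≤ p) (hq : 2 ≤ q)
    (hpq : 1 / p + (((d : ℝ) + 3 * k) / ((d : ℝ) + k)) * (1 / (2 * q)) ≤ 1) :
    ∃ C : ℝ, ∀ f g : (Fin d → ℝ) → ℂ,
      eLpNorm (fun w => extOp d k S₁ Φ f w * extOp d k S₂ Φ g w)
          (ENNReal.ofReal q) volume ≤
        ENNReal.ofReal C * eLpNorm f (ENNReal.ofReal p) volume *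
          eLpNorm g (ENNReal.ofReal p) volume := by
  have hdk : k ≤ d := by
    by_contra! hlt
    obtain ⟨ν₁, h₁⟩ := hS₁.nonempty
    obtain ⟨ν₂, h₂⟩ := hS₂.nonempty
    refine hM ν₁ h₁ ν₂ h₂ (Pi.single ⟨0, hk⟩ 1) ?_ ν₁ (.inl rfl)
      (det_Mmat_eq_zero_of_lt hlt Φ _ ν₁ ν₂ ν₁)
    rw [Finset.sum_eq_single ⟨0, hk⟩ (fun i _ hi => by simp [hi]) (by simp)]
    simp
  have c₁ := hS₁.isCompact hS₁I
  have c₂ := hS₂.isCompact hS₂I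
  have hd' : (1 : ℝ) ≤ d := by exact_mod_cast hd
  have hk' : (1 : ℝ) ≤ k := by exact_mod_cast hk
  have hp0 : 0 < p := by linarith
  have hq0 : 0 < q := by linarith
  set P : ℝ := 4 * ((d : ℝ) + k) / (3 * d + k) with hPdef
  have hP : 0 < P := by positivity
  set s : ℝ := (1 - 2 / q) + P⁻¹ * (2 / q) with hs
  have es : s = 1 - (((d : ℝ) + 3 * k) / ((d : ℝ) + k)) * (1 / (2 * q)) := by
    rw [hs, hPdef]
    field_simp
    ring
  have hps : p⁻¹ ≤ s := by rw [es, ← one_div]; linarith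
  have hs0 : 0 < s := (inv_pos.2 hp0).trans_le hps
  obtain ⟨C, hC, H⟩ := (bilinearBound_of_isCompact hd hdk hΦ c₁ c₂ hM).exists_eLpNorm_le
    (r := s⁻¹) (p := p) hΦ.continuous hP c₁.measurableSet c₂.measurableSet
    c₁.measure_lt_top.ne c₂.measure_lt_top.ne hq (inv_pos.2 hs0) (inv_inv s)
    (inv_le_of_inv_le₀ hp0 hps)
  refine ⟨C.toReal, fun f g => ?_⟩
  rw [ENNReal.ofReal_toReal hC, extOp_eq_fullExt c₁.measurableSet,
    extOp_eq_fullExt c₂.measurableSet]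
  exact H f g

end
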